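/- arXiv:2501.06854 — 2 statements merged into one kernel-verified Lean document; each statement's English description precedes it below -/
import Mathlib

section
/- Let c > 0 and suppose that the following (Paouris-type) bound holds: for every dimension m ≥ 1, every b-subgaussian log-concave random vector Y in ℝᵐ with invertible covariance matrix B, every z ∈ ℝᵐ, and every 0 < ε < c, one has ℙ(‖Y − z‖₂² ≤ ε·Tr(B)) ≤ ε^{c·Tr(B)/(b²·‖B‖_op·‖B⁻¹‖_op)}. Then for every n ≥ 1, every b-subgaussian log-concave random vector X in ℝⁿ with covariance matrix A, every y ∈ ℝⁿ, and every 0 < ε < c, one has ℙ(‖X − y‖₂² ≤ ε·Tr(A)) ≤ (4n·‖A‖_op·ε / Tr(A))^{c·Tr(A)³/(8 n² b² ‖A‖_op²)}. -/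
open MeasureTheory ProbabilityTheory

noncomputable section

/-- A nonnegative function is log-concave if it satisfies
`f(t x + (1-t) y) ≥ f(x)^t f(y)^(1-t)`; this is equivalent to `f = e^{-V}`
for some convex function `V : ℝⁿ → ℝ ∪ {+∞}`. -/
def IsLogConcaveFun {E : Type*} [AddCommGroup E] [Module ℝ E] (f : E → ℝ) : Prop :=
  (∀ x, 0 ≤ f x) ∧
  ∀ x y : E, ∀ t : ℝ, 0 ≤ t → t ≤ 1 →
    f x ^ t * f y ^ (1 - t) ≤ f (t • x + (1 - t) • y)

/-- A measure on `ℝⁿ` is log-concave (with density) if it has a log-concave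
density with respect to the Lebesgue measure. -/
def IsLogConcaveMeasure {n : ℕ} (μ : Measure (EuclideanSpace ℝ (Fin n))) : Prop :=
  ∃ f : EuclideanSpace ℝ (Fin n) → ℝ, IsLogConcaveFun f ∧
    μ = volume.withDensity fun x => ENNReal.ofReal (f x)

/-- A measure on `ℝⁿ` is isotropic if it has mean `0` and covariance matrix `Iₙ`. -/
def IsIsotropicMeasure {n : ℕ} (μ : Measure (EuclideanSpace ℝ (Fin n))) : Prop :=
  (∀ i, ∫ x, x i ∂μ = 0) ∧
  (∀ i j, ∫ x, x i * x j ∂μ = if i = j then 1 else 0)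


open RealInnerProductSpace in
/-- The mean (barycenter) of a measure on `ℝⁿ`, computed coordinatewise. -/
def meanVec {n : ℕ} (μ : Measure (EuclideanSpace ℝ (Fin n))) : EuclideanSpace ℝ (Fin n) :=
  (EuclideanSpace.equiv (Fin n) ℝ).symm fun i => ∫ x, x i ∂μ

/-- The covariance matrix `A = 𝔼[(X - 𝔼X)(X - 𝔼X)ᵀ]` of a measure on `ℝⁿ`. -/
def covMatrix {n : ℕ} (μ : Measure (EuclideanSpace ℝ (Fin n))) : Matrix (Fin n) (Fin n) ℝ :=
  Matrix.of fun i j => ∫ x, (x i - meanVec μ i) * (x j - meanVec μ j) ∂μ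

open RealInnerProductSpace in
/-- A random vector (identified with its law `μ`) is `b`-subgaussian if
`(𝔼 |⟨X - 𝔼X, θ⟩|ᵖ)^{1/p} ≤ b √p` for all `p ≥ 1` and all unit vectors `θ`. -/
def IsSubgaussianWith {n : ℕ} (b : ℝ) (μ : Measure (EuclideanSpace ℝ (Fin n))) : Prop :=
  ∀ p : ℝ, 1 ≤ p → ∀ θ : EuclideanSpace ℝ (Fin n), ‖θ‖ = 1 →
    (∫ x, |⟪x - meanVec μ, θ⟫| ^ p ∂μ) ^ (1 / p) ≤ b * Real.sqrt p

/-- The operator norm of a matrix, acting on Euclidean space. -/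
def matOpNorm {n : ℕ} (A : Matrix (Fin n) (Fin n) ℝ) : ℝ :=
  ‖Matrix.toEuclideanCLM (𝕜 := ℝ) A‖

section Auxiliary

open scoped ENNReal Pointwise NNReal
open Filter Topology Set

/-- A measure satisfies the Prékopa–Leindler inequality. -/
def IsPrekopaLeindler {E : Type*} [AddCommGroup E] [Module ℝ E] [MeasurableSpace E]
    (μ : Measure E) : Prop :=
  ∀ ⦃s t : ℝ⦄, 0 < s → 0 < t → s + t = 1 → ∀ ⦃f g h : E → ℝ≥0∞⦄,
    Measurable f → Measurable g → Measurable h →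
    (∀ x y, f x ^ s * g y ^ t ≤ h (s • x + t • y)) →
    (∫⁻ x, f x ∂μ) ^ s * (∫⁻ x, g x ∂μ) ^ t ≤ ∫⁻ x, h x ∂μ

theorem exists_compact_seq_tendsto_volume {A : Set ℝ} (hA : MeasurableSet A) (hne : A.Nonempty) :
    ∃ K : ℕ → Set ℝ, (∀ n, IsCompact (K n) ∧ (K n).Nonempty ∧ K n ⊆ A) ∧
      Tendsto (fun n => volume (K n)) atTop (𝓝 (volume A)) := by
  by_cases h0 : volume A = 0
  · obtain ⟨a, ha⟩ := hne
    exact ⟨fun _ => {a}, fun _ => ⟨isCompact_singleton, singleton_nonempty a, by simpa using ha⟩,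
      by simp [h0]⟩
  · obtain ⟨u, -, hu, hlim⟩ := exists_seq_strictMono_tendsto' (pos_iff_ne_zero.2 h0)
    choose K hKA hK huK using fun n => hA.exists_lt_isCompact (hu n).2
    refine ⟨K, fun n => ⟨hK n, ?_, hKA n⟩, ?_⟩
    · exact nonempty_of_measure_ne_zero (ne_bot_of_gt (huK n))
    · exact tendsto_of_tendsto_of_tendsto_of_le_of_le hlim tendsto_const_nhds
        (fun n => (huK n).le) (fun n => measure_mono (hKA n))

theorem volume_image_smul_add (s c : ℝ) (hs : 0 < s) (K : Set ℝ) :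
    volume ((fun x => s * x + c) '' K) = ENNReal.ofReal s * volume K := by
  have : (fun x => s * x + c) '' K = (fun x => x + c) '' (s • K) := by
    rw [← image_smul, image_image]; rfl
  rw [this, image_add_right, measure_preimage_add_right, Measure.addHaar_smul]
  simp [abs_of_pos hs]

/-- The one-dimensional Brunn–Minkowski inequality. -/
theorem brunnMinkowski_real {s t : ℝ} (hs : 0 < s) (ht : 0 < t) {A B C : Set ℝ}
    (hA : MeasurableSet A) (hB : MeasurableSet B) (hAne : A.Nonempty) (hBne : B.Nonempty)
    (hC : ∀ a ∈ A, ∀ b ∈ B, s * a + t * b ∈ C) :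
    ENNReal.ofReal s * volume A + ENNReal.ofReal t * volume B ≤ volume C := by
  obtain ⟨K, hK, hKlim⟩ := exists_compact_seq_tendsto_volume hA hAne
  obtain ⟨L, hL, hLlim⟩ := exists_compact_seq_tendsto_volume hB hBne
  refine le_of_tendsto ((ENNReal.Tendsto.const_mul hKlim (Or.inr ENNReal.ofReal_ne_top)).add
    (ENNReal.Tendsto.const_mul hLlim (Or.inr ENNReal.ofReal_ne_top))) (Eventually.of_forall ?_)
  intro n
  obtain ⟨hKc, hKne, hKA⟩ := hK n
  obtain ⟨hLc, hLne, hLB⟩ := hL n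
  obtain ⟨k, hk, hkmax⟩ := hKc.exists_isGreatest hKne
  obtain ⟨l, hl, hlmin⟩ := hLc.exists_isLeast hLne
  have hd : AEDisjoint volume ((fun x => s * x + t * l) '' K n)
      ((fun x => t * x + s * k) '' L n) := by
    refine measure_mono_null (t := {s * k + t * l}) ?_ (by simp)
    rintro _ ⟨⟨x, hx, rfl⟩, ⟨y, hy, hxy⟩⟩
    have h1 := mul_le_mul_of_nonneg_left (hkmax hx) hs.le
    have h2 := mul_le_mul_of_nonneg_left (hlmin hy) ht.le
    simp only [mem_singleton_iff] at *
    linarith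
  rw [← volume_image_smul_add s (t * l) hs, ← volume_image_smul_add t (s * k) ht,
    ← measure_union₀ (hLc.image (by fun_prop)).measurableSet.nullMeasurableSet hd]
  refine measure_mono (union_subset ?_ ?_)
  · rintro _ ⟨x, hx, rfl⟩; exact hC x (hKA hx) l (hLB hl)
  · rintro _ ⟨x, hx, rfl⟩; simpa [add_comm] using hC k (hKA hk) x (hLB hx)

theorem lintegral_eq_lintegral_meas_lt_Ioo {f : ℝ → ℝ≥0∞} (hf : Measurable f) (h1 : ∀ x, f x ≤ 1) :
    ∫⁻ x, f x = ∫⁻ r in Ioo (0 : ℝ) 1, volume {x | ENNReal.ofReal r < f x} := by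
  have hfin : ∀ x, f x ≠ ∞ := fun x => ((h1 x).trans_lt ENNReal.one_lt_top).ne
  have h := lintegral_eq_lintegral_meas_lt volume (f := fun x => (f x).toReal)
    (Eventually.of_forall fun x => ENNReal.toReal_nonneg) hf.ennreal_toReal.aemeasurable
  simp only [ENNReal.ofReal_toReal (hfin _)] at h
  rw [h, ← Ioo_union_Ici_eq_Ioi zero_lt_one, lintegral_union measurableSet_Ici]
  · have h2 : ∫⁻ r in Ici (1 : ℝ), volume {x | r < (f x).toReal} = 0 := by
      rw [setLIntegral_congr_fun (g := fun _ => 0) measurableSet_Ici]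
      · simp
      · intro r hr
        have : {x | r < (f x).toReal} = ∅ := by
          ext x
          simp only [mem_ofPred_eq, mem_empty_iff_false, iff_false, not_lt]
          exact (ENNReal.toReal_mono ENNReal.one_ne_top (h1 x)).trans (by simpa using hr)
        simp [this]
    rw [h2, add_zero]
    refine setLIntegral_congr_fun measurableSet_Ioo fun r hr => ?_
    simp only [ENNReal.ofReal_lt_iff_lt_toReal hr.1.le (hfin _)]
  · exact disjoint_left.2 fun x hx hx' => not_lt.2 hx' hx.2

theorem prekopaLeindler_normalized {s t : ℝ} (hs : 0 < s) (ht : 0 < t) (hst : s + t = 1)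
    {f g h : ℝ → ℝ≥0∞} (hf : Measurable f) (hg : Measurable g) (hh : Measurable h)
    (hfs : ⨆ x, f x = 1) (hgs : ⨆ x, g x = 1)
    (H : ∀ x y, f x ^ s * g y ^ t ≤ h (s * x + t * y)) :
    ENNReal.ofReal s * (∫⁻ x, f x) + ENNReal.ofReal t * (∫⁻ x, g x) ≤ ∫⁻ x, h x := by
  have hf1 : ∀ x, f x ≤ 1 := fun x => hfs ▸ le_iSup f x
  have hg1 : ∀ x, g x ≤ 1 := fun x => hgs ▸ le_iSup g x
  have hmin : ∫⁻ x, min (h x) 1 ≤ ∫⁻ x, h x := lintegral_mono fun x => min_le_left _ _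
  refine le_trans ?_ hmin
  rw [lintegral_eq_lintegral_meas_lt_Ioo hf hf1, lintegral_eq_lintegral_meas_lt_Ioo hg hg1,
    lintegral_eq_lintegral_meas_lt_Ioo (hh.min measurable_const) (fun x => min_le_right _ _),
    ← lintegral_const_mul' _ _ ENNReal.ofReal_ne_top,
    ← lintegral_const_mul' _ _ ENNReal.ofReal_ne_top,
    ← lintegral_add_left']
  · refine setLIntegral_mono' measurableSet_Ioo fun r hr => ?_
    have hr1 : ENNReal.ofReal r < 1 := by simpa using hr.2
    obtain ⟨x0, hx0⟩ := lt_iSup_iff.1 (hr1.trans_eq hfs.symm)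
    obtain ⟨y0, hy0⟩ := lt_iSup_iff.1 (hr1.trans_eq hgs.symm)
    refine brunnMinkowski_real hs ht (measurableSet_lt measurable_const hf)
      (measurableSet_lt measurable_const hg) ⟨x0, hx0⟩ ⟨y0, hy0⟩ ?_
    intro a ha b hb
    simp only [mem_ofPred_eq] at ha hb ⊢
    refine lt_min (lt_of_lt_of_le ?_ (H a b)) hr1
    have hr0 : ENNReal.ofReal r ≠ 0 := by simpa using hr.1
    calc ENNReal.ofReal r = ENNReal.ofReal r ^ s * ENNReal.ofReal r ^ t := by
          rw [← ENNReal.rpow_add _ _ hr0 ENNReal.ofReal_ne_top, hst, ENNReal.rpow_one]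
      _ < f a ^ s * g b ^ t :=
          ENNReal.mul_lt_mul (ENNReal.rpow_lt_rpow ha hs) (ENNReal.rpow_lt_rpow hb ht)
  · refine (Measurable.const_mul (Antitone.measurable ?_) _).aemeasurable
    intro r r' hrr'
    exact measure_mono fun x hx => lt_of_le_of_lt (ENNReal.ofReal_le_ofReal hrr') hx

theorem ennreal_geom_mean_le {s t : ℝ} (hs : 0 < s) (ht : 0 < t) (hst : s + t = 1) (a b : ℝ≥0∞) :
    a ^ s * b ^ t ≤ ENNReal.ofReal s * a + ENNReal.ofReal t * b := by
  rcases eq_or_ne a ∞ with rfl | ha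
  · simp [hs]
  rcases eq_or_ne b ∞ with rfl | hb
  · simp [ht]
  lift a to NNReal using ha
  lift b to NNReal using hb
  rw [← ENNReal.coe_rpow_of_nonneg _ hs.le, ← ENNReal.coe_rpow_of_nonneg _ ht.le]
  have := NNReal.geom_mean_le_arith_mean2_weighted s.toNNReal t.toNNReal a b
    (by rw [← Real.toNNReal_add hs.le ht.le, hst, Real.toNNReal_one])
  rw [Real.coe_toNNReal _ hs.le, Real.coe_toNNReal _ ht.le] at this
  rw [ENNReal.ofReal, ENNReal.ofReal]
  exact_mod_cast this

theorem prekopaLeindler_bounded {s t : ℝ} (hs : 0 < s) (ht : 0 < t) (hst : s + t = 1)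
    {f g h : ℝ → ℝ≥0∞} (hf : Measurable f) (hg : Measurable g) (hh : Measurable h)
    (hfs : ⨆ x, f x ≠ ∞) (hgs : ⨆ x, g x ≠ ∞)
    (H : ∀ x y, f x ^ s * g y ^ t ≤ h (s * x + t * y)) :
    (∫⁻ x, f x) ^ s * (∫⁻ x, g x) ^ t ≤ ∫⁻ x, h x := by
  set a := ⨆ x, f x with ha
  set b := ⨆ x, g x with hb
  rcases eq_or_ne a 0 with ha0 | ha0
  · have : ∀ x, f x = 0 := by simpa [ha] using ha0
    simp [this, hs]
  rcases eq_or_ne b 0 with hb0 | hb0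
  · have : ∀ x, g x = 0 := by simpa [hb] using hb0
    simp [this, ht]
  have key := prekopaLeindler_normalized hs ht hst (f := fun x => a⁻¹ * f x)
    (g := fun x => b⁻¹ * g x) (h := fun x => ((a⁻¹) ^ s * (b⁻¹) ^ t) * h x) (hf.const_mul _)
    (hg.const_mul _) (hh.const_mul _)
    (by rw [← ENNReal.mul_iSup, ENNReal.inv_mul_cancel ha0 hfs])
    (by rw [← ENNReal.mul_iSup, ENNReal.inv_mul_cancel hb0 hgs])
    (fun x y => by
      rw [ENNReal.mul_rpow_of_nonneg _ _ hs.le, ENNReal.mul_rpow_of_nonneg _ _ ht.le,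
        mul_mul_mul_comm]
      gcongr
      exact H x y)
  rw [lintegral_const_mul _ hf, lintegral_const_mul _ hg, lintegral_const_mul _ hh] at key
  have h2 := (ennreal_geom_mean_le hs ht hst _ _).trans key
  rw [ENNReal.mul_rpow_of_nonneg _ _ hs.le, ENNReal.mul_rpow_of_nonneg _ _ ht.le,
        mul_mul_mul_comm] at h2
  refine (ENNReal.mul_le_mul_iff_right ?_ ?_).1 h2
  · have : ∀ c : ℝ≥0∞, c ≠ ∞ → ∀ p : ℝ, 0 < p → c⁻¹ ^ p ≠ 0 := fun c hc p hp => by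
      simp [hp, hc, hp.le]
    exact mul_ne_zero (this a hfs s hs) (this b hgs t ht)
  · exact ENNReal.mul_ne_top (ENNReal.rpow_ne_top_of_nonneg hs.le (by simpa))
      (ENNReal.rpow_ne_top_of_nonneg ht.le (by simpa))

theorem tendsto_lintegral_min_natCast {E : Type*} [MeasurableSpace E] (μ : Measure E)
    {f : E → ℝ≥0∞} (hf : Measurable f) :
    Tendsto (fun M : ℕ => ∫⁻ x, min (f x) M ∂μ) atTop (𝓝 (∫⁻ x, f x ∂μ)) := by
  refine lintegral_tendsto_of_tendsto_of_monotone
    (fun M => (hf.min measurable_const).aemeasurable) (Eventually.of_forall fun x M N hMN => ?_)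
    (Eventually.of_forall fun x => ?_)
  · exact min_le_min_left _ (by exact_mod_cast hMN)
  · simpa using (tendsto_const_nhds (x := f x)).min ENNReal.tendsto_nat_nhds_top

theorem isPrekopaLeindler_volume_real : IsPrekopaLeindler (volume : Measure ℝ) := by
  intro s t hs ht hst f g h hf hg hh H
  rcases eq_or_ne (∫⁻ x, f x) 0 with hf0 | hf0
  · simp [hf0, hs]
  rcases eq_or_ne (∫⁻ x, g x) 0 with hg0 | hg0
  · simp [hg0, ht]
  have hlim := ENNReal.Tendsto.mul
    ((ENNReal.continuous_rpow_const (y := s)).continuousAt.tendsto.comp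
      (tendsto_lintegral_min_natCast volume hf)) (Or.inl (by simp [hf0, hs, hs.le]))
    ((ENNReal.continuous_rpow_const (y := t)).continuousAt.tendsto.comp
      (tendsto_lintegral_min_natCast volume hg)) (Or.inl (by simp [hg0, ht, ht.le]))
  refine le_of_tendsto hlim (Eventually.of_forall fun M => ?_)
  refine prekopaLeindler_bounded hs ht hst (hf.min measurable_const) (hg.min measurable_const) hh
    ?_ ?_ fun x y => le_trans ?_ (H x y)
  · exact ((iSup_le fun x => min_le_right _ _).trans_lt (ENNReal.natCast_lt_top M)).ne
  · exact ((iSup_le fun x => min_le_right _ _).trans_lt (ENNReal.natCast_lt_top M)).ne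
  · gcongr <;> exact min_le_left _ _

namespace IsPrekopaLeindler

variable {E F : Type*} [AddCommGroup E] [Module ℝ E] [MeasurableSpace E]
  [AddCommGroup F] [Module ℝ F] [MeasurableSpace F]

theorem map {μ : Measure E} (hμ : IsPrekopaLeindler μ) {T : E → F} (hT : Measurable T)
    (hlin : ∀ (s t : ℝ), s + t = 1 → ∀ x y : E, T (s • x + t • y) = s • T x + t • T y) :
    IsPrekopaLeindler (μ.map T) := by
  intro s t hs ht hst f g h hf hg hh H
  rw [lintegral_map hf hT, lintegral_map hg hT, lintegral_map hh hT]
  exact hμ hs ht hst (hf.comp hT) (hg.comp hT) (hh.comp hT)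
    fun x y => by simpa [hlin s t hst] using H (T x) (T y)

theorem prod {μ : Measure E} {ν : Measure F} [SFinite ν]
    (hμ : IsPrekopaLeindler μ) (hν : IsPrekopaLeindler ν) :
    IsPrekopaLeindler (μ.prod ν) := by
  intro s t hs ht hst f g h hf hg hh H
  rw [lintegral_prod _ hf.aemeasurable, lintegral_prod _ hg.aemeasurable,
    lintegral_prod _ hh.aemeasurable]
  refine hμ hs ht hst hf.lintegral_prod_right' hg.lintegral_prod_right' hh.lintegral_prod_right'
    fun x y => ?_
  exact hν hs ht hst (hf.comp measurable_prodMk_left) (hg.comp measurable_prodMk_left)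
    (hh.comp measurable_prodMk_left) fun u v => H (x, u) (y, v)

theorem pi_fin {μ : Measure E} [SigmaFinite μ] (hμ : IsPrekopaLeindler μ) (d : ℕ) :
    IsPrekopaLeindler (Measure.pi fun _ : Fin d => μ) := by
  induction d with
  | zero =>
    intro s t hs ht hst f g h hf hg hh H
    rw [Measure.pi_of_empty _ (fun i => i.elim0), lintegral_dirac' _ hf, lintegral_dirac' _ hg,
      lintegral_dirac' _ hh]
    exact (H _ _).trans_eq (congrArg h (Subsingleton.elim _ _))
  | succ d ih =>
    have hp := (measurePreserving_piFinSuccAbove (fun _ : Fin (d + 1) => μ) 0).symm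
    rw [← hp.map_eq]
    refine (hμ.prod ih).map hp.measurable fun s t _ x y => ?_
    ext i
    refine Fin.cases ?_ (fun j => ?_) i <;>
    simp [MeasurableEquiv.piFinSuccAbove, Fin.insertNthEquiv]

theorem pi {ι : Type*} [Fintype ι] {μ : Measure E} [SigmaFinite μ] (hμ : IsPrekopaLeindler μ) :
    IsPrekopaLeindler (Measure.pi fun _ : ι => μ) := by
  have hp := measurePreserving_piCongrLeft (fun _ : ι => μ) (Fintype.equivFin ι).symm
  rw [← hp.map_eq]
  refine (hμ.pi_fin _).map hp.measurable fun s t _ x y => ?_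
  ext i
  obtain ⟨j, rfl⟩ := (Fintype.equivFin ι).symm.surjective i
  simp only [Pi.add_apply, Pi.smul_apply]
  iterate 3 rw [MeasurableEquiv.piCongrLeft_apply_apply]
  rfl

theorem withDensity {μ : Measure E} (hμ : IsPrekopaLeindler μ) {ρ : E → ℝ≥0∞}
    (hρ : Measurable ρ)
    (hρc : ∀ ⦃s t : ℝ⦄, 0 < s → 0 < t → s + t = 1 → ∀ x y, ρ x ^ s * ρ y ^ t ≤ ρ (s • x + t • y)) :
    IsPrekopaLeindler (μ.withDensity ρ) := by
  intro s t hs ht hst f g h hf hg hh H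
  rw [lintegral_withDensity_eq_lintegral_mul _ hρ hf,
    lintegral_withDensity_eq_lintegral_mul _ hρ hg,
    lintegral_withDensity_eq_lintegral_mul _ hρ hh]
  refine hμ hs ht hst (hρ.mul hf) (hρ.mul hg) (hρ.mul hh) fun x y => ?_
  simp only [Pi.mul_apply]
  rw [ENNReal.mul_rpow_of_nonneg _ _ hs.le, ENNReal.mul_rpow_of_nonneg _ _ ht.le,
    mul_mul_mul_comm]
  exact mul_le_mul' (hρc hs ht hst x y) (H x y)

end IsPrekopaLeindler

theorem isPrekopaLeindler_volume_euclideanSpace (n : ℕ) :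
    IsPrekopaLeindler (volume : Measure (EuclideanSpace ℝ (Fin n))) := by
  have hp := (PiLp.volume_preserving_toLp (Fin n))
  rw [← hp.map_eq]
  exact (isPrekopaLeindler_volume_real.pi_fin n).map hp.measurable fun s t _ x y => by simp

/-- A log-concave function agrees almost everywhere with a Borel log-concave function. -/
theorem IsLogConcaveFun.exists_measurable_ae_eq {n : ℕ} {f : EuclideanSpace ℝ (Fin n) → ℝ}
    (hf : IsLogConcaveFun f) :
    ∃ ρ : EuclideanSpace ℝ (Fin n) → ℝ≥0∞, Measurable ρ ∧
      (∀ ⦃s t : ℝ⦄, 0 < s → 0 < t → s + t = 1 → ∀ x y,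
        ρ x ^ s * ρ y ^ t ≤ ρ (s • x + t • y)) ∧
      (fun x => ENNReal.ofReal (f x)) =ᵐ[volume] ρ := by
  obtain ⟨h0, hf⟩ := hf
  set D := {x | 0 < f x} with hD
  have hf' : ∀ x y, ∀ s t : ℝ, 0 ≤ s → 0 ≤ t → s + t = 1 →
      f x ^ s * f y ^ t ≤ f (s • x + t • y) := by
    intro x y s t hs ht hst
    obtain rfl : t = 1 - s := by linarith
    exact hf x y s hs (by linarith)
  have hDc : Convex ℝ D := by
    intro x hx y hy s t hs ht hst
    exact lt_of_lt_of_le (mul_pos (Real.rpow_pos_of_pos hx _) (Real.rpow_pos_of_pos hy _))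
      (hf' x y s t hs ht hst)
  have hconc : ConcaveOn ℝ D fun x => Real.log (f x) := by
    refine ⟨hDc, fun x hx y hy s t hs ht hst => ?_⟩
    have h1 := Real.log_le_log (mul_pos (Real.rpow_pos_of_pos hx _) (Real.rpow_pos_of_pos hy _))
      (hf' x y s t hs ht hst)
    rwa [Real.log_mul (Real.rpow_pos_of_pos hx _).ne' (Real.rpow_pos_of_pos hy _).ne',
      Real.log_rpow hx, Real.log_rpow hy] at h1
  have hcont : ContinuousOn f (interior D) := by
    refine (hconc.continuousOn_interior.rexp).congr fun x hx => ?_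
    have hx' : x ∈ D := interior_subset hx
    exact (Real.exp_log hx').symm
  refine ⟨(interior D).indicator fun x => ENNReal.ofReal (f x), ?_, ?_, ?_⟩
  · classical
    rw [← Set.piecewise_eq_indicator]
    exact (ENNReal.continuous_ofReal.comp_continuousOn hcont).measurable_piecewise
      continuousOn_const isOpen_interior.measurableSet
  · intro s t hs ht hst x y
    by_cases hx : x ∈ interior D
    · by_cases hy : y ∈ interior D
      · rw [indicator_of_mem hx, indicator_of_mem hy,
          indicator_of_mem (hDc.interior hx hy hs.le ht.le hst),
          ENNReal.ofReal_rpow_of_nonneg (h0 x) hs.le, ENNReal.ofReal_rpow_of_nonneg (h0 y) ht.le,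
          ← ENNReal.ofReal_mul (Real.rpow_nonneg (h0 x) s)]
        exact ENNReal.ofReal_le_ofReal (hf' x y s t hs.le ht.le hst)
      · simp [indicator_of_notMem hy, ht]
    · simp [indicator_of_notMem hx, hs]
  · have hfr : ∀ᵐ x ∂(volume : Measure (EuclideanSpace ℝ (Fin n))), x ∉ frontier D :=
      measure_eq_zero_iff_ae_notMem.1 (hDc.addHaar_frontier volume)
    filter_upwards [hfr] with x hx
    by_cases hxi : x ∈ interior D
    · rw [indicator_of_mem hxi]
    · rw [indicator_of_notMem hxi]
      have : x ∉ D := fun hxD => hx ⟨subset_closure hxD, hxi⟩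
      simpa [hD] using this

theorem IsLogConcaveMeasure.isPrekopaLeindler {n : ℕ} {μ : Measure (EuclideanSpace ℝ (Fin n))}
    (hμ : IsLogConcaveMeasure μ) : IsPrekopaLeindler μ := by
  obtain ⟨f, hf, rfl⟩ := hμ
  obtain ⟨ρ, hρ, hρc, hae⟩ := hf.exists_measurable_ae_eq
  rw [withDensity_congr_ae hae]
  exact (isPrekopaLeindler_volume_euclideanSpace n).withDensity hρ hρc

theorem IsPrekopaLeindler.measure_le {E : Type*} [AddCommGroup E] [Module ℝ E]
    [MeasurableSpace E] {μ : Measure E} (hμ : IsPrekopaLeindler μ) {s t : ℝ} (hs : 0 < s)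
    (ht : 0 < t) (hst : s + t = 1) {A B C : Set E} (hA : MeasurableSet A) (hB : MeasurableSet B)
    (hC : MeasurableSet C) (H : ∀ x ∈ A, ∀ y ∈ B, s • x + t • y ∈ C) :
    μ A ^ s * μ B ^ t ≤ μ C := by
  have h := hμ hs ht hst (f := A.indicator 1) (g := B.indicator 1) (h := C.indicator 1)
    (measurable_one.indicator hA) (measurable_one.indicator hB) (measurable_one.indicator hC)
    fun x y => by
      by_cases hx : x ∈ A
      · by_cases hy : y ∈ B
        · simp [hx, hy, H x hx y hy]
        · simp [hy, ht]
      · simp [hx, hs]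
  simpa [lintegral_indicator_one, hA, hB, hC] using h

theorem ENNReal.rpow_liminf {α : Type*} {l : Filter α} {u : α → ℝ≥0∞} {s : ℝ} (hs : 0 < s) :
    (liminf u l) ^ s = liminf (fun i => u i ^ s) l := by
  simpa [ENNReal.orderIsoRpow_apply] using
    (ENNReal.orderIsoRpow s hs).liminf_apply (f := l) (u := u)

/-- An absolutely continuous probability measure satisfying the Prékopa–Leindler inequality has a
log-concave density. -/
theorem IsPrekopaLeindler.isLogConcaveMeasure {n : ℕ} {ν : Measure (EuclideanSpace ℝ (Fin n))}
    [IsProbabilityMeasure ν] (hν : IsPrekopaLeindler ν) (hac : ν ≪ volume) :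
    IsLogConcaveMeasure ν := by
  set E := EuclideanSpace ℝ (Fin n)
  let q : E → ℝ → ℝ≥0∞ := fun x r =>
    ν (Metric.closedBall x r) / volume (Metric.closedBall x r)
  let φ : E → ℝ≥0∞ := fun x => liminf (q x) (𝓝[>] 0)
  have hφae : φ =ᵐ[volume] ν.rnDeriv volume := by
    filter_upwards [Besicovitch.ae_tendsto_rnDeriv ν (volume : Measure E)] with x hx
    exact hx.liminf_eq
  have hq : ∀ ⦃s t : ℝ⦄, 0 < s → 0 < t → s + t = 1 → ∀ x y r, 0 < r →
      q x r ^ s * q y r ^ t ≤ q (s • x + t • y) r := by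
    intro s t hs ht hst x y r hr
    simp only [q, Measure.addHaar_closedBall_center (volume : Measure E) _ r]
    have h1 : volume (Metric.closedBall (0 : E) r) ≠ 0 :=
      (Metric.measure_closedBall_pos _ _ hr).ne'
    have h2 : volume (Metric.closedBall (0 : E) r) ≠ ∞ := measure_closedBall_lt_top.ne
    set v := volume (Metric.closedBall (0 : E) r)
    have h3 := hν.measure_le hs ht hst (A := Metric.closedBall x r) (B := Metric.closedBall y r)
      (C := Metric.closedBall (s • x + t • y) r) measurableSet_closedBall measurableSet_closedBall
      measurableSet_closedBall (fun a ha b hb => by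
        rw [mem_closedBall_iff_norm] at *
        have : s • a + t • b - (s • x + t • y) = s • (a - x) + t • (b - y) := by
          simp only [smul_sub]; abel
        rw [this]
        calc _ ≤ ‖s • (a - x)‖ + ‖t • (b - y)‖ := norm_add_le _ _
          _ = s * ‖a - x‖ + t * ‖b - y‖ := by
            rw [norm_smul, norm_smul, Real.norm_of_nonneg hs.le, Real.norm_of_nonneg ht.le]
          _ ≤ s * r + t * r := by gcongr
          _ = r := by rw [← add_mul, hst, one_mul])
    rw [ENNReal.div_rpow_of_nonneg _ _ hs.le, ENNReal.div_rpow_of_nonneg _ _ ht.le,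
      div_eq_mul_inv, div_eq_mul_inv, mul_mul_mul_comm, ← ENNReal.mul_inv,
      ← ENNReal.rpow_add _ _ h1 h2,
      hst, ENNReal.rpow_one, div_eq_mul_inv]
    · gcongr
    · left; simp [h1, h2]
    · left; simp [h1, h2]
  have hφ : ∀ ⦃s t : ℝ⦄, 0 < s → 0 < t → s + t = 1 → ∀ x y,
      φ x ^ s * φ y ^ t ≤ φ (s • x + t • y) := by
    intro s t hs ht hst x y
    simp only [φ]
    rw [ENNReal.rpow_liminf hs, ENNReal.rpow_liminf ht]
    refine ENNReal.le_liminf_mul.trans (liminf_le_liminf ?_)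
    filter_upwards [self_mem_nhdsWithin] with r hr
    exact hq hs ht hst x y r hr
  have hwd : (volume : Measure E).withDensity φ = ν := by
    rw [withDensity_congr_ae hφae, Measure.withDensity_rnDeriv_eq _ _ hac]
  have hlt : ∀ᵐ x ∂(volume : Measure E), φ x < ∞ := by
    filter_upwards [hφae, ν.rnDeriv_lt_top volume] with x h1 h2
    rwa [h1]
  have htop : ∀ x, φ x ≠ ∞ := by
    intro x₀ hx₀
    have hpos : volume {x | 0 < φ x} ≠ 0 := by
      intro h0
      have : φ =ᵐ[volume] 0 := by
        filter_upwards [measure_eq_zero_iff_ae_notMem.1 h0] with x hx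
        simpa using hx
      rw [withDensity_congr_ae this] at hwd
      have h1 := measure_univ (μ := ν)
      rw [← hwd] at h1
      simp at h1
    have hsub : AffineMap.homothety x₀ (1 / 2 : ℝ) '' {x | 0 < φ x} ⊆ {x | ¬ φ x < ∞} := by
      rintro _ ⟨y, hy, rfl⟩
      have h := hφ (s := 1 / 2) (t := 1 / 2) (by norm_num) (by norm_num) (by norm_num) x₀ y
      rw [hx₀, ENNReal.top_rpow_of_pos (by norm_num), ENNReal.top_mul] at h
      · have e : AffineMap.homothety x₀ (1 / 2 : ℝ) y = (1 / 2 : ℝ) • x₀ + (1 / 2 : ℝ) • y := by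
          rw [AffineMap.homothety_apply]
          simp only [vsub_eq_sub, vadd_eq_add, smul_sub]
          module
        rw [mem_ofPred_eq, e]
        simpa using h
      · have : φ y ≠ 0 := ne_of_gt hy
        simp [this]
    have h0 := measure_mono_null hsub (ae_iff.1 hlt)
    rw [Measure.addHaar_image_homothety] at h0
    simp [hpos] at h0
  refine ⟨fun x => (φ x).toReal, ⟨fun x => ENNReal.toReal_nonneg, fun x y t h0 h1 => ?_⟩, ?_⟩
  · rcases h0.eq_or_lt with rfl | h0
    · simp
    rcases h1.eq_or_lt with rfl | h1
    · simp
    rw [ENNReal.toReal_rpow, ENNReal.toReal_rpow, ← ENNReal.toReal_mul]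
    exact ENNReal.toReal_mono (htop _) (hφ h0 (by linarith) (by ring) x y)
  · rw [← hwd]
    congr 1
    ext x
    exact (ENNReal.ofReal_toReal (htop x)).symm

namespace MeasureTheory

theorem Measure.AbsolutelyContinuous.pi_fin {E : Type*} [MeasurableSpace E] {μ ν : Measure E}
    [SigmaFinite μ] [SigmaFinite ν] (h : μ ≪ ν) (d : ℕ) :
    (Measure.pi fun _ : Fin d => μ) ≪ Measure.pi fun _ : Fin d => ν := by
  induction d with
  | zero => rw [Measure.pi_of_empty _ (fun i => i.elim0), Measure.pi_of_empty _ (fun i => i.elim0)]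
  | succ d ih =>
    have hp := (measurePreserving_piFinSuccAbove (fun _ : Fin (d + 1) => μ) 0).symm
    have hq := (measurePreserving_piFinSuccAbove (fun _ : Fin (d + 1) => ν) 0).symm
    rw [← hp.map_eq, ← hq.map_eq]
    exact (h.prod ih).map hp.measurable

theorem Measure.AbsolutelyContinuous.pi {ι E : Type*} [Fintype ι] [MeasurableSpace E]
    {μ ν : Measure E} [SigmaFinite μ] [SigmaFinite ν] (h : μ ≪ ν) :
    (Measure.pi fun _ : ι => μ) ≪ Measure.pi fun _ : ι => ν := by
  have hp := measurePreserving_piCongrLeft (fun _ : ι => μ) (Fintype.equivFin ι).symm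
  have hq := measurePreserving_piCongrLeft (fun _ : ι => ν) (Fintype.equivFin ι).symm
  rw [← hp.map_eq, ← hq.map_eq]
  exact (h.pi_fin _).map hp.measurable

end MeasureTheory

theorem IsLogConcaveMeasure.absolutelyContinuous {n : ℕ}
    {μ : Measure (EuclideanSpace ℝ (Fin n))} (hμ : IsLogConcaveMeasure μ) : μ ≪ volume := by
  obtain ⟨f, -, rfl⟩ := hμ
  exact withDensity_absolutelyContinuous _ _

/-- Surjective linear images of powers of a log-concave measure are log-concave. -/
theorem IsLogConcaveMeasure.map_pi {ι : Type*} [Fintype ι] {n m : ℕ}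
    {μ : Measure (EuclideanSpace ℝ (Fin n))} [IsProbabilityMeasure μ] (hμ : IsLogConcaveMeasure μ)
    (L : (ι → EuclideanSpace ℝ (Fin n)) →L[ℝ] EuclideanSpace ℝ (Fin m))
    (hL : Function.Surjective L) :
    IsLogConcaveMeasure ((Measure.pi fun _ : ι => μ).map L) := by
  have hLm : Measurable L := L.continuous.measurable
  have : IsProbabilityMeasure ((Measure.pi fun _ : ι => μ).map L) :=
    Measure.isProbabilityMeasure_map hLm.aemeasurable
  refine (hμ.isPrekopaLeindler.pi.map hLm fun s t _ x y => by simp).isLogConcaveMeasure ?_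
  refine (hμ.absolutelyContinuous.pi.map hLm).trans ?_
  obtain ⟨c, -, hc⟩ := L.toLinearMap.exists_map_addHaar_eq_smul_addHaar
    (volume : Measure (ι → EuclideanSpace ℝ (Fin n)))
    (volume : Measure (EuclideanSpace ℝ (Fin m))) hL
  have : (volume : Measure (ι → EuclideanSpace ℝ (Fin n))).map L = c • volume := hc
  rw [← volume_pi, this]
  exact Measure.smul_absolutelyContinuous

/-- Borell's lemma: a one-dimensional measure satisfying the Prékopa–Leindler inequality has
exponential tails. -/
theorem IsPrekopaLeindler.exists_tail_bound {ν : Measure ℝ} [IsProbabilityMeasure ν]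
    (hν : IsPrekopaLeindler ν) :
    ∃ a : ℝ, 0 < a ∧ ∀ j : ℕ, ν.real {x | j * a ≤ |x|} ≤ 4 * (1 / 2) ^ j := by
  have hlim : Tendsto (fun k : ℕ => ν.real (Metric.closedBall (0 : ℝ) k)) atTop (𝓝 1) := by
    have h1 : Monotone fun k : ℕ => Metric.closedBall (0 : ℝ) k := fun i j h =>
      Metric.closedBall_subset_closedBall (by exact_mod_cast h)
    have h2 := tendsto_measure_iUnion_atTop (μ := ν) h1
    rw [Metric.iUnion_closedBall_nat, measure_univ] at h2
    exact (ENNReal.tendsto_toReal ENNReal.one_ne_top).comp h2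
  obtain ⟨k, hk, hk1⟩ := ((hlim.eventually (lt_mem_nhds (by norm_num : (4 / 5 : ℝ) < 1))).and
    (eventually_ge_atTop 1)).exists
  set a : ℝ := (k : ℝ)
  have ha : 0 < a := by positivity
  refine ⟨a, ha, fun j => ?_⟩
  rcases lt_or_ge j 3 with hj | hj
  · refine measureReal_le_one.trans ?_
    interval_cases j <;> norm_num
  obtain ⟨d, rfl⟩ : ∃ d, j = d + 3 := ⟨j - 3, by omega⟩
  set T : Set ℝ := {x | ((d + 2 : ℕ) : ℝ) * a < |x|}
  have hT : MeasurableSet T := measurableSet_lt measurable_const measurable_abs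
  set s : ℝ := 2 / (d + 3)
  set t : ℝ := (d + 1) / (d + 3)
  have hs : 0 < s := by positivity
  have ht : 0 < t := by positivity
  have hst : s + t = 1 := by simp only [s, t]; field_simp; ring
  have h := hν.measure_le hs ht hst hT (measurableSet_closedBall (x := (0 : ℝ)) (ε := a))
    (measurableSet_closedBall (x := (0 : ℝ)) (ε := a)).compl (fun x hx y hy => by
      simp only [mem_compl_iff, mem_closedBall_zero_iff, Real.norm_eq_abs, not_le, smul_eq_mul] at *
      have hx' : ((d + 2 : ℕ) : ℝ) * a < |x| := hx
      have h1 : |s * x| - |t * y| ≤ |s * x + t * y| := by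
        have := abs_sub_abs_le_abs_sub (s * x) (-(t * y))
        rwa [abs_neg, sub_neg_eq_add] at this
      rw [abs_mul, abs_mul, abs_of_pos hs, abs_of_pos ht] at h1
      have h2 : s * (((d + 2 : ℕ) : ℝ) * a) < s * |x| := by gcongr
      have h3 : t * |y| ≤ t * a := by gcongr
      have h4 : s * (((d + 2 : ℕ) : ℝ) * a) - t * a = a := by
        simp only [s, t]; push_cast; field_simp; ring
      linarith)
  have h' := ENNReal.toReal_mono (measure_ne_top _ _) h
  rw [ENNReal.toReal_mul, ← ENNReal.toReal_rpow, ← ENNReal.toReal_rpow] at h'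
  change ν.real T ^ s * ν.real (Metric.closedBall (0 : ℝ) a) ^ t ≤ ν.real _ at h'
  rw [probReal_compl_eq_one_sub measurableSet_closedBall] at h'
  have hTle : ν.real T ≤ (1 / 2) ^ (d + 1) := by
    by_contra! hlt
    have e1 : (((1 : ℝ) / 2) ^ (d + 1)) ^ s < ν.real T ^ s :=
      Real.rpow_lt_rpow (by positivity) hlt hs
    have e2 : (((1 : ℝ) / 2) ^ (d + 1)) ^ s = (1 / 4) ^ t := by
      rw [← Real.rpow_natCast, ← Real.rpow_mul (by norm_num),
        show (1 / 4 : ℝ) = (1 / 2) ^ (2 : ℝ) by norm_num, ← Real.rpow_mul (by norm_num)]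
      congr 1
      simp only [s, t]; push_cast; field_simp
    have e3 : (4 / 5 : ℝ) ^ t ≤ ν.real (Metric.closedBall (0 : ℝ) a) ^ t :=
      Real.rpow_le_rpow (by norm_num) hk.le ht.le
    have e4 : (1 / 5 : ℝ) ≤ (1 / 4) ^ t * (4 / 5) ^ t := by
      rw [← Real.mul_rpow (by norm_num) (by norm_num)]
      norm_num
      exact Real.self_le_rpow_of_le_one (by norm_num) (by norm_num) (by linarith)
    have e5 : ((1 : ℝ) / 4) ^ t * (4 / 5) ^ t
        < ν.real T ^ s * ν.real (Metric.closedBall (0 : ℝ) a) ^ t := by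
      rw [e2] at e1
      exact mul_lt_mul e1 e3 (by positivity) (by positivity)
    linarith
  have hsub : {x : ℝ | ((d + 3 : ℕ) : ℝ) * a ≤ |x|} ⊆ T := fun x hx => by
    have hx' : ((d + 3 : ℕ) : ℝ) * a ≤ |x| := hx
    change ((d + 2 : ℕ) : ℝ) * a < |x|
    push_cast at *
    linarith
  calc _ ≤ ν.real T := measureReal_mono hsub
    _ ≤ (1 / 2) ^ (d + 1) := hTle
    _ = 4 * (1 / 2) ^ (d + 3) := by ring

theorem IsPrekopaLeindler.integrable_abs_pow {ν : Measure ℝ} [IsProbabilityMeasure ν]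
    (hν : IsPrekopaLeindler ν) (p : ℕ) : Integrable (fun x => |x| ^ p) ν := by
  obtain ⟨a, ha, H⟩ := hν.exists_tail_bound
  refine ⟨by fun_prop, ?_⟩
  have hle : ∀ x : ℝ, ‖|x| ^ p‖ₑ ≤ ∑' j : ℕ, ENNReal.ofReal (((j + 1) * a) ^ p) *
      {x : ℝ | j * a ≤ |x|}.indicator 1 x := by
    intro x
    refine le_trans ?_ (ENNReal.le_tsum ⌊|x| / a⌋₊)
    have h1 : (⌊|x| / a⌋₊ : ℝ) * a ≤ |x| := by
      rw [← le_div_iff₀ ha]; exact Nat.floor_le (by positivity)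
    have h2 : |x| ≤ (⌊|x| / a⌋₊ + 1) * a := by
      rw [← div_le_iff₀ ha]; exact (Nat.lt_floor_add_one _).le
    rw [indicator_of_mem (by exact h1), Pi.one_apply, mul_one,
      Real.enorm_eq_ofReal (by positivity)]
    gcongr
  refine lt_of_le_of_lt (lintegral_mono hle) ?_
  have hm : ∀ j : ℕ, MeasurableSet {x : ℝ | j * a ≤ |x|} := fun j =>
    measurableSet_le measurable_const measurable_abs
  rw [lintegral_tsum fun j => by
    exact ((measurable_one.indicator (hm j)).const_mul _).aemeasurable]
  have hterm : ∀ j : ℕ, ∫⁻ x, ENNReal.ofReal (((j + 1) * a) ^ p) *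
      {x : ℝ | j * a ≤ |x|}.indicator 1 x ∂ν ≤
      ENNReal.ofReal (8 * a ^ p * (((j + 1 : ℕ) : ℝ) ^ p * (1 / 2) ^ (j + 1))) := by
    intro j
    rw [lintegral_const_mul _ (measurable_one.indicator (hm j)), lintegral_indicator_one (hm j),
      ← ofReal_measureReal, ← ENNReal.ofReal_mul (by positivity)]
    refine ENNReal.ofReal_le_ofReal ?_
    calc _ ≤ ((j + 1) * a) ^ p * (4 * (1 / 2) ^ j) := by gcongr; exact H j
      _ = _ := by rw [mul_pow]; push_cast; ring
  refine lt_of_le_of_lt (ENNReal.tsum_le_tsum hterm) ?_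
  have hs : Summable fun j : ℕ => (j : ℝ) ^ p * (1 / 2 : ℝ) ^ j :=
    summable_pow_mul_geometric_of_norm_lt_one p (by norm_num)
  exact ((summable_nat_add_iff 1).2 hs |>.mul_left (8 * a ^ p)).tsum_ofReal_lt_top

/-- The coefficients of the series bounding the moment generating function of a centred variable
whose `p`-th absolute moments are at most `p ^ (p / 2)`. -/
def mgfCoeff (p : ℕ) : ℝ := Real.sqrt p ^ p / p.factorial

theorem mgfCoeff_nonneg (p : ℕ) : 0 ≤ mgfCoeff p := by unfold mgfCoeff; positivity

theorem mgfCoeff_add_two_le (p : ℕ) (hp : 1 ≤ p) :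
    mgfCoeff (p + 2) ≤ 2.72 / (p + 1) * mgfCoeff p := by
  have hp0 : (0 : ℝ) < p := by exact_mod_cast hp
  have h1 : Real.sqrt ((p + 2 : ℕ) : ℝ) ≤ Real.sqrt p * Real.exp (1 / p) := by
    rw [Real.sqrt_le_left (by positivity), mul_pow, Real.sq_sqrt hp0.le]
    have h2 : 1 + 1 / (p : ℝ) ≤ Real.exp (1 / p) := by
      linarith [Real.add_one_le_exp (1 / (p : ℝ))]
    calc ((p + 2 : ℕ) : ℝ) ≤ p * (1 + 1 / (p : ℝ)) ^ 2 := by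
          push_cast
          have : (p : ℝ) * (1 + 1 / (p : ℝ)) ^ 2 = p + 2 + 1 / p := by field_simp; ring
          rw [this]
          have : 0 ≤ 1 / (p : ℝ) := by positivity
          linarith
      _ ≤ _ := by gcongr
  have h3 : Real.sqrt ((p + 2 : ℕ) : ℝ) ^ p ≤ 2.72 * Real.sqrt p ^ p := by
    calc _ ≤ (Real.sqrt p * Real.exp (1 / p)) ^ p := by gcongr
      _ = Real.exp 1 * Real.sqrt p ^ p := by
        rw [mul_pow, ← Real.exp_nat_mul, mul_one_div_cancel hp0.ne', mul_comm]
      _ ≤ _ := by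
        gcongr
        linarith [Real.exp_one_lt_d9]
  unfold mgfCoeff
  have h4 : Real.sqrt ((p + 2 : ℕ) : ℝ) ^ (p + 2) = Real.sqrt ((p + 2 : ℕ) : ℝ) ^ p * (p + 2) := by
    rw [pow_add, Real.sq_sqrt (by positivity)]; push_cast; ring
  rw [h4, Nat.factorial_succ, Nat.factorial_succ]
  push_cast at *
  have h5 : (0 : ℝ) < p.factorial := by positivity
  calc _ = Real.sqrt (p + 2) ^ p / ((p + 1) * p.factorial) := by field_simp; ring
    _ ≤ 2.72 * Real.sqrt p ^ p / ((p + 1) * p.factorial) := by gcongr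
    _ = _ := by field_simp

theorem mgfCoeff_even_le (k : ℕ) :
    mgfCoeff (2 * k + 4) ≤ 0.4615 * (1.7 ^ (k + 2) / (k + 2).factorial) := by
  induction k with
  | zero =>
    unfold mgfCoeff
    have : Real.sqrt ((4 : ℕ) : ℝ) = 2 := by
      rw [show ((4 : ℕ) : ℝ) = 2 ^ 2 by norm_num, Real.sqrt_sq (by norm_num)]
    norm_num [this, Nat.factorial]
  | succ k ih =>
    have h := mgfCoeff_add_two_le (2 * k + 4) (by omega)
    rw [show 2 * (k + 1) + 4 = 2 * k + 4 + 2 by ring]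
    refine h.trans ((mul_le_mul_of_nonneg_left ih (by positivity)).trans ?_)
    rw [show k + 1 + 2 = (k + 2) + 1 by ring, Nat.factorial_succ (k + 2), pow_succ _ (k + 2)]
    have h5 : (0 : ℝ) < (k + 2).factorial := by positivity
    have h6 : 2.72 / (((2 * k + 4 : ℕ) : ℝ) + 1) ≤ 1.7 / ((k : ℝ) + 3) := by
      push_cast
      rw [div_le_div_iff₀ (by positivity) (by positivity)]
      nlinarith [(Nat.cast_nonneg k : (0 : ℝ) ≤ k)]
    calc _ ≤ 1.7 / ((k : ℝ) + 3) * (0.4615 * (1.7 ^ (k + 2) / (k + 2).factorial)) := by gcongr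
      _ = _ := by
        push_cast
        have : (k : ℝ) + 2 + 1 = k + 3 := by ring
        rw [this]
        field_simp

theorem mgfCoeff_odd_le (k : ℕ) :
    mgfCoeff (2 * k + 3) ≤ 0.51 * 0.8 ^ k * (1.7 ^ (k + 1) / (k + 1).factorial) := by
  induction k with
  | zero =>
    unfold mgfCoeff
    have h1 : Real.sqrt ((3 : ℕ) : ℝ) ≤ 1.733 := by
      rw [Real.sqrt_le_left (by norm_num)]; norm_num
    have h2 : Real.sqrt ((3 : ℕ) : ℝ) ^ 3 = 3 * Real.sqrt ((3 : ℕ) : ℝ) := by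
      rw [pow_succ, Real.sq_sqrt (by positivity)]; norm_num
    norm_num [Nat.factorial] at *
    rw [h2]; linarith
  | succ k ih =>
    have h := mgfCoeff_add_two_le (2 * k + 3) (by omega)
    rw [show 2 * (k + 1) + 3 = 2 * k + 3 + 2 by ring]
    refine h.trans ((mul_le_mul_of_nonneg_left ih (by positivity)).trans ?_)
    rw [Nat.factorial_succ (k + 1), pow_succ _ (k + 1), pow_succ _ k]
    have h5 : (0 : ℝ) < (k + 1).factorial := by positivity
    have h6 : 2.72 / (((2 * k + 3 : ℕ) : ℝ) + 1) = 1.36 / ((k : ℝ) + 2) := by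
      push_cast
      rw [div_eq_div_iff (by positivity) (by positivity)]
      ring
    rw [h6]
    push_cast
    have : (k : ℝ) + 1 + 1 = k + 2 := by ring
    rw [this]
    apply le_of_eq
    field_simp
    ring

theorem mgfCoeff_combination_le (k : ℕ) :
    mgfCoeff (2 * k + 4) + 0.75 * mgfCoeff (2 * k + 5) + mgfCoeff (2 * k + 3) / 3 ≤
      1.7 ^ (k + 2) / (k + 2).factorial := by
  have h1 := mgfCoeff_even_le k
  have h2 := mgfCoeff_odd_le k
  have h3 := mgfCoeff_odd_le (k + 1)
  rw [show 2 * (k + 1) + 3 = 2 * k + 5 by ring, show k + 1 + 1 = k + 2 by ring] at h3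
  set w : ℝ := 1.7 ^ (k + 2) / (k + 2).factorial
  have hw : 0 ≤ w := by positivity
  have h4 : (1.7 : ℝ) ^ (k + 1) / (k + 1).factorial = w * (k + 2) / 1.7 := by
    simp only [w]
    rw [Nat.factorial_succ (k + 1), pow_succ _ (k + 1)]
    push_cast
    have : (k : ℝ) + 1 + 1 = k + 2 := by ring
    rw [this]
    field_simp
  rw [h4] at h2
  have h5 : ∀ j : ℕ, (0.8 : ℝ) ^ j * (0.506 + 0.1 * j) ≤ 0.506 := by
    intro j
    induction j with
    | zero => norm_num
    | succ j ih =>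
      refine le_trans ?_ ih
      rw [pow_succ, mul_assoc]
      gcongr
      push_cast
      linarith [(Nat.cast_nonneg j : (0 : ℝ) ≤ j)]
  have h6 := mul_le_mul_of_nonneg_right (h5 k) hw
  have e1 : 0.75 * (0.51 * (0.8 : ℝ) ^ (k + 1) * w) + (0.51 * 0.8 ^ k * (w * (k + 2) / 1.7)) / 3 =
      (0.8 : ℝ) ^ k * (0.506 + 0.1 * k) * w := by
    rw [pow_succ]; ring
  linarith

theorem sum_mgfCoeff_le {x : ℝ} (hx : 0 ≤ x) (N : ℕ) :
    ∑ p ∈ Finset.range N, mgfCoeff (p + 2) * x ^ (p + 2) ≤ Real.exp (1.7 * x ^ 2) - 1 := by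
  have hterm : ∀ p, 0 ≤ mgfCoeff (p + 2) * x ^ (p + 2) := fun p =>
    mul_nonneg (mgfCoeff_nonneg _) (by positivity)
  have hodd : ∀ k, mgfCoeff (2 * k + 3) * x ^ (2 * k + 3) ≤
      0.75 * mgfCoeff (2 * k + 3) * (x ^ 2) ^ (k + 1) +
        mgfCoeff (2 * k + 3) / 3 * (x ^ 2) ^ (k + 2) := by
    intro k
    have h1 : x ≤ 0.75 + x ^ 2 / 3 := by nlinarith [sq_nonneg (x - 1.5)]
    have h2 : 0 ≤ mgfCoeff (2 * k + 3) * (x ^ 2) ^ (k + 1) :=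
      mul_nonneg (mgfCoeff_nonneg _) (by positivity)
    have h3 := mul_le_mul_of_nonneg_left h1 h2
    calc _ = mgfCoeff (2 * k + 3) * (x ^ 2) ^ (k + 1) * x := by
          rw [← pow_mul]; ring
      _ ≤ _ := h3
      _ = _ := by ring
  have key : ∀ M : ℕ, ∑ p ∈ Finset.range (2 * (M + 1)), mgfCoeff (p + 2) * x ^ (p + 2) ≤
      ∑ k ∈ Finset.range (M + 1), (1.7 * x ^ 2) ^ (k + 1) / (k + 1).factorial +
        mgfCoeff (2 * M + 3) / 3 * (x ^ 2) ^ (M + 2) := by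
    intro M
    induction M with
    | zero =>
      have h := hodd 0
      have h2 : mgfCoeff 2 = 1 := by
        unfold mgfCoeff
        rw [Real.sq_sqrt (by positivity)]; norm_num [Nat.factorial]
      have h3 := mgfCoeff_odd_le 0
      simp only [Finset.sum_range_succ, Finset.sum_range_zero, h2, mul_zero, zero_add, mul_one,
        pow_zero, Nat.factorial_one, Nat.cast_one, div_one, pow_one] at h h3 ⊢
      nlinarith [sq_nonneg x]
    | succ M ih =>
      rw [show 2 * (M + 1 + 1) = 2 * (M + 1) + 1 + 1 by ring, Finset.sum_range_succ,
        Finset.sum_range_succ, Finset.sum_range_succ _ (M + 1)]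
      have h := hodd (M + 1)
      have h2 := mul_le_mul_of_nonneg_right (mgfCoeff_combination_le M)
        (by positivity : 0 ≤ (x ^ 2) ^ (M + 2))
      have e1 : (1.7 * x ^ 2) ^ (M + 1 + 1) / ((M + 1 + 1).factorial : ℝ) =
        1.7 ^ (M + 2) / (M + 2).factorial * (x ^ 2) ^ (M + 2) := by
        rw [mul_pow]; ring
      have e2 : x ^ (2 * (M + 1) + 2) = (x ^ 2) ^ (M + 2) := by rw [← pow_mul]; ring_nf
      rw [e1, e2]
      rw [show 2 * (M + 1) + 1 + 2 = 2 * (M + 1) + 3 by ring,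
        show 2 * (M + 1) + 2 = 2 * M + 4 by ring]
      rw [show 2 * (M + 1) + 3 = 2 * M + 5 by ring] at h ⊢
      rw [show M + 1 + 1 = M + 2 by ring] at h
      linarith
  have h1 : ∑ p ∈ Finset.range N, mgfCoeff (p + 2) * x ^ (p + 2) ≤
      ∑ p ∈ Finset.range (2 * (N + 1)), mgfCoeff (p + 2) * x ^ (p + 2) :=
    Finset.sum_le_sum_of_subset_of_nonneg (Finset.range_subset_range.2 (by omega))
      fun p _ _ => hterm p
  have h2 : mgfCoeff (2 * N + 3) / 3 * (x ^ 2) ^ (N + 2) ≤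
      (1.7 * x ^ 2) ^ (N + 2) / (N + 2).factorial := by
    have h := mgfCoeff_combination_le N
    have h3 := mgfCoeff_nonneg (2 * N + 4)
    have h4 := mgfCoeff_nonneg (2 * N + 5)
    calc _ ≤ 1.7 ^ (N + 2) / (N + 2).factorial * (x ^ 2) ^ (N + 2) := by
          exact mul_le_mul_of_nonneg_right (by linarith [mgfCoeff_nonneg (2 * N + 3)])
            (by positivity)
      _ = _ := by rw [mul_pow]; ring
  have h3 := Real.sum_le_exp_of_nonneg (by positivity : 0 ≤ 1.7 * x ^ 2) (N + 3)
  rw [Finset.sum_range_succ', Finset.sum_range_succ] at h3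
  have h4 := key N
  norm_num at h3 h2 h4 h1 ⊢
  linarith

theorem hasSum_exp_sub_one_sub (u : ℝ) :
    HasSum (fun p : ℕ => u ^ (p + 2) / (p + 2).factorial) (Real.exp u - 1 - u) := by
  rw [hasSum_nat_add_iff 2 (f := fun p : ℕ => u ^ p / p.factorial)]
  have h := NormedSpace.expSeries_div_hasSum_exp u
  rw [← Real.exp_eq_exp_ℝ] at h
  have e : Real.exp u - 1 - u + ∑ i ∈ Finset.range 2, u ^ i / (i.factorial : ℝ) = Real.exp u := by
    simp [Finset.sum_range_succ]
  rwa [e]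

/-- A centred random variable with moments `𝔼|Y|ᵖ ≤ (b √p)ᵖ`, `p ≥ 2`, is subgaussian. -/
theorem hasSubgaussianMGF_of_moments {Ω : Type*} [MeasurableSpace Ω] {P : Measure Ω}
    [IsProbabilityMeasure P] {Y : Ω → ℝ} (hY : Measurable Y) {b : ℝ} (hb : 0 ≤ b)
    (hint : ∀ p : ℕ, Integrable (fun ω => |Y ω| ^ p) P) (hmean : ∫ ω, Y ω ∂P = 0)
    (hmom : ∀ p : ℕ, 2 ≤ p → ∫ ω, |Y ω| ^ p ∂P ≤ (b * Real.sqrt p) ^ p)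
    {c : ℝ≥0} (hc : (c : ℝ) = 3.4 * b ^ 2) : HasSubgaussianMGF Y c P := by
  have hY1 : Integrable Y P := by
    have := hint 1
    simp only [pow_one] at this
    exact (integrable_norm_iff hY.aestronglyMeasurable).1 this
  have main : ∀ x : ℝ, Integrable (fun ω => Real.exp (x * Y ω) - 1 - x * Y ω) P ∧
      ∫ ω, (Real.exp (x * Y ω) - 1 - x * Y ω) ∂P ≤ Real.exp (c * x ^ 2 / 2) - 1 := by
    intro x
    have hnn : ∀ u : ℝ, 0 ≤ Real.exp u - 1 - u := fun u => by linarith [Real.add_one_le_exp u]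
    set y : ℝ := |x| * b
    have hy : 0 ≤ y := by positivity
    have hcy : 1.7 * y ^ 2 = c * x ^ 2 / 2 := by
      simp only [y]; rw [hc, mul_pow, sq_abs]; ring
    have hL : ∫⁻ ω, ENNReal.ofReal (Real.exp (x * Y ω) - 1 - x * Y ω) ∂P ≤
        ENNReal.ofReal (Real.exp (c * x ^ 2 / 2) - 1) := by
      calc _ ≤ ∫⁻ ω, ∑' p : ℕ, ENNReal.ofReal (|x * Y ω| ^ (p + 2) / (p + 2).factorial) ∂P := by
            refine lintegral_mono fun ω => ?_
            have h1 := hasSum_exp_sub_one_sub (x * Y ω)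
            have h2 := hasSum_exp_sub_one_sub |x * Y ω|
            dsimp only
            rw [← ENNReal.ofReal_tsum_of_nonneg (fun p => by positivity) h2.summable]
            refine ENNReal.ofReal_le_ofReal ?_
            rw [h2.tsum_eq]
            refine hasSum_le (fun p => ?_) h1 h2
            have h3 : (x * Y ω) ^ (p + 2) ≤ |x * Y ω| ^ (p + 2) := by
              rw [← abs_pow]; exact le_abs_self _
            exact div_le_div_of_nonneg_right h3 (by positivity)
        _ = ∑' p : ℕ, ∫⁻ ω, ENNReal.ofReal (|x * Y ω| ^ (p + 2) / (p + 2).factorial) ∂P := by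
            refine lintegral_tsum fun p => ?_
            exact Measurable.aemeasurable (by fun_prop)
        _ ≤ ∑' p : ℕ, ENNReal.ofReal (mgfCoeff (p + 2) * y ^ (p + 2)) := by
            refine ENNReal.tsum_le_tsum fun p => ?_
            have e : ∀ ω, |x * Y ω| ^ (p + 2) / (p + 2).factorial =
                |x| ^ (p + 2) / (p + 2).factorial * |Y ω| ^ (p + 2) := fun ω => by
              rw [abs_mul, mul_pow]; ring
            simp_rw [e]
            rw [← ofReal_integral_eq_lintegral_ofReal ((hint _).const_mul _)
              (Eventually.of_forall fun ω => by positivity), integral_const_mul]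
            refine ENNReal.ofReal_le_ofReal ?_
            calc _ ≤ |x| ^ (p + 2) / (p + 2).factorial * (b * Real.sqrt (p + 2 : ℕ)) ^ (p + 2) := by
                  gcongr
                  exact hmom _ (by omega)
              _ = _ := by simp only [mgfCoeff, y, mul_pow]; ring
        _ ≤ _ := by
            have hterm : ∀ p : ℕ, 0 ≤ mgfCoeff (p + 2) * y ^ (p + 2) := fun p =>
              mul_nonneg (mgfCoeff_nonneg _) (by positivity)
            rw [← ENNReal.ofReal_tsum_of_nonneg hterm
              (summable_of_sum_range_le hterm (sum_mgfCoeff_le hy)), ← hcy]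
            exact ENNReal.ofReal_le_ofReal (Real.tsum_le_of_sum_range_le hterm (sum_mgfCoeff_le hy))
    have hI : Integrable (fun ω => Real.exp (x * Y ω) - 1 - x * Y ω) P := by
      refine ⟨by fun_prop, ?_⟩
      rw [hasFiniteIntegral_iff_ofReal (Eventually.of_forall fun ω => hnn _)]
      exact hL.trans_lt ENNReal.ofReal_lt_top
    refine ⟨hI, ?_⟩
    rw [← ofReal_integral_eq_lintegral_ofReal hI (Eventually.of_forall fun ω => hnn _)] at hL
    exact (ENNReal.ofReal_le_ofReal_iff (by
      rw [sub_nonneg]; exact Real.one_le_exp (by positivity))).1 hL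
  have hexp : ∀ x : ℝ, Integrable (fun ω => Real.exp (x * Y ω)) P := fun x => by
    have := ((main x).1.add (integrable_const (1 : ℝ))).add (hY1.const_mul x)
    refine this.congr (Eventually.of_forall fun ω => ?_)
    simp only [Pi.add_apply]; ring
  refine ⟨hexp, fun x => ?_⟩
  have h := (main x).2
  rw [integral_sub (f := fun ω => Real.exp (x * Y ω) - 1) ((hexp x).sub (integrable_const _))
    (hY1.const_mul x), integral_sub (hexp x) (integrable_const _), integral_const_mul, hmean] at h
  simp only [integral_const, probReal_univ, smul_eq_mul, mul_one, mul_zero, sub_zero] at h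
  unfold mgf
  linarith

section Moments

variable {Ω : Type*} [MeasurableSpace Ω] {P : Measure Ω} {S : Ω → ℝ}
  {b : ℝ} {c : ℝ≥0}

theorem HasSubgaussianMGF.integrable_abs_rpow (hS : HasSubgaussianMGF S c P) {p : ℝ} (hp : 0 < p) :
    Integrable (fun ω => |S ω| ^ p) P := by
  have hp' : ((p.toNNReal : ℝ≥0∞)) ≠ 0 := by simpa using hp
  have := (hS.memLp p.toNNReal).integrable_norm_rpow hp' ENNReal.coe_ne_top
  simpa [hp.le] using this

theorem integral_abs_rpow_le_of_subgaussianMGF (hb : 0 < b) (hc : (c : ℝ) = 3.4 * b ^ 2)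
    (hS : HasSubgaussianMGF S c P) {p : ℝ} (hp : 0 < p) :
    ∫ ω, |S ω| ^ p ∂P ≤ 2 * (Real.sqrt (3.4 / Real.exp 1) * (b * Real.sqrt p)) ^ p := by
  set s : ℝ := Real.sqrt (p / 3.4) / b
  have hs : 0 < s := by positivity
  have hpt : ∀ ω, |S ω| ^ p ≤ (p / (Real.exp 1 * s)) ^ p *
      (Real.exp (s * S ω) + Real.exp (-s * S ω)) := by
    intro ω
    have h1 : |S ω| ≤ p / (Real.exp 1 * s) * Real.exp (s * |S ω| / p) := by
      have h := Real.add_one_le_exp (s * |S ω| / p - 1)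
      rw [sub_add_cancel, Real.exp_sub] at h
      calc |S ω| = p / s * (s * |S ω| / p) := by field_simp
        _ ≤ p / s * (Real.exp (s * |S ω| / p) / Real.exp 1) := by gcongr
        _ = _ := by field_simp
    calc |S ω| ^ p ≤ (p / (Real.exp 1 * s) * Real.exp (s * |S ω| / p)) ^ p := by gcongr
      _ = (p / (Real.exp 1 * s)) ^ p * Real.exp (s * |S ω|) := by
        rw [Real.mul_rpow (by positivity) (by positivity), ← Real.exp_mul,
          div_mul_cancel₀ _ hp.ne']
      _ ≤ _ := by
        gcongr
        rcases abs_cases (S ω) with ⟨h, -⟩ | ⟨h, -⟩ <;> rw [h]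
        · linarith [Real.exp_pos (-s * S ω)]
        · rw [mul_neg, ← neg_mul]; linarith [Real.exp_pos (s * S ω)]
  have hI : Integrable (fun ω => (p / (Real.exp 1 * s)) ^ p *
      (Real.exp (s * S ω) + Real.exp (-s * S ω))) P :=
    ((hS.integrable_exp_mul s).add (hS.integrable_exp_mul (-s))).const_mul _
  refine (integral_mono_of_nonneg (Eventually.of_forall fun ω => by positivity) hI
    (Eventually.of_forall hpt)).trans ?_
  rw [integral_const_mul, integral_add (hS.integrable_exp_mul s) (hS.integrable_exp_mul (-s))]
  have hs2 : (c : ℝ) * s ^ 2 / 2 = p / 2 := by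
    simp only [s]; rw [hc, div_pow, Real.sq_sqrt (by positivity)]; field_simp
  have h1 := hS.mgf_le s
  have h2 := hS.mgf_le (-s)
  rw [neg_sq] at h2
  rw [hs2] at h1 h2
  unfold mgf at h1 h2
  have e1 : p / (Real.exp 1 * s) * Real.exp (1 / 2) =
      Real.sqrt (3.4 / Real.exp 1) * (b * Real.sqrt p) := by
    have e2 : Real.exp 1 = Real.exp (1 / 2) ^ 2 := by
      rw [← Real.exp_nat_mul]; norm_num
    have e3 := Real.exp_pos (1 / 2)
    have e4 : Real.sqrt p ^ 2 = p := Real.sq_sqrt hp.le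
    have e5 : 0 < Real.sqrt p := by positivity
    have e6 : 0 < Real.sqrt 3.4 := by positivity
    simp only [s]
    rw [e2, Real.sqrt_div' _ (sq_nonneg _), Real.sqrt_div' _ (by norm_num),
      Real.sqrt_sq e3.le]
    generalize Real.exp (1 / 2) = h at *
    rw [← e4, Real.sqrt_sq e5.le]
    field_simp
  calc _ ≤ (p / (Real.exp 1 * s)) ^ p * (Real.exp (p / 2) + Real.exp (p / 2)) := by gcongr
    _ = 2 * (p / (Real.exp 1 * s) * Real.exp (1 / 2)) ^ p := by
      rw [Real.mul_rpow (by positivity) (by positivity), ← Real.exp_mul]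
      rw [show 1 / 2 * p = p / 2 by ring]; ring
    _ = _ := by rw [e1]

theorem sqrt_const_rpow_le {p : ℝ} (hp : 3 ≤ p) :
    2 * Real.sqrt (3.4 / Real.exp 1) ^ p ≤ Real.sqrt 2 ^ p := by
  have h1 : (0 : ℝ) < Real.sqrt (Real.exp 1 / 1.7) := by positivity
  have hge : 1 ≤ Real.sqrt (Real.exp 1 / 1.7) := by
    rw [Real.one_le_sqrt, le_div_iff₀ (by norm_num)]
    linarith [Real.exp_one_gt_d9]
  have h2 : 2 ≤ Real.sqrt (Real.exp 1 / 1.7) ^ p := by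
    have h3 : Real.sqrt (Real.exp 1 / 1.7) ^ (3 : ℝ) ≤ Real.sqrt (Real.exp 1 / 1.7) ^ p :=
      Real.rpow_le_rpow_of_exponent_le hge hp
    refine le_trans ?_ h3
    have h4 : Real.sqrt (Real.exp 1 / 1.7) ^ (3 : ℝ) = Real.sqrt (Real.exp 1 / 1.7) ^ 3 := by
      exact_mod_cast Real.rpow_natCast _ 3
    rw [h4]
    refine le_of_sq_le_sq ?_ (by positivity)
    rw [← pow_mul, show 3 * 2 = 2 * 3 by norm_num, pow_mul, Real.sq_sqrt (by positivity), div_pow,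
      le_div_iff₀ (by norm_num)]
    have h5 : (2.7182818283 : ℝ) ^ 3 ≤ Real.exp 1 ^ 3 := by
      gcongr; exact Real.exp_one_gt_d9.le
    refine le_trans ?_ h5
    norm_num
  calc _ ≤ Real.sqrt (Real.exp 1 / 1.7) ^ p * Real.sqrt (3.4 / Real.exp 1) ^ p := by gcongr
    _ = _ := by
      rw [← Real.mul_rpow (by positivity) (by positivity), ← Real.sqrt_mul (by positivity)]
      congr 2
      field_simp
      norm_num

/-- Lyapunov interpolation between moments. -/
theorem integral_interpolation {f g : Ω → ℝ} (hf : 0 ≤ f) (hg : 0 ≤ g) (hfi : Integrable f P)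
    (hgi : Integrable g P) {M N h : ℝ} (hM : 0 < M) (hN : 0 < N) (hfM : ∫ ω, f ω ∂P ≤ M)
    (hgN : ∫ ω, g ω ∂P ≤ N) (h0 : 0 ≤ h) (h1 : h ≤ 1) :
    ∫ ω, f ω ^ (1 - h) * g ω ^ h ∂P ≤ M ^ (1 - h) * N ^ h := by
  have hpt : ∀ ω, f ω ^ (1 - h) * g ω ^ h ≤
      M ^ (1 - h) * N ^ h * ((1 - h) / M * f ω + h / N * g ω) := by
    intro ω
    have h2 := Real.geom_mean_le_arith_mean2_weighted (by linarith : 0 ≤ 1 - h) h0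
      (div_nonneg (hf ω) hM.le) (div_nonneg (hg ω) hN.le) (by ring)
    rw [Real.div_rpow (hf ω) hM.le, Real.div_rpow (hg ω) hN.le, div_mul_div_comm,
      div_le_iff₀ (by positivity)] at h2
    refine h2.trans_eq ?_
    ring
  have hI : Integrable (fun ω => M ^ (1 - h) * N ^ h * ((1 - h) / M * f ω + h / N * g ω)) P :=
    ((hfi.const_mul _).add (hgi.const_mul _)).const_mul _
  refine (integral_mono_of_nonneg (Eventually.of_forall fun ω =>
    mul_nonneg (Real.rpow_nonneg (hf ω) _) (Real.rpow_nonneg (hg ω) _)) hI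
    (Eventually.of_forall hpt)).trans ?_
  rw [integral_const_mul, integral_add (hfi.const_mul _) (hgi.const_mul _), integral_const_mul,
    integral_const_mul]
  refine mul_le_of_le_one_right (by positivity) ?_
  calc (1 - h) / M * ∫ ω, f ω ∂P + h / N * ∫ ω, g ω ∂P ≤ (1 - h) / M * M + h / N * N := by
        have : 0 ≤ 1 - h := by linarith
        gcongr
    _ = 1 := by field_simp; ring

/-- Moments of a subgaussian random variable with controlled variance. -/
theorem moment_le_of_subgaussianMGF [IsProbabilityMeasure P] (hb : 0 < b)
    (hc : (c : ℝ) = 3.4 * b ^ 2)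
    (hS : HasSubgaussianMGF S c P) (h2 : ∫ ω, S ω ^ 2 ∂P ≤ 2 * b ^ 2) {p : ℝ} (hp : 1 ≤ p) :
    (∫ ω, |S ω| ^ p ∂P) ^ (1 / p) ≤ Real.sqrt 2 * b * Real.sqrt p := by
  have hp0 : 0 < p := by linarith
  have hI2 : Integrable (fun ω => S ω ^ 2) P := by
    refine (HasSubgaussianMGF.integrable_abs_rpow hS (p := 2) two_pos).congr
      (Eventually.of_forall fun ω => ?_)
    norm_num
  have hI4 : Integrable (fun ω => S ω ^ 4) P := by
    refine (HasSubgaussianMGF.integrable_abs_rpow hS (p := 4) (by norm_num)).congr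
      (Eventually.of_forall fun ω => ?_)
    norm_num [Even.pow_abs]
  suffices h : ∫ ω, |S ω| ^ p ∂P ≤ (Real.sqrt 2 * b * Real.sqrt p) ^ p by
    calc _ ≤ ((Real.sqrt 2 * b * Real.sqrt p) ^ p) ^ (1 / p) := by
          refine Real.rpow_le_rpow (integral_nonneg fun ω => by positivity) h (by positivity)
      _ = _ := by
        rw [← Real.rpow_mul (by positivity), mul_one_div_cancel hp0.ne', Real.rpow_one]
  have hsqrtp : 1 ≤ Real.sqrt p := Real.one_le_sqrt.2 hp
  rcases le_total 3 p with hp3 | hp3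
  · refine (integral_abs_rpow_le_of_subgaussianMGF hb hc hS hp0).trans ?_
    rw [mul_assoc (Real.sqrt 2), Real.mul_rpow (x := Real.sqrt 2) (by positivity) (by positivity),
      Real.mul_rpow (x := Real.sqrt (3.4 / _)) (by positivity) (by positivity), ← mul_assoc]
    exact mul_le_mul_of_nonneg_right (sqrt_const_rpow_le hp3) (by positivity)
  rcases le_total p 2 with hp2 | hp2
  · have h := integral_interpolation (P := P) (f := fun _ => 1) (g := fun ω => S ω ^ 2)
      (fun _ => zero_le_one) (fun ω => sq_nonneg _) (integrable_const _) hI2 one_pos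
      (by positivity : 0 < 2 * b ^ 2) (by simp) h2 (by positivity : 0 ≤ p / 2) (by linarith)
    simp only [Real.one_rpow, one_mul] at h
    have e : ∀ u : ℝ, 0 ≤ u → (u ^ 2) ^ (p / 2) = u ^ p := fun u hu => by
      rw [← Real.rpow_natCast, ← Real.rpow_mul hu]; congr 1; push_cast; ring
    have e' : ∀ u : ℝ, (u ^ 2) ^ (p / 2) = |u| ^ p := fun u => by
      rw [← sq_abs, e _ (abs_nonneg _)]
    simp_rw [e'] at h
    refine h.trans ?_
    rw [show 2 * b ^ 2 = (Real.sqrt 2 * b) ^ 2 by rw [mul_pow, Real.sq_sqrt (by norm_num)],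
      e _ (by positivity)]
    refine Real.rpow_le_rpow (by positivity) ?_ hp0.le
    exact le_mul_of_one_le_right (by positivity) hsqrtp
  · have h4 : ∫ ω, S ω ^ 4 ∂P ≤ 50.1 * b ^ 4 := by
      have h := integral_abs_rpow_le_of_subgaussianMGF hb hc hS (p := 4) (by norm_num)
      have e : ∀ u : ℝ, |u| ^ (4 : ℝ) = u ^ 4 := fun u => by norm_num [Even.pow_abs]
      have e2 : ∀ u : ℝ, u ^ (4 : ℝ) = u ^ 4 := fun u => by norm_num
      simp_rw [e, e2] at h
      refine h.trans ?_
      rw [show Real.sqrt 4 = 2 by rw [show (4 : ℝ) = 2 ^ 2 by norm_num]; simp, mul_pow,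
        show Real.sqrt (3.4 / Real.exp 1) ^ 4 = (Real.sqrt (3.4 / Real.exp 1) ^ 2) ^ 2 by ring,
        Real.sq_sqrt (by positivity)]
      have h5 : 3.4 / Real.exp 1 ≤ 1.2508 := by
        rw [div_le_iff₀ (Real.exp_pos _)]; linarith [Real.exp_one_gt_d9]
      have h6 : (3.4 / Real.exp 1) ^ 2 ≤ 1.2508 ^ 2 := by gcongr
      have h7 : 0 < b ^ 4 := by positivity
      rw [mul_pow]
      nlinarith
    set k : ℝ := p / 2 - 1 with hk
    have hk0 : 0 ≤ k := by simp only [k]; linarith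
    have hk1 : k ≤ 1 / 2 := by simp only [k]; linarith
    have h := integral_interpolation (P := P) (f := fun ω => S ω ^ 2) (g := fun ω => S ω ^ 4)
      (fun ω => sq_nonneg _) (fun ω => by positivity) hI2 hI4
      (by positivity : 0 < 2 * b ^ 2) (by positivity : 0 < 50.1 * b ^ 4) h2 h4 hk0 (by linarith)
    have hexp : 0 < 1 + k := by linarith
    have e : ∀ u : ℝ, (u ^ 2) ^ (1 - k) * (u ^ 4) ^ k = |u| ^ p := fun u => by
      rw [← sq_abs, show u ^ 4 = (|u| ^ 2) ^ 2 by rw [sq_abs]; ring, ← Real.rpow_natCast (|u| ^ 2),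
        ← Real.rpow_mul (by positivity), ← Real.rpow_add_of_nonneg (by positivity) (by linarith)
          (by positivity), ← Real.rpow_natCast, ← Real.rpow_mul (by positivity)]
      congr 1; simp only [k]; push_cast; ring
    simp_rw [e] at h
    refine h.trans ?_
    rw [show (50.1 : ℝ) * b ^ 4 = 50.1 / 4 * (2 * b ^ 2) ^ 2 by ring,
      Real.mul_rpow (x := 50.1 / 4) (by positivity) (by positivity),
      ← Real.rpow_natCast (2 * b ^ 2) 2,
      ← Real.rpow_mul (by positivity), mul_left_comm, ← Real.rpow_add (by positivity)]
    have e3 : (Real.sqrt 2 * b * Real.sqrt p) ^ p = (2 * b ^ 2) ^ (1 + k) * p ^ (1 + k) := by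
      rw [← Real.mul_rpow (by positivity) (by positivity),
        show 2 * b ^ 2 * p = (Real.sqrt 2 * b * Real.sqrt p) ^ 2 by
          rw [mul_pow, mul_pow, Real.sq_sqrt (by norm_num), Real.sq_sqrt hp0.le],
        ← Real.rpow_natCast _ 2, ← Real.rpow_mul (by positivity)]
      congr 1; simp only [k]; push_cast; ring
    rw [e3, mul_comm, show 1 - k + ((2 : ℕ) : ℝ) * k = 1 + k by push_cast; ring]
    gcongr
    have hp' : p = 2 * (1 + k) := by simp only [k]; ring
    calc (50.1 / 4 : ℝ) ^ k = 2 ^ k * (50.1 / 8) ^ k := by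
          rw [← Real.mul_rpow (by norm_num) (by norm_num)]; norm_num
      _ ≤ 2 ^ k * (2 * (1 + k)) := by
          gcongr
          have h8 := rpow_one_add_le_one_add_mul_self (s := 1.51) (by norm_num)
            (by linarith : 0 ≤ 2 * k) (by linarith)
          calc (50.1 / 8 : ℝ) ^ k ≤ ((1 + 1.51) ^ 2) ^ k := by gcongr; norm_num
            _ = (1 + 1.51) ^ (2 * k) := by
              rw [← Real.rpow_natCast, ← Real.rpow_mul (by norm_num)]; norm_num
            _ ≤ 1 + 2 * k * 1.51 := h8
            _ ≤ _ := by linarith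
      _ = 2 ^ (1 + k) * (1 + k) := by rw [Real.rpow_add two_pos, Real.rpow_one]; ring
      _ ≤ 2 ^ (1 + k) * (1 + k) ^ (1 + k) := by
          gcongr
          exact Real.self_le_rpow_of_one_le (by linarith) (by linarith)
      _ = p ^ (1 + k) := by
          rw [hp', Real.mul_rpow (by norm_num) (by linarith)]

end Moments

/-- The real sign attached to a Boolean. -/
def boolSign (s : Bool) : ℝ := cond s 1 (-1)

theorem boolSign_mul_self (s : Bool) : boolSign s * boolSign s = 1 := by
  cases s <;> simp [boolSign]

theorem exists_signs_norm_sq_sum_le {V : Type*} [NormedAddCommGroup V] [InnerProductSpace ℝ V]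
    (J : ℕ) (u : Fin J → V) :
    ∃ σ : Fin J → Bool, ‖∑ l, boolSign (σ l) • u l‖ ^ 2 ≤ ∑ l, ‖u l‖ ^ 2 := by
  induction J with
  | zero => exact ⟨fun _ => true, by simp⟩
  | succ J ih =>
    obtain ⟨σ, hσ⟩ := ih fun l => u l.succ
    set W := ∑ l : Fin J, boolSign (σ l) • u l.succ
    have key : ∀ s : Bool,
        ‖∑ l, boolSign ((Fin.cons s σ : Fin (J + 1) → Bool) l) • u l‖ ^ 2 =
          ‖u 0‖ ^ 2 + 2 * (boolSign s * inner ℝ (u 0) W) + ‖W‖ ^ 2 := by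
      intro s
      rw [Fin.sum_univ_succ]
      simp only [Fin.cons_zero, Fin.cons_succ]
      rw [norm_add_sq_real, norm_smul, real_inner_smul_left]
      have : ‖boolSign s‖ = 1 := by cases s <;> simp [boolSign]
      rw [this, one_mul]
    rw [Fin.sum_univ_succ]
    rcases le_total 0 (inner ℝ (u 0) W) with h | h
    · refine ⟨Fin.cons false σ, ?_⟩
      rw [key]
      simp only [boolSign, cond_false] at *
      linarith
    · refine ⟨Fin.cons true σ, ?_⟩
      rw [key]
      simp only [boolSign, cond_true] at *
      linarith

theorem exists_perm_antitone {n : ℕ} (S lam : Fin n → ℝ) :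
    ∃ π : Equiv.Perm (Fin n), ∀ i i', S i < S i' → lam (π i') ≤ lam (π i) := by
  refine ⟨(Tuple.sort S).symm.trans (Fin.revPerm.trans (Tuple.sort lam)), fun i i' h => ?_⟩
  have h1 : (Tuple.sort S).symm i < (Tuple.sort S).symm i' := by
    by_contra! hle
    have := Tuple.monotone_sort S hle
    simp only [Function.comp_apply, Equiv.apply_symm_apply] at this
    linarith
  exact Tuple.monotone_sort lam (Fin.rev_le_rev.2 h1.le)

/-- Greedy balancing of permuted copies of a vector with entries in `[0, Λ]`. -/
theorem exists_perms_balanced {n : ℕ} {lam : Fin n → ℝ} {Λ : ℝ} (h0 : ∀ i, 0 ≤ lam i)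
    (h1 : ∀ i, lam i ≤ Λ) (hΛ : 0 ≤ Λ) (J : ℕ) :
    ∃ π : Fin J → Equiv.Perm (Fin n),
      ∀ i i', ∑ l, lam (π l i) - ∑ l, lam (π l i') ≤ Λ := by
  induction J with
  | zero => exact ⟨fun _ => 1, by simpa using fun _ _ => hΛ⟩
  | succ J ih =>
    obtain ⟨π, hπ⟩ := ih
    obtain ⟨ρ, hρ⟩ := exists_perm_antitone (fun i => ∑ l, lam (π l i)) lam
    refine ⟨Fin.cons ρ π, fun i i' => ?_⟩
    simp only [Fin.sum_univ_succ, Fin.cons_zero, Fin.cons_succ]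
    have h2 := hπ i i'
    have h3 := h0 (ρ i')
    have h4 := h1 (ρ i)
    rcases lt_or_ge (∑ l, lam (π l i')) (∑ l, lam (π l i)) with h | h
    · have := hρ i' i h
      linarith
    · linarith

theorem exists_number_of_copies {r : ℝ} (hr0 : 0 < r) (hr1 : r ≤ 1) :
    ∃ J : ℕ, 1 ≤ J ∧ ∀ M m : ℝ, M - m ≤ 1 → J * r ≤ M → 0 < m ∧ J * r ^ 2 * M ≤ 4 * m := by
  suffices h : ∃ J : ℕ, 1 ≤ J ∧ 1 < J * r ∧ (J * r) ^ 2 * r ≤ 4 * (J * r - 1) by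
    obtain ⟨J, hJ, hu, h⟩ := h
    refine ⟨J, hJ, fun M m hMm hM => ⟨by linarith, ?_⟩⟩
    set u : ℝ := J * r
    have h4 : u * r ≤ 4 := by
      by_contra! h5
      nlinarith
    have h5 : u * (4 - u * r) ≤ M * (4 - u * r) := by
      gcongr
    have : J * r ^ 2 * M = u * r * M := by simp only [u]; ring
    rw [this]
    nlinarith
  rcases le_total 0.62 r with h | h
  · refine ⟨2, by norm_num, by push_cast; linarith, ?_⟩
    push_cast
    nlinarith [mul_nonneg (sub_nonneg.2 hr1) (by nlinarith : 0 ≤ r ^ 2 + r - 1)]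
  · have h1 : 2 / r ≤ ⌈2 / r⌉₊ := Nat.le_ceil _
    have h2 : (⌈2 / r⌉₊ : ℝ) < 2 / r + 1 := Nat.ceil_lt_add_one (by positivity)
    have h3 : 2 ≤ ⌈2 / r⌉₊ * r := by rwa [div_le_iff₀ hr0] at h1
    have h4 : ⌈2 / r⌉₊ * r ≤ 2 + r := by
      calc _ ≤ (2 / r + 1) * r := by gcongr
        _ = _ := by field_simp
    refine ⟨⌈2 / r⌉₊, ?_, by linarith, ?_⟩
    · exact Nat.one_le_ceil_iff.2 (by positivity)
    · obtain ⟨d, hd⟩ : ∃ d, (⌈2 / r⌉₊ : ℝ) * r = 2 + d := ⟨_, (add_sub_cancel _ _).symm⟩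
      rw [hd] at h3 h4 ⊢
      have hd0 : 0 ≤ d := by linarith
      have hd1 : d ≤ r := by linarith
      have h5 : d ^ 2 * r ≤ r ^ 2 * r := by gcongr
      nlinarith [mul_nonneg hd0 (by linarith : 0 ≤ 1 - r), mul_nonneg hr0.le hr0.le]

theorem integral_eval_pi {ι E : Type*} [Fintype ι] [MeasurableSpace E] {μ : Measure E}
    [IsProbabilityMeasure μ] (j : ι) {h : E → ℝ} (hh : Measurable h) :
    ∫ x : ι → E, h (x j) ∂(Measure.pi fun _ => μ) = ∫ x, h x ∂μ := by
  have hmp := measurePreserving_eval (fun _ : ι => μ) j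
  have e := integral_map (μ := Measure.pi fun _ : ι => μ) hmp.measurable.aemeasurable
    (f := h) hh.aestronglyMeasurable
  rw [hmp.map_eq] at e
  exact e.symm

/-- Second moments of sums of independent centred variables. -/
theorem integral_sum_mul_sum_pi {ι E : Type*} [Fintype ι] [MeasurableSpace E] {μ : Measure E}
    [IsProbabilityMeasure μ] {f g : ι → E → ℝ} (hfm : ∀ j, Measurable (f j))
    (hgm : ∀ j, Measurable (g j)) (hf : ∀ j, MemLp (f j) 2 μ)
    (hg : ∀ j, MemLp (g j) 2 μ) (hf0 : ∀ j, ∫ x, f j x ∂μ = 0) :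
    Integrable (fun x : ι → E => (∑ j, f j (x j)) * ∑ k, g k (x k)) (Measure.pi fun _ => μ) ∧
      ∫ x : ι → E, (∑ j, f j (x j)) * ∑ k, g k (x k) ∂(Measure.pi fun _ => μ) =
        ∑ j, ∫ x, f j x * g j x ∂μ := by
  classical
  set P := Measure.pi fun _ : ι => μ
  have hmp : ∀ j, MeasurePreserving (Function.eval j) P μ := fun j =>
    measurePreserving_eval (fun _ : ι => μ) j
  have hf' : ∀ j, MemLp (fun x : ι → E => f j (x j)) 2 P := fun j =>
    (hf j).comp_measurePreserving (hmp j)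
  have hg' : ∀ j, MemLp (fun x : ι → E => g j (x j)) 2 P := fun j =>
    (hg j).comp_measurePreserving (hmp j)
  have hI : ∀ j k, Integrable (fun x : ι → E => f j (x j) * g k (x k)) P := fun j k =>
    (hf' j).integrable_mul (hg' k)
  have hIj : ∀ j, Integrable (fun x : ι → E => ∑ k, f j (x j) * g k (x k)) P := fun j =>
    integrable_finsetSum _ fun k _ => hI j k
  simp_rw [Finset.sum_mul_sum]
  refine ⟨integrable_finsetSum _ fun j _ => hIj j, ?_⟩
  rw [integral_finsetSum _ fun j _ => hIj j]
  refine Finset.sum_congr rfl fun j _ => ?_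
  rw [integral_finsetSum _ fun k _ => hI j k]
  rw [Finset.sum_eq_single j]
  · exact integral_eval_pi j ((hfm j).mul (hgm j))
  · intro k _ hkj
    have hind : (fun x : ι → E => f j (x j)) ⟂ᵢ[P] (fun x : ι → E => g k (x k)) := by
      have h := (iIndepFun_pi (μ := fun _ : ι => μ) (X := fun _ : ι => (id : E → E))
        fun i => aemeasurable_id).indepFun hkj.symm
      exact h.comp (hfm j) (hgm k)
    have h0 : ∫ x, f j (x j) ∂P = 0 := (integral_eval_pi j (hfm j)).trans (hf0 j)
    rw [hind.integral_fun_mul_eq_mul_integral (hf' j).1 (hg' k).1, h0, zero_mul]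
  · simp

section Directional

open RealInnerProductSpace

variable {n : ℕ} {μ : Measure (EuclideanSpace ℝ (Fin n))}

theorem IsLogConcaveMeasure.integrable_inner_pow [IsProbabilityMeasure μ]
    (hμ : IsLogConcaveMeasure μ)
    (a θ : EuclideanSpace ℝ (Fin n)) (p : ℕ) :
    Integrable (fun x => |⟪x - a, θ⟫| ^ p) μ := by
  have hm : Measurable fun x : EuclideanSpace ℝ (Fin n) => ⟪x - a, θ⟫ := by fun_prop
  have hpl : IsPrekopaLeindler (μ.map fun x => ⟪x - a, θ⟫) :=
    hμ.isPrekopaLeindler.map hm fun s t hst x y => by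
      have : s • x + t • y - a = s • (x - a) + t • (y - a) := by
        have h : a = s • a + t • a := by rw [← add_smul, hst, one_smul]
        nth_rewrite 1 [h]
        simp only [smul_sub]; abel
      rw [this, inner_add_left, real_inner_smul_left, real_inner_smul_left, smul_eq_mul,
        smul_eq_mul]
  have := Measure.isProbabilityMeasure_map (μ := μ) hm.aemeasurable
  exact (hpl.integrable_abs_pow p).comp_measurable hm

theorem IsLogConcaveMeasure.memLp_inner [IsProbabilityMeasure μ] (hμ : IsLogConcaveMeasure μ)
    (a θ : EuclideanSpace ℝ (Fin n)) : MemLp (fun x => ⟪x - a, θ⟫) 2 μ := by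
  have hm : Measurable fun x : EuclideanSpace ℝ (Fin n) => ⟪x - a, θ⟫ := by fun_prop
  rw [memLp_two_iff_integrable_sq hm.aestronglyMeasurable]
  simpa using hμ.integrable_inner_pow a θ 2

theorem IsLogConcaveMeasure.integrable_inner [IsProbabilityMeasure μ] (hμ : IsLogConcaveMeasure μ)
    (a θ : EuclideanSpace ℝ (Fin n)) : Integrable (fun x => ⟪x - a, θ⟫) μ :=
  (hμ.memLp_inner a θ).integrable one_le_two

theorem inner_eq_sum_mul (x θ : EuclideanSpace ℝ (Fin n)) : ⟪x, θ⟫ = ∑ i, x i * θ i := by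
  simp [PiLp.inner_apply, mul_comm]

theorem inner_single_eq (x : EuclideanSpace ℝ (Fin n)) (i : Fin n) :
    ⟪x, EuclideanSpace.single i (1 : ℝ)⟫ = x i := by
  simp [inner_eq_sum_mul]

theorem IsLogConcaveMeasure.integrable_apply [IsProbabilityMeasure μ]
    (hμ : IsLogConcaveMeasure μ) (i : Fin n) :
    Integrable (fun x => x i) μ := by
  simpa only [sub_zero, inner_single_eq] using
    hμ.integrable_inner 0 (EuclideanSpace.single i (1 : ℝ))

theorem IsLogConcaveMeasure.integral_inner [IsProbabilityMeasure μ] (hμ : IsLogConcaveMeasure μ)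
    (θ : EuclideanSpace ℝ (Fin n)) : ∫ x, ⟪x, θ⟫ ∂μ = ⟪meanVec μ, θ⟫ := by
  simp_rw [inner_eq_sum_mul]
  rw [integral_finsetSum _ fun i _ => (hμ.integrable_apply i).mul_const _]
  simp_rw [integral_mul_const]
  rfl

theorem IsLogConcaveMeasure.integral_inner_sub_meanVec [IsProbabilityMeasure μ]
    (hμ : IsLogConcaveMeasure μ)
    (θ : EuclideanSpace ℝ (Fin n)) : ∫ x, ⟪x - meanVec μ, θ⟫ ∂μ = 0 := by
  simp_rw [inner_sub_left]
  rw [integral_sub (by simpa using hμ.integrable_inner 0 θ) (integrable_const _), hμ.integral_inner]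
  simp

/-- The covariance form in directions `u`, `v`. -/
def covForm (μ : Measure (EuclideanSpace ℝ (Fin n))) (u v : EuclideanSpace ℝ (Fin n)) : ℝ :=
  ∫ x, ⟪x - meanVec μ, u⟫ * ⟪x - meanVec μ, v⟫ ∂μ

theorem covMatrix_apply (i j : Fin n) :
    covMatrix μ i j =
      covForm μ (EuclideanSpace.single i (1 : ℝ)) (EuclideanSpace.single j (1 : ℝ)) := by
  simp only [covForm, inner_single_eq]
  rfl

theorem IsLogConcaveMeasure.covForm_eq [IsProbabilityMeasure μ] (hμ : IsLogConcaveMeasure μ)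
    (u v : EuclideanSpace ℝ (Fin n)) :
    covForm μ u v = ⟪u, Matrix.toEuclideanCLM (𝕜 := ℝ) (covMatrix μ) v⟫ := by
  have hI : ∀ i j, Integrable (fun x => ((x - meanVec μ) i) * ((x - meanVec μ) j)) μ := by
    intro i j
    have h := (hμ.memLp_inner (meanVec μ) (EuclideanSpace.single i (1 : ℝ))).integrable_mul
      (hμ.memLp_inner (meanVec μ) (EuclideanSpace.single j (1 : ℝ)))
    simpa only [inner_single_eq, Pi.mul_def] using h
  have e : ∀ x, ⟪x - meanVec μ, u⟫ * ⟪x - meanVec μ, v⟫ =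
      ∑ i, ∑ j, u i * v j * ((x - meanVec μ) i * (x - meanVec μ) j) := by
    intro x
    rw [inner_eq_sum_mul, inner_eq_sum_mul, Finset.sum_mul_sum]
    exact Finset.sum_congr rfl fun i _ => Finset.sum_congr rfl fun j _ => by ring
  unfold covForm
  simp_rw [e]
  rw [integral_finsetSum _ fun i _ => integrable_finsetSum _ fun j _ => (hI i j).const_mul _]
  rw [inner_eq_sum_mul]
  refine Finset.sum_congr rfl fun i _ => ?_
  rw [integral_finsetSum _ fun j _ => (hI i j).const_mul _]
  rw [Matrix.ofLp_toEuclideanCLM]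
  simp only [Matrix.mulVec, dotProduct]
  rw [Finset.mul_sum]
  refine Finset.sum_congr rfl fun j _ => ?_
  rw [integral_const_mul]
  have : covMatrix μ i j = ∫ x, (x - meanVec μ) i * (x - meanVec μ) j ∂μ := rfl
  rw [this]
  ring

theorem IsSubgaussianWith.integral_inner_pow_le {b : ℝ} (hs : IsSubgaussianWith b μ) 
    (θ : EuclideanSpace ℝ (Fin n)) {p : ℕ} (hp : 1 ≤ p) :
    ∫ x, |⟪x - meanVec μ, θ⟫| ^ p ∂μ ≤ (b * ‖θ‖ * Real.sqrt p) ^ p := by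
  have hp' : (1 : ℝ) ≤ p := by exact_mod_cast hp
  have hp0 : p ≠ 0 := by omega
  rcases eq_or_ne θ 0 with rfl | hθ
  · simp [hp0]
  have hn : 0 < ‖θ‖ := norm_pos_iff.2 hθ
  have h := hs p hp' (‖θ‖⁻¹ • θ) (by rw [norm_smul, norm_inv, norm_norm, inv_mul_cancel₀ hn.ne'])
  set I := ∫ x, |⟪x - meanVec μ, ‖θ‖⁻¹ • θ⟫| ^ (p : ℝ) ∂μ with hI
  have hI0 : 0 ≤ I := integral_nonneg fun x => by positivity
  have h2 : I ≤ (b * Real.sqrt p) ^ p := by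
    have h3 := pow_le_pow_left₀ (by positivity) h p
    rwa [← Real.rpow_natCast, ← Real.rpow_mul hI0, one_div_mul_cancel (by positivity),
      Real.rpow_one] at h3
  have h4 : ∫ x, |⟪x - meanVec μ, θ⟫| ^ p ∂μ = ‖θ‖ ^ p * I := by
    rw [hI, ← integral_const_mul]
    congr 1
    ext x
    rw [Real.rpow_natCast, real_inner_smul_right, abs_mul, abs_inv, abs_norm, mul_pow,
      ← mul_assoc, ← mul_pow, mul_inv_cancel₀ hn.ne', one_pow, one_mul]
  rw [h4]
  calc _ ≤ ‖θ‖ ^ p * (b * Real.sqrt p) ^ p := by gcongr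
    _ = _ := by rw [← mul_pow]; ring

theorem IsSubgaussianWith.hasSubgaussianMGF_inner [IsProbabilityMeasure μ] {b : ℝ} (hb : 0 ≤ b)
    (hs : IsSubgaussianWith b μ) (hμ : IsLogConcaveMeasure μ) (θ : EuclideanSpace ℝ (Fin n)) :
    HasSubgaussianMGF (fun x => ⟪x - meanVec μ, θ⟫) (3.4 * (b * ‖θ‖) ^ 2).toNNReal μ :=
  hasSubgaussianMGF_of_moments (by fun_prop) (by positivity)
    (fun p => hμ.integrable_inner_pow _ _ p) (hμ.integral_inner_sub_meanVec θ)
    (fun _ hp => hs.integral_inner_pow_le θ (by omega)) (Real.coe_toNNReal _ (by positivity))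

end Directional

section CoisometricImage

open RealInnerProductSpace

variable {ι : Type*} [Fintype ι] {n m : ℕ} {μ : Measure (EuclideanSpace ℝ (Fin n))}
  {L : (ι → EuclideanSpace ℝ (Fin n)) →L[ℝ] EuclideanSpace ℝ (Fin m)}
  {w : EuclideanSpace ℝ (Fin m) → ι → EuclideanSpace ℝ (Fin n)}

/-- The family `w` is the adjoint of `L` for the Euclidean structure on the product, and it is
norm preserving; thus `L` is a coisometry. -/
structure IsCoisometryWith (L : (ι → EuclideanSpace ℝ (Fin n)) →L[ℝ] EuclideanSpace ℝ (Fin m))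
    (w : EuclideanSpace ℝ (Fin m) → ι → EuclideanSpace ℝ (Fin n)) : Prop where
  inner_eq : ∀ x θ, ⟪L x, θ⟫ = ∑ j, ⟪x j, w θ j⟫
  sum_norm_sq : ∀ θ, ∑ j, ‖w θ j‖ ^ 2 = ‖θ‖ ^ 2

theorem IsCoisometryWith.surjective (h : IsCoisometryWith L w) : Function.Surjective L := by
  have hr : LinearMap.range L.toLinearMap = ⊤ := by
    rw [← Submodule.orthogonal_eq_bot_iff, Submodule.eq_bot_iff]
    intro θ hθ
    have h0 : ⟪L (w θ), θ⟫ = 0 := hθ _ ⟨w θ, rfl⟩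
    rw [h.inner_eq] at h0
    simp_rw [real_inner_self_eq_norm_sq] at h0
    rw [h.sum_norm_sq] at h0
    simpa using h0
  exact LinearMap.range_eq_top.1 hr

theorem IsCoisometryWith.isLogConcaveMeasure_map (h : IsCoisometryWith L w)
    [IsProbabilityMeasure μ] (hμ : IsLogConcaveMeasure μ) :
    IsLogConcaveMeasure ((Measure.pi fun _ : ι => μ).map L) :=
  hμ.map_pi L h.surjective

theorem isProbabilityMeasure_map_pi [IsProbabilityMeasure μ] :
    IsProbabilityMeasure ((Measure.pi fun _ : ι => μ).map L) :=
  Measure.isProbabilityMeasure_map L.continuous.measurable.aemeasurable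

theorem IsCoisometryWith.meanVec_map (h : IsCoisometryWith L w)
    [IsProbabilityMeasure μ] (hμ : IsLogConcaveMeasure μ) :
    meanVec ((Measure.pi fun _ : ι => μ).map L) = L fun _ => meanVec μ := by
  have := isProbabilityMeasure_map_pi (L := L) (μ := μ)
  refine ext_inner_right ℝ fun θ => ?_
  rw [← (h.isLogConcaveMeasure_map hμ).integral_inner θ,
    integral_map L.continuous.measurable.aemeasurable (by fun_prop), h.inner_eq]
  simp_rw [h.inner_eq]
  rw [integral_finsetSum]
  · refine Finset.sum_congr rfl fun j _ => ?_
    rw [integral_eval_pi j (h := fun x => ⟪x, w θ j⟫) (by fun_prop), hμ.integral_inner]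
  · intro j _
    have hi : Integrable (fun x => ⟪x, w θ j⟫) μ := by
      simpa only [sub_zero] using hμ.integrable_inner 0 (w θ j)
    exact (measurePreserving_eval (fun _ : ι => μ) j).integrable_comp_of_integrable hi

theorem IsCoisometryWith.inner_sub_meanVec (h : IsCoisometryWith L w)
    [IsProbabilityMeasure μ] (hμ : IsLogConcaveMeasure μ) (x : ι → EuclideanSpace ℝ (Fin n))
    (θ : EuclideanSpace ℝ (Fin m)) :
    ⟪L x - meanVec ((Measure.pi fun _ : ι => μ).map L), θ⟫ = ∑ j, ⟪x j - meanVec μ, w θ j⟫ := by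
  rw [h.meanVec_map hμ, ← map_sub, h.inner_eq]
  rfl

theorem IsCoisometryWith.covForm_map (h : IsCoisometryWith L w)
    [IsProbabilityMeasure μ] (hμ : IsLogConcaveMeasure μ) (θ θ' : EuclideanSpace ℝ (Fin m)) :
    covForm ((Measure.pi fun _ : ι => μ).map L) θ θ' = ∑ j, covForm μ (w θ j) (w θ' j) := by
  unfold covForm
  rw [integral_map L.continuous.measurable.aemeasurable (by fun_prop)]
  simp_rw [h.inner_sub_meanVec hμ]
  exact (integral_sum_mul_sum_pi (f := fun j x => ⟪x - meanVec μ, w θ j⟫)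
    (g := fun j x => ⟪x - meanVec μ, w θ' j⟫) (fun j => by fun_prop) (fun j => by fun_prop)
    (fun j => hμ.memLp_inner _ _) (fun j => hμ.memLp_inner _ _)
    (fun j => hμ.integral_inner_sub_meanVec _)).2

theorem IsCoisometryWith.isSubgaussianWith_map (h : IsCoisometryWith L w)
    [IsProbabilityMeasure μ] (hμ : IsLogConcaveMeasure μ) {b : ℝ} (hb : 0 < b)
    (hs : IsSubgaussianWith b μ) :
    IsSubgaussianWith (Real.sqrt 2 * b) ((Measure.pi fun _ : ι => μ).map L) := by
  intro p hp θ hθ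
  rw [integral_map L.continuous.measurable.aemeasurable
    (Measurable.pow_const (by fun_prop) p).aestronglyMeasurable]
  have hsum : ∑ j, ‖w θ j‖ ^ 2 = 1 := by rw [h.sum_norm_sq, hθ, one_pow]
  have h2 : ∫ x, ⟪L x - meanVec ((Measure.pi fun _ : ι => μ).map L), θ⟫ ^ 2
      ∂(Measure.pi fun _ : ι => μ) ≤ 2 * b ^ 2 := by
    have e := h.covForm_map hμ θ θ
    unfold covForm at e
    rw [integral_map L.continuous.measurable.aemeasurable (by fun_prop)] at e
    simp_rw [← sq] at e
    rw [e]
    calc _ ≤ ∑ j, 2 * b ^ 2 * ‖w θ j‖ ^ 2 := by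
          refine Finset.sum_le_sum fun j _ => ?_
          have := hs.integral_inner_pow_le (w θ j) (p := 2) (by norm_num)
          simp only [sq_abs, Nat.cast_ofNat, mul_pow, Real.sq_sqrt zero_le_two] at this
          linarith
      _ = _ := by rw [← Finset.mul_sum, hsum, mul_one]
  simp_rw [h.inner_sub_meanVec hμ] at h2 ⊢
  have hind := iIndepFun_pi (μ := fun _ : ι => μ)
    (X := fun j x => ⟪x - meanVec μ, w θ j⟫) fun j => by fun_prop
  have hS := HasSubgaussianMGF.sum_of_iIndepFun hind (s := Finset.univ)
    (c := fun j => (3.4 * (b * ‖w θ j‖) ^ 2).toNNReal) fun j _ => by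
      have hj := hs.hasSubgaussianMGF_inner hb.le hμ (w θ j)
      refine HasSubgaussianMGF.of_map (Y := Function.eval j) (μ := Measure.pi fun _ : ι => μ)
        (X := fun x => ⟪x - meanVec μ, w θ j⟫) (measurable_pi_apply j).aemeasurable ?_
      rwa [(measurePreserving_eval (fun _ : ι => μ) j).map_eq]
  refine moment_le_of_subgaussianMGF hb ?_ hS h2 hp
  rw [NNReal.coe_sum]
  have e : ∀ j, ((3.4 * (b * ‖w θ j‖) ^ 2).toNNReal : ℝ) = 3.4 * (b ^ 2 * ‖w θ j‖ ^ 2) :=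
    fun j => by rw [Real.coe_toNNReal _ (by positivity), mul_pow]
  simp_rw [e]
  rw [← Finset.mul_sum, ← Finset.mul_sum, hsum, mul_one]

end CoisometricImage

open scoped Matrix.Norms.L2Operator in
theorem matOpNorm_diagonal {m : ℕ} (d : Fin m → ℝ) : matOpNorm (Matrix.diagonal d) = ‖d‖ :=
  Matrix.l2_opNorm_diagonal d

section Mixing

open RealInnerProductSpace

variable {n N m J : ℕ}

/-- The coordinates of `N` vectors in an orthonormal basis reordered by `ρ`. -/
def mixRow (v : OrthonormalBasis (Fin n) ℝ (EuclideanSpace ℝ (Fin n))) (ρ : Equiv.Perm (Fin n))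
    (e : Fin n × Fin N ≃ Fin m) :
    (Fin N → EuclideanSpace ℝ (Fin n)) →ₗ[ℝ] EuclideanSpace ℝ (Fin m) where
  toFun u := WithLp.toLp 2 fun q => ⟪u (e.symm q).2, v (ρ (e.symm q).1)⟫
  map_add' x y := by ext q; simp [inner_add_left]
  map_smul' t x := by ext q; simp [real_inner_smul_left]

/-- A signed combination of `J` blocks of `N` vectors, the coordinates of the block `l` being
reordered by `π l`. -/
def mixMap (v : OrthonormalBasis (Fin n) ℝ (EuclideanSpace ℝ (Fin n)))
    (π : Fin J → Equiv.Perm (Fin n)) (e : Fin n × Fin N ≃ Fin m) (s : Fin J → ℝ) :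
    (Fin J × Fin N → EuclideanSpace ℝ (Fin n)) →L[ℝ] EuclideanSpace ℝ (Fin m) :=
  LinearMap.toContinuousLinearMap <|
    (Real.sqrt J)⁻¹ • ∑ l, s l • mixRow v (π l) e ∘ₗ LinearMap.funLeft ℝ _ fun k => (l, k)

/-- The Euclidean adjoint of `mixMap`. -/
def mixAdjoint (v : OrthonormalBasis (Fin n) ℝ (EuclideanSpace ℝ (Fin n)))
    (π : Fin J → Equiv.Perm (Fin n)) (e : Fin n × Fin N ≃ Fin m) (s : Fin J → ℝ)
    (θ : EuclideanSpace ℝ (Fin m)) (j : Fin J × Fin N) : EuclideanSpace ℝ (Fin n) :=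
  ((Real.sqrt J)⁻¹ * s j.1) • ∑ i, θ (e (i, j.2)) • v (π j.1 i)

variable {v : OrthonormalBasis (Fin n) ℝ (EuclideanSpace ℝ (Fin n))}
  {π : Fin J → Equiv.Perm (Fin n)} {e : Fin n × Fin N ≃ Fin m} {s : Fin J → ℝ}

theorem mixMap_apply (x : Fin J × Fin N → EuclideanSpace ℝ (Fin n)) :
    mixMap v π e s x =
      (Real.sqrt J)⁻¹ • ∑ l, s l • mixRow v (π l) e fun k => x (l, k) := by
  simp only [mixMap, LinearMap.coe_toContinuousLinearMap', LinearMap.smul_apply,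
    LinearMap.sum_apply, LinearMap.comp_apply]
  rfl

theorem inner_mixRow (ρ : Equiv.Perm (Fin n)) (u : Fin N → EuclideanSpace ℝ (Fin n))
    (θ : EuclideanSpace ℝ (Fin m)) :
    ⟪mixRow v ρ e u, θ⟫ = ∑ k, ⟪u k, ∑ i, θ (e (i, k)) • v (ρ i)⟫ := by
  rw [inner_eq_sum_mul, ← e.sum_comp, Fintype.sum_prod_type_right]
  simp only [mixRow, LinearMap.coe_mk, AddHom.coe_mk, Equiv.symm_apply_apply, inner_sum,
    real_inner_smul_right, mul_comm]

theorem norm_sq_mixRow (ρ : Equiv.Perm (Fin n)) (u : Fin N → EuclideanSpace ℝ (Fin n)) :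
    ‖mixRow v ρ e u‖ ^ 2 = ∑ k, ‖u k‖ ^ 2 := by
  rw [EuclideanSpace.real_norm_sq_eq, ← e.sum_comp, Fintype.sum_prod_type_right]
  refine Finset.sum_congr rfl fun k _ => ?_
  rw [← v.sum_sq_inner_left, ← Equiv.sum_comp ρ fun i => ⟪u k, v i⟫ ^ 2]
  simp [mixRow]

theorem isCoisometryWith_mixMap (hJ : 1 ≤ J) (hs : ∀ l, s l * s l = 1) :
    IsCoisometryWith (mixMap v π e s) (mixAdjoint v π e s) where
  inner_eq x θ := by
    simp only [mixMap_apply, real_inner_smul_left, sum_inner, inner_mixRow, mixAdjoint,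
      Fintype.sum_prod_type, real_inner_smul_right, Finset.mul_sum, mul_assoc]
  sum_norm_sq θ := by
    have hJ' : (0 : ℝ) < J := by exact_mod_cast hJ
    have h1 : ∀ j : Fin J × Fin N,
        ‖mixAdjoint v π e s θ j‖ ^ 2 = (J : ℝ)⁻¹ * ∑ i, θ (e (i, j.2)) ^ 2 := by
      intro j
      have ho : Orthonormal ℝ fun i => v (π j.1 i) :=
        v.orthonormal.comp _ (π j.1).injective
      rw [mixAdjoint, norm_smul, mul_pow, Real.norm_eq_abs, sq_abs, mul_pow, inv_pow,
        Real.sq_sqrt hJ'.le, sq (s _), hs, mul_one, ← real_inner_self_eq_norm_sq,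
        ho.inner_sum]
      simp [sq]
    simp_rw [h1]
    rw [Fintype.sum_prod_type]
    simp only [Finset.sum_const, Finset.card_univ, Fintype.card_fin, nsmul_eq_mul]
    rw [EuclideanSpace.real_norm_sq_eq, ← e.sum_comp, Fintype.sum_prod_type_right,
      ← Finset.mul_sum, ← mul_assoc, mul_inv_cancel₀ hJ'.ne', one_mul]

theorem covForm_mixMap (hJ : 1 ≤ J) (hs : ∀ l, s l * s l = 1)
    {μ : Measure (EuclideanSpace ℝ (Fin n))} [IsProbabilityMeasure μ]
    (hμ : IsLogConcaveMeasure μ) {lam : Fin n → ℝ}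
    (hv : ∀ i, Matrix.toEuclideanCLM (𝕜 := ℝ) (covMatrix μ) (v i) = lam i • v i)
    (θ θ' : EuclideanSpace ℝ (Fin m)) :
    covForm ((Measure.pi fun _ : Fin J × Fin N => μ).map (mixMap v π e s)) θ θ' =
      ∑ q, θ q * θ' q * ((∑ l, lam (π l (e.symm q).1)) / J) := by
  have hJ' : (0 : ℝ) < J := by exact_mod_cast hJ
  rw [(isCoisometryWith_mixMap hJ hs).covForm_map hμ]
  have h1 : ∀ j : Fin J × Fin N,
      covForm μ (mixAdjoint v π e s θ j) (mixAdjoint v π e s θ' j) =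
        (J : ℝ)⁻¹ * ∑ i, θ (e (i, j.2)) * θ' (e (i, j.2)) * lam (π j.1 i) := by
    intro j
    have ho : Orthonormal ℝ fun i => v (π j.1 i) :=
      v.orthonormal.comp _ (π j.1).injective
    rw [hμ.covForm_eq, mixAdjoint, mixAdjoint, map_smul, map_sum]
    simp only [map_smul, hv, smul_smul]
    rw [real_inner_smul_left, real_inner_smul_right, ho.inner_sum, ← mul_assoc]
    congr 1
    · have : (Real.sqrt J)⁻¹ * (Real.sqrt J)⁻¹ = (J : ℝ)⁻¹ := by
        rw [← mul_inv, Real.mul_self_sqrt hJ'.le]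
      linear_combination (s j.1 * s j.1) * this + (J : ℝ)⁻¹ * hs j.1
    · simp [mul_assoc]
  simp_rw [h1]
  rw [← e.sum_comp, Fintype.sum_prod_type, Fintype.sum_prod_type_right, Finset.sum_comm]
  refine Finset.sum_congr rfl fun k _ => ?_
  simp only [Equiv.symm_apply_apply, Finset.sum_div, Finset.mul_sum]
  rw [Finset.sum_comm]
  refine Finset.sum_congr rfl fun i _ => Finset.sum_congr rfl fun l _ => ?_
  ring

theorem covMatrix_mixMap (hJ : 1 ≤ J) (hs : ∀ l, s l * s l = 1)
    {μ : Measure (EuclideanSpace ℝ (Fin n))} [IsProbabilityMeasure μ]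
    (hμ : IsLogConcaveMeasure μ) {lam : Fin n → ℝ}
    (hv : ∀ i, Matrix.toEuclideanCLM (𝕜 := ℝ) (covMatrix μ) (v i) = lam i • v i) :
    covMatrix ((Measure.pi fun _ : Fin J × Fin N => μ).map (mixMap v π e s)) =
      Matrix.diagonal fun q => (∑ l, lam (π l (e.symm q).1)) / J := by
  ext p q
  rw [covMatrix_apply, covForm_mixMap hJ hs hμ hv, Matrix.diagonal_apply]
  rcases eq_or_ne p q with rfl | h
  · simp
  · simp [h, h.symm]

theorem exists_signs_norm_sq_mixMap_le (hJ : 1 ≤ J)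
    (x : Fin J × Fin N → EuclideanSpace ℝ (Fin n)) :
    ∃ σ : Fin J → Bool,
      ‖mixMap v π e (fun l => boolSign (σ l)) x‖ ^ 2 ≤ (∑ j, ‖x j‖ ^ 2) / J := by
  have hJ' : (0 : ℝ) < J := by exact_mod_cast hJ
  obtain ⟨σ, hσ⟩ := exists_signs_norm_sq_sum_le J fun l => mixRow v (π l) e fun k => x (l, k)
  refine ⟨σ, ?_⟩
  simp_rw [norm_sq_mixRow] at hσ
  rw [mixMap_apply, norm_smul, mul_pow, Real.norm_eq_abs, sq_abs, inv_pow,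
    Real.sq_sqrt hJ'.le, Fintype.sum_prod_type, div_eq_inv_mul]
  gcongr

end Mixing

theorem matOpNorm_diagonal_le {m : ℕ} {d : Fin m → ℝ} {β : ℝ} (hβ : 0 ≤ β)
    (h0 : ∀ q, 0 ≤ d q) (h1 : ∀ q, d q ≤ β) : matOpNorm (Matrix.diagonal d) ≤ β := by
  rw [matOpNorm_diagonal, pi_norm_le_iff_of_nonneg hβ]
  exact fun q => by rw [Real.norm_of_nonneg (h0 q)]; exact h1 q

theorem matOpNorm_diagonal_pos {m : ℕ} {d : Fin m → ℝ} {q : Fin m} (hq : d q ≠ 0) :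
    0 < matOpNorm (Matrix.diagonal d) := by
  rw [matOpNorm_diagonal, norm_pos_iff]
  exact fun h => hq (congrFun h q)

/-- The product of the operator norms of a diagonal matrix with entries in `[α, β]` and of its
inverse is positive and at most `β / α`. -/
theorem matOpNorm_diagonal_mul_inv {m : ℕ} (hm : 1 ≤ m) {d : Fin m → ℝ} {α β : ℝ} (hα : 0 < α)
    (h0 : ∀ q, α ≤ d q) (h1 : ∀ q, d q ≤ β) :
    0 < matOpNorm (Matrix.diagonal d) * matOpNorm (Matrix.diagonal d)⁻¹ ∧
      matOpNorm (Matrix.diagonal d) * matOpNorm (Matrix.diagonal d)⁻¹ ≤ β / α := by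
  have hd : ∀ q, 0 < d q := fun q => hα.trans_le (h0 q)
  have hinv : (Matrix.diagonal d)⁻¹ = Matrix.diagonal fun q => (d q)⁻¹ := by
    refine Matrix.inv_eq_right_inv ?_
    rw [Matrix.diagonal_mul_diagonal, ← Matrix.diagonal_one]
    congr 1
    ext q
    exact mul_inv_cancel₀ (hd q).ne'
  let q₀ : Fin m := ⟨0, hm⟩
  have hβ : 0 < β := (hd q₀).trans_le (h1 q₀)
  rw [hinv]
  refine ⟨mul_pos (matOpNorm_diagonal_pos (q := q₀) (hd q₀).ne')
    (matOpNorm_diagonal_pos (q := q₀) (inv_ne_zero (hd q₀).ne')), ?_⟩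
  rw [div_eq_mul_inv]
  refine mul_le_mul (matOpNorm_diagonal_le hβ.le (fun q => (hd q).le) h1)
    (matOpNorm_diagonal_le (inv_nonneg.2 hα.le) (fun q => inv_nonneg.2 (hd q).le)
      fun q => inv_anti₀ hα (h0 q)) (norm_nonneg _) hβ.le

section Spectral

open RealInnerProductSpace

/-- Spectral decomposition of the covariance matrix of a log-concave measure. -/
theorem IsLogConcaveMeasure.exists_eigenbasis {n : ℕ} {μ : Measure (EuclideanSpace ℝ (Fin n))}
    [IsProbabilityMeasure μ] (hμ : IsLogConcaveMeasure μ) :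
    ∃ (v : OrthonormalBasis (Fin n) ℝ (EuclideanSpace ℝ (Fin n))) (lam : Fin n → ℝ),
      (∀ i, Matrix.toEuclideanCLM (𝕜 := ℝ) (covMatrix μ) (v i) = lam i • v i) ∧
      (∀ i, 0 ≤ lam i) ∧ (∀ i, lam i ≤ matOpNorm (covMatrix μ)) ∧
      ∑ i, lam i = (covMatrix μ).trace := by
  have hA : (covMatrix μ).IsHermitian := by
    ext i j
    rw [Matrix.conjTranspose_apply, star_trivial, covMatrix_apply, covMatrix_apply]
    simp only [covForm, mul_comm]
  have hv : ∀ i, Matrix.toEuclideanCLM (𝕜 := ℝ) (covMatrix μ) (hA.eigenvectorBasis i) =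
      hA.eigenvalues i • hA.eigenvectorBasis i := by
    intro i
    apply (WithLp.ofLp_injective 2)
    rw [Matrix.ofLp_toEuclideanCLM]
    exact hA.mulVec_eigenvectorBasis i
  have h0 : ∀ i, 0 ≤ hA.eigenvalues i := by
    intro i
    have h := hμ.covForm_eq (hA.eigenvectorBasis i) (hA.eigenvectorBasis i)
    rw [hv, real_inner_smul_right, real_inner_self_eq_norm_sq,
      hA.eigenvectorBasis.orthonormal.1 i, one_pow, mul_one] at h
    rw [← h]
    exact integral_nonneg fun x => mul_self_nonneg _
  refine ⟨hA.eigenvectorBasis, hA.eigenvalues, hv, h0, fun i => ?_, ?_⟩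
  · have h := (Matrix.toEuclideanCLM (𝕜 := ℝ) (covMatrix μ)).le_opNorm (hA.eigenvectorBasis i)
    rwa [hv, norm_smul, hA.eigenvectorBasis.orthonormal.1 i, mul_one, mul_one,
      Real.norm_of_nonneg (h0 i)] at h
  · rw [hA.trace_eq_sum_eigenvalues]
    simp

end Spectral

theorem le_of_forall_pow_le_mul_pow {x y C : ℝ} (hy : 0 < y)
    (h : ∀ N : ℕ, 1 ≤ N → x ^ N ≤ C * y ^ N) : x ≤ y := by
  by_contra! hxy
  have h1 : 1 < x / y := (one_lt_div hy).2 hxy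
  obtain ⟨k, hk⟩ := pow_unbounded_of_one_lt C h1
  have h2 : (x / y) ^ k ≤ (x / y) ^ (k + 1) := pow_le_pow_right₀ h1.le (Nat.le_succ k)
  have h3 := h (k + 1) (by omega)
  rw [← div_le_iff₀ (by positivity), ← div_pow] at h3
  linarith

/-- The small ball bound for vectors with invertible covariance, with constant `c`. -/
def SmallBallBound (c : ℝ) : Prop :=
  ∀ m : ℕ, 1 ≤ m → ∀ (b : ℝ)
    (ν : Measure (EuclideanSpace ℝ (Fin m))), IsProbabilityMeasure ν →
    IsLogConcaveMeasure ν → IsSubgaussianWith b ν → (covMatrix ν).det ≠ 0 →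
    ∀ z : EuclideanSpace ℝ (Fin m), ∀ ε : ℝ, 0 < ε → ε < c →
      ν {x | ‖x - z‖ ^ 2 ≤ ε * (covMatrix ν).trace} ≤
        ENNReal.ofReal (ε ^ (c * (covMatrix ν).trace /
          (b ^ 2 * matOpNorm (covMatrix ν) * matOpNorm (covMatrix ν)⁻¹)))

section Balanced

variable {n J : ℕ} {μ : Measure (EuclideanSpace ℝ (Fin n))} [IsProbabilityMeasure μ]
  {v : OrthonormalBasis (Fin n) ℝ (EuclideanSpace ℝ (Fin n))} {lam : Fin n → ℝ}
  {π : Fin J → Equiv.Perm (Fin n)} {b c ε α β : ℝ}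

/-- The bound for `J * N` independent copies. -/
theorem SmallBallBound.measure_pow_le (hP : SmallBallBound c) (hn : 1 ≤ n) (hJ : 1 ≤ J)
    (hc : 0 < c) (hμ : IsLogConcaveMeasure μ) (hb : 0 < b) (hs : IsSubgaussianWith b μ)
    (hv : ∀ i, Matrix.toEuclideanCLM (𝕜 := ℝ) (covMatrix μ) (v i) = lam i • v i)
    (htr : ∑ i, lam i = (covMatrix μ).trace) (hT : 0 ≤ (covMatrix μ).trace)
    (hα : 0 < α) (h0 : ∀ i, α ≤ ∑ l, lam (π l i)) (h1 : ∀ i, ∑ l, lam (π l i) ≤ β)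
    (hε : 0 < ε) (hεc : ε < c) (hε1 : ε ≤ 1) (y : EuclideanSpace ℝ (Fin n)) {N : ℕ}
    (hN : 1 ≤ N) :
    μ {x | ‖x - y‖ ^ 2 ≤ ε * (covMatrix μ).trace} ^ (J * N) ≤
      2 ^ J * ENNReal.ofReal (ε ^ (c * (N * (covMatrix μ).trace) * α / (2 * b ^ 2 * β))) := by
  have hJ' : (0 : ℝ) < J := by exact_mod_cast hJ
  set T := (covMatrix μ).trace
  have e : Fin n × Fin N ≃ Fin (n * N) := finProdFinEquiv
  have hm : 1 ≤ n * N := Nat.mul_pos hn hN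
  have hβ : 0 < β := hα.trans_le ((h0 ⟨0, hn⟩).trans (h1 ⟨0, hn⟩))
  set P := Measure.pi fun _ : Fin J × Fin N => μ
  set B : Set (EuclideanSpace ℝ (Fin n)) := {x | ‖x - y‖ ^ 2 ≤ ε * T}
  let L : (Fin J → Bool) → _ := fun σ => mixMap v π e fun l => boolSign (σ l)
  let z : (Fin J → Bool) → _ := fun σ => L σ fun _ => y
  have hsg : ∀ σ : Fin J → Bool, ∀ l, boolSign (σ l) * boolSign (σ l) = 1 := fun σ l =>
    boolSign_mul_self _
  have htrν : (∑ q, (∑ l, lam (π l (e.symm q).1)) / J : ℝ) = N * T := by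
    rw [← e.sum_comp, Fintype.sum_prod_type_right]
    simp only [Equiv.symm_apply_apply, Finset.sum_const, Finset.card_univ, Fintype.card_fin,
      nsmul_eq_mul]
    rw [← Finset.sum_div, Finset.sum_comm]
    simp only [Equiv.sum_comp, htr, Finset.sum_const, Finset.card_univ, Fintype.card_fin,
      nsmul_eq_mul]
    rw [mul_div_cancel_left₀ _ hJ'.ne']
  have hsub : Set.univ.pi (fun _ : Fin J × Fin N => B) ⊆
      ⋃ σ, L σ ⁻¹' {x | ‖x - z σ‖ ^ 2 ≤ ε * (N * T)} := by
    intro x hx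
    obtain ⟨σ, hσ⟩ := exists_signs_norm_sq_mixMap_le (v := v) (π := π) (e := e) hJ fun j => x j - y
    refine mem_iUnion.2 ⟨σ, ?_⟩
    have e1 : L σ x - z σ = L σ fun j => x j - y := by
      rw [← map_sub]
      rfl
    change ‖L σ x - z σ‖ ^ 2 ≤ ε * (N * T)
    rw [e1]
    refine hσ.trans ?_
    rw [div_le_iff₀ hJ']
    calc ∑ j, ‖x j - y‖ ^ 2 ≤ ∑ _j : Fin J × Fin N, ε * T :=
          Finset.sum_le_sum fun j _ => hx j (mem_univ j)
      _ = ε * (N * T) * J := by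
          simp only [Finset.sum_const, Finset.card_univ, Fintype.card_prod, Fintype.card_fin,
            nsmul_eq_mul, Nat.cast_mul]
          ring
  have hball : ∀ σ, P (L σ ⁻¹' {x | ‖x - z σ‖ ^ 2 ≤ ε * (N * T)}) ≤
      ENNReal.ofReal (ε ^ (c * (N * T) * α / (2 * b ^ 2 * β))) := by
    intro σ
    have hco := isCoisometryWith_mixMap (v := v) (π := π) (e := e) hJ (hsg σ)
    have hprob : IsProbabilityMeasure (P.map (L σ)) := isProbabilityMeasure_map_pi
    have hcov : covMatrix (P.map (L σ)) =
        Matrix.diagonal fun q => (∑ l, lam (π l (e.symm q).1)) / (J : ℝ) :=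
      covMatrix_mixMap hJ (hsg σ) hμ hv
    have htrace : (covMatrix (P.map (L σ))).trace = N * T := by
      rw [hcov, Matrix.trace_diagonal, htrν]
    have hdet : (covMatrix (P.map (L σ))).det ≠ 0 := by
      rw [hcov, Matrix.det_diagonal]
      exact Finset.prod_ne_zero_iff.2 fun q _ =>
        (div_pos (hα.trans_le (h0 _)) hJ').ne'
    have h := hP (n * N) hm (Real.sqrt 2 * b) (P.map (L σ)) hprob
      (hco.isLogConcaveMeasure_map hμ) (hco.isSubgaussianWith_map hμ hb hs) hdet (z σ) ε hε hεc
    rw [htrace] at h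
    have hms : MeasurableSet {x | ‖x - z σ‖ ^ 2 ≤ ε * (N * T)} :=
      measurableSet_le (by fun_prop) measurable_const
    rw [Measure.map_apply (L σ).continuous.measurable hms] at h
    refine h.trans (ENNReal.ofReal_le_ofReal ?_)
    refine Real.rpow_le_rpow_of_exponent_ge hε hε1 ?_
    obtain ⟨hpos, hle⟩ := matOpNorm_diagonal_mul_inv hm (α := α / J) (β := β / J)
      (d := fun q => (∑ l, lam (π l (e.symm q).1)) / (J : ℝ)) (by positivity)
      (fun q => by gcongr; exact h0 _) (fun q => by gcongr; exact h1 _)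
    rw [← hcov] at hpos hle
    rw [div_div_div_cancel_right₀ hJ'.ne'] at hle
    rw [mul_pow, Real.sq_sqrt zero_le_two, mul_assoc (2 * b ^ 2)]
    calc c * (N * T) * α / (2 * b ^ 2 * β) = c * (N * T) / (2 * b ^ 2 * (β / α)) := by
          field_simp
      _ ≤ _ := by gcongr
  calc μ B ^ (J * N) = P (Set.univ.pi fun _ : Fin J × Fin N => B) := by
        rw [Measure.pi_pi]
        simp
    _ ≤ P (⋃ σ, L σ ⁻¹' {x | ‖x - z σ‖ ^ 2 ≤ ε * (N * T)}) := measure_mono hsub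
    _ ≤ ∑ σ, P (L σ ⁻¹' {x | ‖x - z σ‖ ^ 2 ≤ ε * (N * T)}) := measure_iUnion_fintype_le _ _
    _ ≤ ∑ _σ : Fin J → Bool, ENNReal.ofReal (ε ^ (c * (N * T) * α / (2 * b ^ 2 * β))) :=
        Finset.sum_le_sum fun σ _ => hball σ
    _ = _ := by simp

theorem SmallBallBound.measure_le (hP : SmallBallBound c) (hn : 1 ≤ n) (hJ : 1 ≤ J)
    (hc : 0 < c) (hμ : IsLogConcaveMeasure μ) (hb : 0 < b) (hs : IsSubgaussianWith b μ)
    (hv : ∀ i, Matrix.toEuclideanCLM (𝕜 := ℝ) (covMatrix μ) (v i) = lam i • v i)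
    (htr : ∑ i, lam i = (covMatrix μ).trace) (hT : 0 ≤ (covMatrix μ).trace)
    (hα : 0 < α) (h0 : ∀ i, α ≤ ∑ l, lam (π l i)) (h1 : ∀ i, ∑ l, lam (π l i) ≤ β)
    (hε : 0 < ε) (hεc : ε < c) (hε1 : ε ≤ 1) (y : EuclideanSpace ℝ (Fin n)) :
    μ {x | ‖x - y‖ ^ 2 ≤ ε * (covMatrix μ).trace} ≤
      ENNReal.ofReal (ε ^ (c * (covMatrix μ).trace * α / (2 * b ^ 2 * β * J))) := by
  have hJ' : (0 : ℝ) < J := by exact_mod_cast hJ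
  set T := (covMatrix μ).trace
  set B : Set (EuclideanSpace ℝ (Fin n)) := {x | ‖x - y‖ ^ 2 ≤ ε * T}
  have hβ : 0 < β := hα.trans_le ((h0 ⟨0, hn⟩).trans (h1 ⟨0, hn⟩))
  set E := c * T * α / (2 * b ^ 2 * β * J) with hE
  refine (ENNReal.le_ofReal_iff_toReal_le (measure_ne_top _ _) (by positivity)).2 ?_
  refine (pow_le_pow_iff_left₀ ENNReal.toReal_nonneg (by positivity)
    (show J ≠ 0 by omega)).1 ?_
  refine le_of_forall_pow_le_mul_pow (C := 2 ^ J) (by positivity) fun N hN => ?_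
  have h := hP.measure_pow_le hn hJ hc hμ hb hs hv htr hT hα h0 h1 hε hεc hε1 y hN
  have h' := ENNReal.toReal_mono (by finiteness) h
  rw [ENNReal.toReal_pow, ENNReal.toReal_mul, ENNReal.toReal_pow, ENNReal.toReal_ofNat,
    ENNReal.toReal_ofReal (by positivity)] at h'
  rw [← pow_mul, ← pow_mul, ← Real.rpow_natCast (ε ^ E), ← Real.rpow_mul hε.le]
  refine h'.trans_eq ?_
  congr 2
  rw [hE]
  push_cast
  field_simp
  rfl

end Balanced


theorem IsSubgaussianWith.nonneg {n : ℕ} {b : ℝ} {μ : Measure (EuclideanSpace ℝ (Fin n))}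
    (hn : 1 ≤ n) (hs : IsSubgaussianWith b μ) : 0 ≤ b := by
  have h := hs 1 le_rfl (EuclideanSpace.single ⟨0, hn⟩ 1) (by simp)
  rw [Real.sqrt_one, mul_one] at h
  exact le_trans (Real.rpow_nonneg (integral_nonneg fun x => by positivity) _) h

theorem SmallBallBound.measure_le_of_covMatrix {c : ℝ} (hc : 0 < c) (hP : SmallBallBound c)
    {n : ℕ} (hn : 1 ≤ n) {b : ℝ} {μ : Measure (EuclideanSpace ℝ (Fin n))}
    [IsProbabilityMeasure μ] (hμ : IsLogConcaveMeasure μ) (hs : IsSubgaussianWith b μ)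
    (y : EuclideanSpace ℝ (Fin n)) {ε : ℝ} (hε : 0 < ε) (hεc : ε < c) :
    μ {x | ‖x - y‖ ^ 2 ≤ ε * (covMatrix μ).trace} ≤
      ENNReal.ofReal ((4 * n * matOpNorm (covMatrix μ) * ε / (covMatrix μ).trace) ^
        (c * (covMatrix μ).trace ^ 3 /
          (8 * (n : ℝ) ^ 2 * b ^ 2 * matOpNorm (covMatrix μ) ^ 2))) := by
  obtain ⟨v, lam, hv, hlam0, hlam1, htr⟩ := hμ.exists_eigenbasis
  have hn' : (0 : ℝ) < n := by exact_mod_cast hn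
  set T := (covMatrix μ).trace with hTdef
  set Λ := matOpNorm (covMatrix μ) with hΛdef
  have hT : 0 ≤ T := htr ▸ Finset.sum_nonneg fun i _ => hlam0 i
  have hΛ : 0 ≤ Λ := norm_nonneg _
  have hTΛ : T ≤ n * Λ := by
    rw [← htr]
    exact (Finset.sum_le_sum fun i _ => hlam1 i).trans_eq (by simp)
  have hb := hs.nonneg hn
  by_cases htriv : 1 ≤ (4 * n * Λ * ε / T) ^ (c * T ^ 3 / (8 * (n : ℝ) ^ 2 * b ^ 2 * Λ ^ 2))
  · exact prob_le_one.trans (ENNReal.one_le_ofReal.2 htriv)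
  have hT0 : 0 < T := by
    refine hT.lt_of_ne fun h => htriv ?_
    simp [← h]
  have hb0 : 0 < b := by
    refine hb.lt_of_ne fun h => htriv ?_
    simp [← h]
  have hΛ0 : 0 < Λ := by
    refine hΛ.lt_of_ne fun h => htriv ?_
    simp [← h]
  have hbase : 4 * n * Λ * ε / T < 1 := by
    by_contra! h
    exact htriv (Real.one_le_rpow h (by positivity))
  have hr1 : T / (n * Λ) ≤ 1 := (div_le_one (by positivity)).2 hTΛ
  have hεbase : ε ≤ 4 * n * Λ * ε / T := by
    rw [le_div_iff₀ hT0]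
    nlinarith [mul_nonneg hε.le (sub_nonneg.2 hTΛ), mul_pos (mul_pos hn' hΛ0) hε]
  obtain ⟨J, hJ, hJr⟩ := exists_number_of_copies (r := T / (n * Λ)) (by positivity) hr1
  have hJ' : (0 : ℝ) < J := by exact_mod_cast hJ
  obtain ⟨π, hπ⟩ := exists_perms_balanced hlam0 hlam1 hΛ J
  have hne : Nonempty (Fin n) := ⟨⟨0, hn⟩⟩
  obtain ⟨i₁, hi₁⟩ := Finite.exists_max fun i => ∑ l, lam (π l i)
  obtain ⟨i₀, hi₀⟩ := Finite.exists_min fun i => ∑ l, lam (π l i)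
  set β := ∑ l, lam (π l i₁)
  set α := ∑ l, lam (π l i₀)
  have hsum : (J : ℝ) * T ≤ n * β := by
    calc (J : ℝ) * T = ∑ i, ∑ l, lam (π l i) := by
          rw [Finset.sum_comm]
          simp [Equiv.sum_comp, htr]
      _ ≤ ∑ _i : Fin n, β := Finset.sum_le_sum fun i _ => hi₁ i
      _ = n * β := by simp
  obtain ⟨hα, hαβ⟩ := hJr (β / Λ) (α / Λ)
    (by rw [← sub_div, div_le_one hΛ0]; exact hπ i₁ i₀)
    (by rw [mul_div_assoc', div_le_div_iff₀ (by positivity) hΛ0]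
        nlinarith [mul_le_mul_of_nonneg_right hsum hΛ])
  have hα0 : 0 < α := by
    have := mul_pos hα hΛ0
    rwa [div_mul_cancel₀ _ hΛ0.ne'] at this
  have hβ0 : 0 < β := hα0.trans_le (hi₀ i₁)
  have hmain := hP.measure_le hn hJ hc hμ hb0 hs hv htr hT hα0 hi₀ hi₁ hε hεc
    (hεbase.trans hbase.le) y
  refine hmain.trans (ENNReal.ofReal_le_ofReal ?_)
  have hexp : c * T ^ 3 / (8 * (n : ℝ) ^ 2 * b ^ 2 * Λ ^ 2) ≤
      c * T * α / (2 * b ^ 2 * β * J) := by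
    have h4 : J * (T / (n * Λ)) ^ 2 * β ≤ 4 * α := by
      have := mul_le_mul_of_nonneg_right hαβ hΛ
      calc _ = J * (T / (n * Λ)) ^ 2 * (β / Λ) * Λ := by field_simp
        _ ≤ 4 * (α / Λ) * Λ := this
        _ = 4 * α := by field_simp
    calc _ = c * T / (8 * b ^ 2 * β * J) * (J * (T / (n * Λ)) ^ 2 * β) := by field_simp
      _ ≤ c * T / (8 * b ^ 2 * β * J) * (4 * α) := by gcongr
      _ = _ := by field_simp; norm_num
  calc ε ^ (c * T * α / (2 * b ^ 2 * β * J))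
      ≤ ε ^ (c * T ^ 3 / (8 * (n : ℝ) ^ 2 * b ^ 2 * Λ ^ 2)) :=
        Real.rpow_le_rpow_of_exponent_ge hε (hεbase.trans hbase.le) hexp
    _ ≤ _ := Real.rpow_le_rpow hε.le hεbase (by positivity)

end Auxiliary

/-- Assuming the Paouris-type small ball bound for `b`-subgaussian log-concave
vectors with invertible covariance (in every dimension `m ≥ 1`), every
`b`-subgaussian log-concave random vector `X` in `ℝⁿ` with covariance `A`
satisfies, for `0 < ε < c` and `y ∈ ℝⁿ`,
`ℙ(‖X - y‖₂² ≤ ε Tr A) ≤ (4 n ‖A‖_op ε / Tr A)^{c Tr(A)³ / (8 n² b² ‖A‖_op²)}`. -/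
theorem small_ball_of_paouris (c : ℝ) (hc : 0 < c)
    (hPaouris : ∀ m : ℕ, 1 ≤ m → ∀ (b : ℝ)
      (ν : Measure (EuclideanSpace ℝ (Fin m))), IsProbabilityMeasure ν →
      IsLogConcaveMeasure ν → IsSubgaussianWith b ν → (covMatrix ν).det ≠ 0 →
      ∀ z : EuclideanSpace ℝ (Fin m), ∀ ε : ℝ, 0 < ε → ε < c →
        ν {x | ‖x - z‖ ^ 2 ≤ ε * (covMatrix ν).trace} ≤
          ENNReal.ofReal (ε ^ (c * (covMatrix ν).trace /
            (b ^ 2 * matOpNorm (covMatrix ν) * matOpNorm (covMatrix ν)⁻¹)))) :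
    ∀ n : ℕ, 1 ≤ n → ∀ (b : ℝ)
      (μ : Measure (EuclideanSpace ℝ (Fin n))), IsProbabilityMeasure μ →
      IsLogConcaveMeasure μ → IsSubgaussianWith b μ →
      ∀ y : EuclideanSpace ℝ (Fin n), ∀ ε : ℝ, 0 < ε → ε < c →
        μ {x | ‖x - y‖ ^ 2 ≤ ε * (covMatrix μ).trace} ≤
          ENNReal.ofReal ((4 * n * matOpNorm (covMatrix μ) * ε / (covMatrix μ).trace) ^
            (c * (covMatrix μ).trace ^ 3 /
              (8 * (n : ℝ) ^ 2 * b ^ 2 * matOpNorm (covMatrix μ) ^ 2))) := by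
  intro n hn b μ hμp hμ hs y ε hε hεc
  exact SmallBallBound.measure_le_of_covMatrix hc hPaouris hn hμ hs y hε hεc

end
end

section
/- Let C₀ > 1 be a constant such that every symmetric log-concave real random variable Y satisfies (𝔼 Y⁴)^{1/2} ≤ C₀·𝔼 Y². Let X₁ be a symmetric isotropic log-concave random vector in ℝⁿ, let K = B₂(0, 2C₀√n) be the closed Euclidean ball of radius 2C₀√n centered at the origin, and let X₂ have the law of X₁ conditioned on the event {X₁ ∈ K}. Then 𝔼[X₂] = 0 and (1/2)·Iₙ ≼ Cov(X₂) ≼ 2·Iₙ in the order of symmetric matrices. -/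
open MeasureTheory ProbabilityTheory

noncomputable section

open scoped Pointwise ENNReal

theorem Real.volume_add_le_volume_add_of_isCompact {K L : Set ℝ} (hK : IsCompact K)
    (hL : IsCompact L) (hKn : K.Nonempty) (hLn : L.Nonempty) :
    volume K + volume L ≤ volume (K + L) := by
  obtain ⟨a, haK, ha⟩ := hK.exists_isGreatest hKn
  obtain ⟨b, hbL, hb⟩ := hL.exists_isLeast hLn
  have h1 : volume ((fun x => b + x) '' K) = volume K := by
    rw [Set.image_add_left, measure_preimage_add]
  have h2 : volume ((fun x => a + x) '' L) = volume L := by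
    rw [Set.image_add_left, measure_preimage_add]
  rw [← h1, ← h2, ← measure_union₀]
  · refine measure_mono ?_
    rintro _ (⟨x, hx, rfl⟩ | ⟨x, hx, rfl⟩)
    · exact ⟨x, hx, b, hbL, add_comm _ _⟩
    · exact ⟨a, haK, x, hx, rfl⟩
  · exact (hL.image (by fun_prop)).measurableSet.nullMeasurableSet
  · refine measure_mono_null (t := {a + b}) ?_ (by simp)
    rintro _ ⟨⟨x, hx, rfl⟩, ⟨y, hy, hxy⟩⟩
    have := ha hx
    have := hb hy
    simp only [Set.mem_singleton_iff] at *
    linarith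

/-- The one-dimensional Brunn–Minkowski inequality. -/
theorem Real.volume_add_le_volume_add {A B : Set ℝ} (hA : MeasurableSet A)
    (hB : MeasurableSet B) (hAn : A.Nonempty) (hBn : B.Nonempty) :
    volume A + volume B ≤ volume (A + B) := by
  obtain ⟨a, ha⟩ := hAn
  obtain ⟨b, hb⟩ := hBn
  rw [hA.measure_eq_iSup_isCompact, hB.measure_eq_iSup_isCompact]
  simp only [iSup_and']
  refine ENNReal.biSup_add_biSup_le' (p := fun K => K ⊆ A ∧ IsCompact K)
    (q := fun K => K ⊆ B ∧ IsCompact K) ⟨∅, by simp⟩ ⟨∅, by simp⟩ ?_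
  rintro K ⟨hKA, hK⟩ L ⟨hLB, hL⟩
  calc volume K + volume L ≤ volume (insert a K) + volume (insert b L) := by
        gcongr <;> exact Set.subset_insert _ _
    _ ≤ volume (insert a K + insert b L) :=
        Real.volume_add_le_volume_add_of_isCompact (hK.insert a) (hL.insert b)
          (Set.insert_nonempty _ _) (Set.insert_nonempty _ _)
    _ ≤ volume (A + B) := by
        refine measure_mono (Set.add_subset_add ?_ ?_)
        · exact Set.insert_subset ha hKA
        · exact Set.insert_subset hb hLB

theorem lintegral_eq_setLIntegral_measure_lt_of_le_one {α : Type*} [MeasurableSpace α]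
    (μ : Measure α) {f : α → ℝ≥0∞} (hf : Measurable f) (hf1 : ∀ x, f x ≤ 1) :
    ∫⁻ x, f x ∂μ = ∫⁻ s in Set.Ioo (0 : ℝ) 1, μ {x | ENNReal.ofReal s < f x} := by
  have htop : ∀ x, f x ≠ ⊤ := fun x => ne_top_of_le_ne_top ENNReal.one_ne_top (hf1 x)
  have h0 : ∫⁻ x, f x ∂μ = ∫⁻ x, ENNReal.ofReal ((f x).toReal) ∂μ := by
    simp only [ENNReal.ofReal_toReal (htop _)]
  rw [h0, lintegral_eq_lintegral_meas_lt μ (Filter.Eventually.of_forall fun x => by simp)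
    hf.ennreal_toReal.aemeasurable]
  have h1 : ∫⁻ s in Set.Ioi (0 : ℝ), μ {x | s < (f x).toReal} =
      ∫⁻ s in Set.Ioi (0 : ℝ), μ {x | ENNReal.ofReal s < f x} := by
    refine setLIntegral_congr_fun measurableSet_Ioi fun s hs => ?_
    simp only [ENNReal.ofReal_lt_iff_lt_toReal (le_of_lt hs) (htop _)]
  rw [h1]
  rw [← lintegral_indicator measurableSet_Ioi, ← lintegral_indicator measurableSet_Ioo]
  refine lintegral_congr fun s => ?_
  by_cases hs1 : s < 1
  · simp [Set.indicator_apply, hs1]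
  · have : {x | ENNReal.ofReal s < f x} = ∅ := by
      ext x
      simpa using (hf1 x).trans (ENNReal.one_le_ofReal.2 (not_lt.1 hs1))
    simp [Set.indicator_apply, this]

theorem ENNReal.geom_mean_le_arith_mean_two {t : ℝ} (ht0 : 0 < t) (ht1 : t < 1) (a b : ℝ≥0∞) :
    a ^ t * b ^ (1 - t) ≤ ENNReal.ofReal t * a + ENNReal.ofReal (1 - t) * b := by
  have ht1' : 0 < 1 - t := sub_pos.2 ht1
  rcases eq_or_ne a ⊤ with rfl | ha
  · simp [ENNReal.mul_top, ht0]
  rcases eq_or_ne b ⊤ with rfl | hb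
  · simp [ENNReal.mul_top, ht1]
  lift a to NNReal using ha
  lift b to NNReal using hb
  have := Real.geom_mean_le_arith_mean2_weighted ht0.le ht1'.le a.coe_nonneg b.coe_nonneg (by ring)
  rw [← ENNReal.ofReal_coe_nnreal, ← ENNReal.ofReal_coe_nnreal,
    ENNReal.ofReal_rpow_of_nonneg a.coe_nonneg ht0.le, ENNReal.ofReal_rpow_of_nonneg b.coe_nonneg ht1'.le,
    ← ENNReal.ofReal_mul (by positivity), ← ENNReal.ofReal_mul ht0.le,
    ← ENNReal.ofReal_mul ht1'.le, ← ENNReal.ofReal_add (by positivity) (by positivity)]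
  exact ENNReal.ofReal_le_ofReal this

/-- The one-dimensional Prékopa–Leindler inequality, for functions with supremum one. -/
theorem prekopa_leindler_of_iSup_eq_one {f g h : ℝ → ℝ≥0∞} (hf : Measurable f)
    (hg : Measurable g) (hh : Measurable h) {t : ℝ} (ht0 : 0 < t) (ht1 : t < 1)
    (hf1 : ⨆ x, f x = 1) (hg1 : ⨆ x, g x = 1)
    (H : ∀ x y, f x ^ t * g y ^ (1 - t) ≤ h (t * x + (1 - t) * y)) :
    ENNReal.ofReal t * (∫⁻ x, f x) + ENNReal.ofReal (1 - t) * ∫⁻ x, g x ≤ ∫⁻ x, h x := by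
  have ht1' : 0 < 1 - t := sub_pos.2 ht1
  have hfle : ∀ x, f x ≤ 1 := fun x => hf1 ▸ le_iSup f x
  have hgle : ∀ x, g x ≤ 1 := fun x => hg1 ▸ le_iSup g x
  have hmeas : ∀ (k : ℝ → ℝ≥0∞), Measurable fun s : ℝ => volume {x | ENNReal.ofReal s < k x} := by
    intro k
    refine Antitone.measurable fun s s' hs => measure_mono fun x hx => ?_
    exact (ENNReal.ofReal_le_ofReal hs).trans_lt hx
  calc _ = ENNReal.ofReal t * (∫⁻ s in Set.Ioo (0 : ℝ) 1, volume {x | ENNReal.ofReal s < f x})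
        + ENNReal.ofReal (1 - t) *
          ∫⁻ s in Set.Ioo (0 : ℝ) 1, volume {x | ENNReal.ofReal s < g x} := by
        rw [lintegral_eq_setLIntegral_measure_lt_of_le_one volume hf hfle,
          lintegral_eq_setLIntegral_measure_lt_of_le_one volume hg hgle]
    _ = ∫⁻ s in Set.Ioo (0 : ℝ) 1, (ENNReal.ofReal t * volume {x | ENNReal.ofReal s < f x}
          + ENNReal.ofReal (1 - t) * volume {x | ENNReal.ofReal s < g x}) := by
        rw [lintegral_add_left ((hmeas f).const_mul _), lintegral_const_mul _ (hmeas f),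
          lintegral_const_mul _ (hmeas g)]
    _ ≤ ∫⁻ s in Set.Ioo (0 : ℝ) 1, volume {x | ENNReal.ofReal s < min (h x) 1} := by
        refine setLIntegral_mono' measurableSet_Ioo fun s hs => ?_
        have hs1 : ENNReal.ofReal s < 1 := ENNReal.ofReal_lt_one.2 hs.2
        have hs0 : ENNReal.ofReal s ≠ 0 := by simpa using hs.1
        have hfn : {x | ENNReal.ofReal s < f x}.Nonempty := by
          rw [← hf1] at hs1; exact lt_iSup_iff.1 hs1
        have hgn : {x | ENNReal.ofReal s < g x}.Nonempty := by
          rw [← hg1] at hs1; exact lt_iSup_iff.1 hs1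
        have hsm := fun (c : ℝ) (A : Set ℝ) => Measure.addHaar_smul (volume : Measure ℝ) c A
        simp only [Module.finrank_self, pow_one] at hsm
        have e1 := hsm t {x | ENNReal.ofReal s < f x}
        have e2 := hsm (1 - t) {x | ENNReal.ofReal s < g x}
        rw [abs_of_pos ht0] at e1
        rw [abs_of_pos ht1'] at e2
        rw [← e1, ← e2]
        refine (Real.volume_add_le_volume_add
          ((measurableSet_lt measurable_const hf).const_smul₀ t)
          ((measurableSet_lt measurable_const hg).const_smul₀ (1 - t))
          (hfn.smul_set) (hgn.smul_set)).trans (measure_mono ?_)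
        rintro _ ⟨_, ⟨x, hx, rfl⟩, _, ⟨y, hy, rfl⟩, rfl⟩
        refine lt_min ?_ hs1
        refine lt_of_lt_of_le ?_ (H x y)
        calc ENNReal.ofReal s = ENNReal.ofReal s ^ t * ENNReal.ofReal s ^ (1 - t) := by
              rw [← ENNReal.rpow_add _ _ hs0 ENNReal.ofReal_ne_top]; simp
          _ < _ := ENNReal.mul_lt_mul (ENNReal.rpow_lt_rpow hx ht0)
              (ENNReal.rpow_lt_rpow hy ht1')
    _ = ∫⁻ x, min (h x) 1 :=
        (lintegral_eq_setLIntegral_measure_lt_of_le_one volume (hh.min measurable_const)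
          fun x => min_le_right _ _).symm
    _ ≤ ∫⁻ x, h x := lintegral_mono fun x => min_le_left _ _

theorem prekopa_leindler_of_bounded {f g h : ℝ → ℝ≥0∞} (hf : Measurable f)
    (hg : Measurable g) (hh : Measurable h) {t : ℝ} (ht0 : 0 < t) (ht1 : t < 1)
    (hf1 : ⨆ x, f x ≠ ⊤) (hg1 : ⨆ x, g x ≠ ⊤)
    (H : ∀ x y, f x ^ t * g y ^ (1 - t) ≤ h (t * x + (1 - t) * y)) :
    (∫⁻ x, f x) ^ t * (∫⁻ x, g x) ^ (1 - t) ≤ ∫⁻ x, h x := by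
  have ht1' : 0 < 1 - t := sub_pos.2 ht1
  set F := ⨆ x, f x with hF
  set G := ⨆ x, g x with hG
  rcases eq_or_ne F 0 with hF0 | hF0
  · have : ∀ x, f x = 0 := fun x => le_zero_iff.1 (hF0 ▸ le_iSup f x)
    simp [this, ht0]
  rcases eq_or_ne G 0 with hG0 | hG0
  · have : ∀ x, g x = 0 := fun x => le_zero_iff.1 (hG0 ▸ le_iSup g x)
    simp [this, ht1]
  set M := F ^ t * G ^ (1 - t) with hM
  have hM0 : M ≠ 0 := by
    simp [hM, hF0, hG0, hf1, hg1]
  have hMt : M ≠ ⊤ := ENNReal.mul_ne_top (ENNReal.rpow_ne_top_of_nonneg ht0.le hf1)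
    (ENNReal.rpow_ne_top_of_nonneg ht1'.le hg1)
  have hMinv : M⁻¹ = F⁻¹ ^ t * G⁻¹ ^ (1 - t) := by
    rw [hM, ENNReal.mul_inv, ENNReal.inv_rpow, ENNReal.inv_rpow]
    · exact Or.inr (ENNReal.rpow_ne_top_of_nonneg ht1'.le hg1)
    · exact Or.inl (ENNReal.rpow_ne_top_of_nonneg ht0.le hf1)
  have key := prekopa_leindler_of_iSup_eq_one (hf.const_mul F⁻¹) (hg.const_mul G⁻¹)
    (hh.const_mul M⁻¹) ht0 ht1
    (by rw [← ENNReal.mul_iSup, ENNReal.inv_mul_cancel hF0 hf1])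
    (by rw [← ENNReal.mul_iSup, ENNReal.inv_mul_cancel hG0 hg1])
    (fun x y => by
      rw [ENNReal.mul_rpow_of_nonneg _ _ ht0.le, ENNReal.mul_rpow_of_nonneg _ _ ht1'.le,
        mul_mul_mul_comm, hMinv]
      gcongr
      exact H x y)
  have key := (ENNReal.geom_mean_le_arith_mean_two ht0 ht1 _ _).trans key
  rw [lintegral_const_mul _ hf, lintegral_const_mul _ hg, lintegral_const_mul _ hh,
    ENNReal.mul_rpow_of_nonneg _ _ ht0.le, ENNReal.mul_rpow_of_nonneg _ _ ht1'.le,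
    mul_mul_mul_comm, ← hMinv] at key
  exact (ENNReal.mul_le_mul_iff_right (ENNReal.inv_ne_zero.2 hMt) (ENNReal.inv_ne_top.2 hM0)).1 key

/-- The one-dimensional Prékopa–Leindler inequality. -/
theorem prekopa_leindler {f g h : ℝ → ℝ≥0∞} (hf : Measurable f)
    (hg : Measurable g) (hh : Measurable h) {t : ℝ} (ht0 : 0 < t) (ht1 : t < 1)
    (H : ∀ x y, f x ^ t * g y ^ (1 - t) ≤ h (t * x + (1 - t) * y)) :
    (∫⁻ x, f x) ^ t * (∫⁻ x, g x) ^ (1 - t) ≤ ∫⁻ x, h x := by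
  have ht1' : 0 < 1 - t := sub_pos.2 ht1
  rcases eq_or_ne (∫⁻ x, f x) 0 with hf0 | hf0
  · simp [hf0, ht0]
  rcases eq_or_ne (∫⁻ x, g x) 0 with hg0 | hg0
  · simp [hg0, ht1]
  have trunc : ∀ k : ℝ → ℝ≥0∞, Measurable k → Filter.Tendsto
      (fun N : ℕ => ∫⁻ x, min (k x) N) Filter.atTop (nhds (∫⁻ x, k x)) := by
    intro k hk
    refine lintegral_tendsto_of_tendsto_of_monotone
      (fun N => (hk.min measurable_const).aemeasurable)
      (Filter.Eventually.of_forall fun x N N' hN => ?_) (Filter.Eventually.of_forall fun x => ?_)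
    · have : (N : ℝ≥0∞) ≤ N' := by exact_mod_cast hN
      exact min_le_min le_rfl this
    · have := (tendsto_const_nhds (x := k x)).min ENNReal.tendsto_nat_nhds_top
      simpa using this
  refine le_of_tendsto (ENNReal.Tendsto.mul ((trunc f hf).ennrpow_const t) ?_
    ((trunc g hg).ennrpow_const (1 - t)) ?_) (Filter.Eventually.of_forall fun N => ?_)
  · left
    simp [hf0, ht0.not_gt]
  · left
    simp [hg0, ht1.not_gt]
  · have hb : ∀ k : ℝ → ℝ≥0∞, ⨆ x, min (k x) (N : ℝ≥0∞) ≠ ⊤ := fun k =>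
      ne_top_of_le_ne_top (ENNReal.natCast_ne_top N) (iSup_le fun x => min_le_right _ _)
    refine prekopa_leindler_of_bounded (hf.min measurable_const) (hg.min measurable_const) hh
      ht0 ht1 (hb f) (hb g) fun x y => le_trans ?_ (H x y)
    gcongr <;> exact min_le_left _ _

/-- Log-concavity of a function with values in `[0, ∞]`. -/
def IsENNRealLogConcave {E : Type*} [AddCommGroup E] [Module ℝ E] (f : E → ℝ≥0∞) : Prop :=
  ∀ x y : E, ∀ t : ℝ, 0 < t → t < 1 →
    f x ^ t * f y ^ (1 - t) ≤ f (t • x + (1 - t) • y)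

theorem IsENNRealLogConcave.comp_linearMap {E F : Type*} [AddCommGroup E] [Module ℝ E]
    [AddCommGroup F] [Module ℝ F] {f : F → ℝ≥0∞} (hf : IsENNRealLogConcave f) (L : E →ₗ[ℝ] F) :
    IsENNRealLogConcave fun x => f (L x) := by
  intro x y t ht0 ht1
  simpa using hf (L x) (L y) t ht0 ht1

theorem IsENNRealLogConcave.lintegral_real {E : Type*} [AddCommGroup E] [Module ℝ E]
    [MeasurableSpace E] {f : E × ℝ → ℝ≥0∞} (hf : IsENNRealLogConcave f) (hfm : Measurable f) :
    IsENNRealLogConcave fun x => ∫⁻ s, f (x, s) := by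
  intro x y t ht0 ht1
  refine prekopa_leindler (hfm.comp measurable_prodMk_left) (hfm.comp measurable_prodMk_left)
    (hfm.comp measurable_prodMk_left) ht0 ht1 fun r s => ?_
  simpa using hf (x, r) (y, s) t ht0 ht1

/-- Prékopa's theorem: marginals of log-concave functions are log-concave. -/
theorem IsENNRealLogConcave.lintegral_pi {E : Type*} [AddCommGroup E] [Module ℝ E]
    [MeasurableSpace E] {n : ℕ} {f : E × (Fin n → ℝ) → ℝ≥0∞} (hf : IsENNRealLogConcave f)
    (hfm : Measurable f) : IsENNRealLogConcave fun x => ∫⁻ y, f (x, y) := by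
  induction n generalizing E with
  | zero =>
    have : (fun x => ∫⁻ y, f (x, y)) = fun x => f (x, 0) := by
      ext x
      rw [Measure.volume_pi_eq_dirac 0, lintegral_dirac]
    rw [this]
    exact hf.comp_linearMap (LinearMap.inl ℝ E (Fin 0 → ℝ))
  | succ n ih =>
    let c : ℝ × (Fin n → ℝ) → (Fin (n + 1) → ℝ) :=
      (MeasurableEquiv.piFinSuccAbove (fun _ : Fin (n + 1) => ℝ) 0).symm
    have hc : ∀ p, c p = Fin.cons p.1 p.2 := fun p => by
      simp [c]; rfl
    have hcm : Measurable c := MeasurableEquiv.measurable _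
    have hcv : MeasurePreserving c volume volume :=
      (volume_preserving_piFinSuccAbove (fun _ : Fin (n + 1) => ℝ) 0).symm
    let f' : (E × ℝ) × (Fin n → ℝ) → ℝ≥0∞ := fun p => f (p.1.1, c (p.1.2, p.2))
    have hf'm : Measurable f' := hfm.comp (by fun_prop)
    have hf' : IsENNRealLogConcave f' := by
      intro x y t ht0 ht1
      have h := hf (x.1.1, c (x.1.2, x.2)) (y.1.1, c (y.1.2, y.2)) t ht0 ht1
      convert h using 2
      refine Prod.ext rfl ?_
      ext i
      simp only [hc]
      refine Fin.cases ?_ (fun j => ?_) i <;> simp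
    have h1 := (ih hf' hf'm).lintegral_real hf'm.lintegral_prod_right'
    convert h1 using 2 with x
    have hm : Measurable fun y => f (x, y) := hfm.comp measurable_prodMk_left
    rw [← hcv.lintegral_comp hm, Measure.volume_eq_prod, lintegral_prod _ (by fun_prop)]

/-- The marginal of a log-concave density in a unit direction has a log-concave density. -/
theorem exists_logConcave_density_map_inner {n : ℕ} {f : EuclideanSpace ℝ (Fin n) → ℝ≥0∞}
    (hf : IsENNRealLogConcave f) (hfm : Measurable f) {θ : EuclideanSpace ℝ (Fin n)}
    (hθ : ‖θ‖ = 1) : ∃ g : ℝ → ℝ≥0∞, Measurable g ∧ IsENNRealLogConcave g ∧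
      (volume.withDensity f).map (fun x => inner ℝ θ x) = volume.withDensity g := by
  obtain _ | m := n
  · have : θ = 0 := Subsingleton.elim _ _
    simp [this] at hθ
  obtain ⟨b, hb⟩ := Orthonormal.exists_orthonormalBasis_extension_of_card_eq (𝕜 := ℝ)
    (E := EuclideanSpace ℝ (Fin (m + 1))) (ι := Fin (m + 1)) (by simp)
    (v := fun _ => θ) (s := {0}) (by
      constructor
      · intro i; simpa using hθ
      · intro i j hij
        exact absurd (Subsingleton.elim i j) hij)
  have hb0 : b 0 = θ := hb 0 rfl
  let c : ℝ × (Fin m → ℝ) → (Fin (m + 1) → ℝ) :=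
    (MeasurableEquiv.piFinSuccAbove (fun _ : Fin (m + 1) => ℝ) 0).symm
  have hc : ∀ p, c p = Fin.cons p.1 p.2 := fun p => by
    simp [c]; rfl
  have hcv : MeasurePreserving c volume volume :=
    (volume_preserving_piFinSuccAbove (fun _ : Fin (m + 1) => ℝ) 0).symm
  let Φ : ℝ × (Fin m → ℝ) → EuclideanSpace ℝ (Fin (m + 1)) :=
    fun p => b.repr.symm (WithLp.toLp 2 (c p))
  have hΦv : MeasurePreserving Φ volume volume :=
    b.repr.symm.measurePreserving.comp ((PiLp.volume_preserving_toLp (Fin (m + 1))).comp hcv)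
  have hΦθ : ∀ p, inner ℝ θ (Φ p) = p.1 := by
    intro p
    rw [← hb0, ← b.repr_apply_apply]
    simp [Φ, hc]
  have hΦf : IsENNRealLogConcave fun p => f (Φ p) := by
    intro x y t ht0 ht1
    have h := hf (Φ x) (Φ y) t ht0 ht1
    convert h using 2
    simp only [Φ, ← map_smul, ← map_add, ← WithLp.toLp_smul, ← WithLp.toLp_add]
    congr 2
    ext i
    simp only [hc]
    refine Fin.cases ?_ (fun j => ?_) i <;> simp
  have hΦm : Measurable fun p => f (Φ p) := hfm.comp hΦv.measurable
  refine ⟨fun s => ∫⁻ y, f (Φ (s, y)), hΦm.lintegral_prod_right', hΦf.lintegral_pi hΦm, ?_⟩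
  have hin : Measurable fun x : EuclideanSpace ℝ (Fin (m + 1)) => inner ℝ θ x := by fun_prop
  ext A hA
  rw [Measure.map_apply hin hA, withDensity_apply _ (hin hA), withDensity_apply _ hA,
    ← lintegral_indicator (hin hA), ← lintegral_indicator hA,
    ← hΦv.lintegral_comp (hfm.indicator (hin hA)), Measure.volume_eq_prod,
    lintegral_prod (f := fun p => Set.indicator _ f (Φ p))
      ((hfm.indicator (hin hA)).comp hΦv.measurable).aemeasurable]
  refine lintegral_congr fun s => ?_
  by_cases hs : s ∈ A <;> simp [hΦθ, hs]

theorem IsENNRealLogConcave.ne_top_of_lintegral_ne_top {g : ℝ → ℝ≥0∞}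
    (hg : IsENNRealLogConcave g) (h0 : ∫⁻ x, g x ≠ 0) (h1 : ∫⁻ x, g x ≠ ⊤) (x : ℝ) :
    g x ≠ ⊤ := by
  intro hx
  obtain ⟨y, hyx, hy⟩ : ∃ y, y ≠ x ∧ g y ≠ 0 := by
    by_contra! h
    refine h0 ?_
    rw [lintegral_congr_ae (g := 0)]
    · simp
    · filter_upwards [compl_mem_ae_iff.2 (measure_singleton (μ := volume) x)] with y hy
      exact h y hy
  have htop : ∀ z ∈ openSegment ℝ x y, g z = ⊤ := by
    rintro z ⟨t, s, ht, hs, hts, rfl⟩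
    obtain rfl : s = 1 - t := by linarith
    have h := hg x y t ht (by linarith)
    rw [hx, ENNReal.top_rpow_of_pos ht, ENNReal.top_mul] at h
    · exact top_le_iff.1 h
    · simp only [ne_eq, ENNReal.rpow_eq_zero_iff, not_or, not_and]
      exact ⟨fun h => absurd h hy, fun _ => hs.le.not_gt⟩
  rw [openSegment_eq_Ioo' hyx.symm] at htop
  refine h1 (top_le_iff.1 ?_)
  calc (⊤ : ℝ≥0∞) = ∫⁻ z in Set.Ioo (min x y) (max x y), ⊤ := by
        rw [setLIntegral_const, ENNReal.top_mul]
        simpa using fun h : y ≤ x => h.lt_of_ne hyx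
    _ = ∫⁻ z in Set.Ioo (min x y) (max x y), g z :=
        (setLIntegral_congr_fun measurableSet_Ioo htop).symm
    _ ≤ ∫⁻ z, g z := setLIntegral_le_lintegral _ _

theorem IsENNRealLogConcave.toReal {E : Type*} [AddCommGroup E] [Module ℝ E] {g : E → ℝ≥0∞}
    (hg : IsENNRealLogConcave g) (hgt : ∀ x, g x ≠ ⊤) : IsLogConcaveFun fun x => (g x).toReal := by
  refine ⟨fun x => ENNReal.toReal_nonneg, fun x y t ht0 ht1 => ?_⟩
  rcases ht0.eq_or_lt with rfl | ht0
  · simp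
  rcases ht1.eq_or_lt with rfl | ht1
  · simp
  rw [ENNReal.toReal_rpow, ENNReal.toReal_rpow, ← ENNReal.toReal_mul]
  exact ENNReal.toReal_mono (hgt _) (hg x y t ht0 ht1)

/-- A log-concave function on a finite-dimensional space agrees almost everywhere with a
measurable log-concave function. -/
theorem IsLogConcaveFun.exists_measurable {E : Type*} [NormedAddCommGroup E] [NormedSpace ℝ E]
    [MeasurableSpace E] [BorelSpace E] [FiniteDimensional ℝ E] (μ : Measure E)
    [μ.IsAddHaarMeasure] {f : E → ℝ} (hf : IsLogConcaveFun f) :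
    ∃ g : E → ℝ≥0∞, Measurable g ∧ IsENNRealLogConcave g ∧
      (fun x => ENNReal.ofReal (f x)) =ᵐ[μ] g := by
  set C : Set E := {x | 0 < f x} with hC
  have hconv : ∀ x ∈ C, ∀ y ∈ C, ∀ t : ℝ, 0 < t → t < 1 → t • x + (1 - t) • y ∈ C := by
    intro x hx y hy t ht0 ht1
    exact lt_of_lt_of_le (mul_pos (Real.rpow_pos_of_pos hx _) (Real.rpow_pos_of_pos hy _))
      (hf.2 x y t ht0.le ht1.le)
  have hCc : Convex ℝ C := by
    rw [convex_iff_forall_pos]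
    intro x hx y hy a b ha hb hab
    obtain rfl : b = 1 - a := by linarith
    exact hconv x hx y hy a ha (by linarith)
  have hlog : ConcaveOn ℝ C fun x => Real.log (f x) := by
    refine concaveOn_iff_forall_pos.2 ⟨hCc, ?_⟩
    intro x hx y hy a b ha hb hab
    obtain rfl : b = 1 - a := by linarith
    have h := Real.log_le_log
      (mul_pos (Real.rpow_pos_of_pos hx _) (Real.rpow_pos_of_pos hy _))
      (hf.2 x y a ha.le (by linarith))
    rwa [Real.log_mul (Real.rpow_pos_of_pos hx _).ne' (Real.rpow_pos_of_pos hy _).ne',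
      Real.log_rpow hx, Real.log_rpow hy] at h
  have hcont : ContinuousOn f (interior C) := by
    refine (Real.continuous_exp.comp_continuousOn hlog.continuousOn_interior).congr ?_
    intro x hx
    exact (Real.exp_log (interior_subset hx : x ∈ C)).symm
  refine ⟨(interior C).indicator fun x => ENNReal.ofReal (f x), ?_, ?_, ?_⟩
  · classical
    have h := ContinuousOn.measurable_piecewise (g := fun _ => (0 : ℝ≥0∞))
      (ENNReal.continuous_ofReal.comp_continuousOn hcont) continuousOn_const
      isOpen_interior.measurableSet
    convert h using 1
    ext x
    simp [Set.piecewise, Set.indicator_apply]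
  · intro x y t ht0 ht1
    by_cases hx : x ∈ interior C
    · by_cases hy : y ∈ interior C
      · have hz : t • x + (1 - t) • y ∈ interior C :=
          hCc.interior hx hy ht0.le (by linarith) (by ring)
        rw [Set.indicator_of_mem hx, Set.indicator_of_mem hy, Set.indicator_of_mem hz,
          ENNReal.ofReal_rpow_of_nonneg (hf.1 _) ht0.le,
          ENNReal.ofReal_rpow_of_nonneg (hf.1 _) (by linarith),
          ← ENNReal.ofReal_mul (Real.rpow_nonneg (hf.1 _) _)]
        exact ENNReal.ofReal_le_ofReal (hf.2 x y t ht0.le ht1.le)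
      · simp [hy, ht1]
    · simp [hx, ht0]
  · filter_upwards [compl_mem_ae_iff.2 (hCc.addHaar_frontier μ)] with x hx
    by_cases hxi : x ∈ interior C
    · simp [hxi]
    · have hxC : x ∉ C := fun h => hx ⟨subset_closure h, hxi⟩
      simp only [hC, Set.mem_ofPred_eq, not_lt] at hxC
      simp [hxi, hxC]

theorem map_neg_cond {G : Type*} [MeasurableSpace G] [Neg G] [MeasurableNeg G] {μ : Measure G}
    (hμ : μ.map (fun x => -x) = μ) {s : Set G} (hs : MeasurableSet s)
    (hneg : (fun x : G => -x) ⁻¹' s = s) : (μ[|s]).map (fun x => -x) = μ[|s] := by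
  rw [ProbabilityTheory.cond, Measure.map_smul]
  congr 1
  conv_lhs => rw [← hneg]
  rw [← Measure.restrict_map measurable_neg hs, hμ]

theorem IsENNRealLogConcave.const_mul_indicator {E : Type*} [AddCommGroup E] [Module ℝ E]
    {g : E → ℝ≥0∞} (hg : IsENNRealLogConcave g) {s : Set E} (hs : Convex ℝ s) {c : ℝ≥0∞}
    (hc0 : c ≠ 0) (hct : c ≠ ⊤) : IsENNRealLogConcave (c • s.indicator g) := by
  intro x y t ht0 ht1
  have ht1' : 0 < 1 - t := sub_pos.2 ht1
  simp only [Pi.smul_apply, smul_eq_mul]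
  by_cases hx : x ∈ s
  · by_cases hy : y ∈ s
    · have hz : t • x + (1 - t) • y ∈ s := hs hx hy ht0.le ht1'.le (by ring)
      rw [Set.indicator_of_mem hx, Set.indicator_of_mem hy, Set.indicator_of_mem hz,
        ENNReal.mul_rpow_of_nonneg _ _ ht0.le, ENNReal.mul_rpow_of_nonneg _ _ ht1'.le,
        mul_mul_mul_comm, ← ENNReal.rpow_add _ _ hc0 hct]
      have := hg x y t ht0 ht1
      simp only [add_sub_cancel, ENNReal.rpow_one]
      gcongr
    · simp [hy, ht1]
  · simp [hx, ht0]

theorem measure_mul_setLIntegral_pow_four_le (C₀ : ℝ) (hC₀ : 0 ≤ C₀)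
    (hBorell : ∀ ν : Measure ℝ, IsProbabilityMeasure ν →
      (∃ g : ℝ → ℝ, IsLogConcaveFun g ∧
        ν = volume.withDensity fun x => ENNReal.ofReal (g x)) →
      Measure.map (fun x : ℝ => -x) ν = ν →
      (∫ x, x ^ 4 ∂ν) ^ ((1 : ℝ) / 2) ≤ C₀ * ∫ x, x ^ 2 ∂ν)
    {ν : Measure ℝ} [IsProbabilityMeasure ν] {g : ℝ → ℝ≥0∞} (hgm : Measurable g)
    (hg : IsENNRealLogConcave g) (hν : ν = volume.withDensity g)
    (hsymm : ν.map (fun x => -x) = ν) (hint : Integrable (fun x => x ^ 2) ν) (R : ℝ) :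
    ν (Set.Icc (-R) R) * ∫⁻ x in Set.Icc (-R) R, ENNReal.ofReal (x ^ 4) ∂ν ≤
      ENNReal.ofReal (C₀ ^ 2 * (∫ x, x ^ 2 ∂ν) ^ 2) := by
  set I := Set.Icc (-R) R with hI
  rcases eq_or_ne (ν I) 0 with h0 | h0
  · simp [h0]
  have hIm : MeasurableSet I := measurableSet_Icc
  have hg1 : ∫⁻ x, g x = 1 := by
    have := measure_univ (μ := ν)
    rwa [hν, withDensity_apply _ MeasurableSet.univ, setLIntegral_univ] at this
  have hgt := hg.ne_top_of_lintegral_ne_top (by simp [hg1]) (by simp [hg1])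
  set c := (ν I)⁻¹ with hc
  have hc0 : c ≠ 0 := ENNReal.inv_ne_zero.2 (measure_ne_top _ _)
  have hct : c ≠ ⊤ := ENNReal.inv_ne_top.2 h0
  have hlc := hg.const_mul_indicator (convex_Icc (-R) R) hc0 hct
  have hlct : ∀ x, (c • I.indicator g) x ≠ ⊤ := fun x =>
    ENNReal.mul_ne_top hct (by by_cases hx : x ∈ I <;> simp [hx, hgt])
  have hcond : ν[|I] = volume.withDensity (c • I.indicator g) := by
    rw [ProbabilityTheory.cond, ← hc, withDensity_smul _ (hgm.indicator hIm),
      withDensity_indicator hIm, hν, restrict_withDensity hIm]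
  have hprob : IsProbabilityMeasure (ν[|I]) := cond_isProbabilityMeasure h0
  have key := hBorell (ν[|I]) hprob ⟨_, hlc.toReal hlct, by
    rw [hcond]
    congr 1
    ext x
    exact (ENNReal.ofReal_toReal (hlct x)).symm⟩ (map_neg_cond hsymm hIm (by ext x; simp [hI, and_comm]))
  have h4 : IntegrableOn (fun x : ℝ => x ^ 4) I ν := Continuous.integrableOn_Icc (by fun_prop)
  have hp : 0 < (ν I).toReal := ENNReal.toReal_pos h0 (measure_ne_top _ _)
  have hcr : c.toReal = (ν I).toReal⁻¹ := by simp [hc]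
  rw [ProbabilityTheory.cond, integral_smul_measure, integral_smul_measure, ← hc, hcr,
    ← Real.sqrt_eq_rpow, smul_eq_mul, smul_eq_mul] at key
  have hA0 : 0 ≤ ∫ x in I, x ^ 4 ∂ν := integral_nonneg fun x => by positivity
  have hB0 : 0 ≤ ∫ x in I, x ^ 2 ∂ν := integral_nonneg fun x => by positivity
  have hBle : ∫ x in I, x ^ 2 ∂ν ≤ ∫ x, x ^ 2 ∂ν :=
    setIntegral_le_integral hint (Filter.Eventually.of_forall fun x => by positivity)
  rw [Real.sqrt_le_left (by positivity)] at key
  rw [← ofReal_integral_eq_lintegral_ofReal h4 (Filter.Eventually.of_forall fun x => by positivity),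
    ← ENNReal.ofReal_toReal (measure_ne_top ν I), ← ENNReal.ofReal_mul hp.le]
  refine ENNReal.ofReal_le_ofReal ?_
  have h1 : (ν I).toReal * (∫ x in I, x ^ 4 ∂ν) =
      (ν I).toReal ^ 2 * ((ν I).toReal⁻¹ * ∫ x in I, x ^ 4 ∂ν) := by field_simp
  rw [h1]
  calc _ ≤ (ν I).toReal ^ 2 * (C₀ * ((ν I).toReal⁻¹ * ∫ x in I, x ^ 2 ∂ν)) ^ 2 := by gcongr
    _ = C₀ ^ 2 * (∫ x in I, x ^ 2 ∂ν) ^ 2 := by field_simp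
    _ ≤ _ := by gcongr

theorem lintegral_pow_four_le (C₀ : ℝ) (hC₀ : 0 ≤ C₀)
    (hBorell : ∀ ν : Measure ℝ, IsProbabilityMeasure ν →
      (∃ g : ℝ → ℝ, IsLogConcaveFun g ∧
        ν = volume.withDensity fun x => ENNReal.ofReal (g x)) →
      Measure.map (fun x : ℝ => -x) ν = ν →
      (∫ x, x ^ 4 ∂ν) ^ ((1 : ℝ) / 2) ≤ C₀ * ∫ x, x ^ 2 ∂ν)
    {ν : Measure ℝ} [IsProbabilityMeasure ν] {g : ℝ → ℝ≥0∞} (hgm : Measurable g)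
    (hg : IsENNRealLogConcave g) (hν : ν = volume.withDensity g)
    (hsymm : ν.map (fun x => -x) = ν) (hint : Integrable (fun x => x ^ 2) ν) :
    ∫⁻ x, ENNReal.ofReal (x ^ 4) ∂ν ≤ ENNReal.ofReal (C₀ ^ 2 * (∫ x, x ^ 2 ∂ν) ^ 2) := by
  let I : ℕ → Set ℝ := fun N => Set.Icc (-(N : ℝ)) N
  have hmono : Monotone I := fun N N' h => by
    have : (N : ℝ) ≤ N' := by exact_mod_cast h
    exact Set.Icc_subset_Icc (neg_le_neg this) this
  have hU : ⋃ N, I N = Set.univ := by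
    refine Set.eq_univ_of_forall fun x => Set.mem_iUnion.2 ?_
    obtain ⟨N, hN⟩ := exists_nat_ge |x|
    exact ⟨N, abs_le.1 hN⟩
  have hlim : ∀ ρ : Measure ℝ, Filter.Tendsto (fun N => ρ (I N)) Filter.atTop
      (nhds (ρ Set.univ)) := fun ρ => hU ▸ tendsto_measure_iUnion_atTop hmono
  have h1 := hlim ν
  have h2 := hlim (ν.withDensity fun x => ENNReal.ofReal (x ^ 4))
  simp only [withDensity_apply _ MeasurableSet.univ, setLIntegral_univ, I,
    withDensity_apply _ measurableSet_Icc] at h2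
  rw [measure_univ] at h1
  have h3 := ENNReal.Tendsto.mul h1 (by simp) h2 (by simp)
  rw [one_mul] at h3
  exact le_of_tendsto h3 (Filter.Eventually.of_forall fun N =>
    measure_mul_setLIntegral_pow_four_le C₀ hC₀ hBorell hgm hg hν hsymm hint N)

/-- Linear functionals of a symmetric log-concave vector satisfy the fourth moment bound of
symmetric log-concave real variables. -/
theorem integrable_inner_pow_four {n : ℕ} (C₀ : ℝ) (hC₀ : 0 ≤ C₀)
    (hBorell : ∀ ν : Measure ℝ, IsProbabilityMeasure ν →
      (∃ g : ℝ → ℝ, IsLogConcaveFun g ∧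
        ν = volume.withDensity fun x => ENNReal.ofReal (g x)) →
      Measure.map (fun x : ℝ => -x) ν = ν →
      (∫ x, x ^ 4 ∂ν) ^ ((1 : ℝ) / 2) ≤ C₀ * ∫ x, x ^ 2 ∂ν)
    {μ : Measure (EuclideanSpace ℝ (Fin n))} [IsProbabilityMeasure μ]
    (hlc : IsLogConcaveMeasure μ) (hsymm : μ.map (fun x => -x) = μ)
    {θ : EuclideanSpace ℝ (Fin n)} (hθ : ‖θ‖ = 1)
    (hint : Integrable (fun x => inner ℝ θ x ^ 2) μ) :
    Integrable (fun x => inner ℝ θ x ^ 4) μ ∧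
      ∫ x, inner ℝ θ x ^ 4 ∂μ ≤ C₀ ^ 2 * (∫ x, inner ℝ θ x ^ 2 ∂μ) ^ 2 := by
  obtain ⟨f, hf, rfl⟩ := hlc
  obtain ⟨f', hf'm, hf', hff'⟩ := hf.exists_measurable volume
  rw [withDensity_congr_ae hff'] at *
  obtain ⟨g, hgm, hg, hν⟩ := exists_logConcave_density_map_inner hf' hf'm hθ
  set μ := (volume : Measure (EuclideanSpace ℝ (Fin n))).withDensity f' with hμ
  have hin : Measurable fun x : EuclideanSpace ℝ (Fin n) => inner ℝ θ x := by fun_prop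
  have hprob : IsProbabilityMeasure (μ.map fun x => inner ℝ θ x) :=
    Measure.isProbabilityMeasure_map hin.aemeasurable
  have hs : (μ.map fun x => inner ℝ θ x).map (fun x => -x) = μ.map fun x => inner ℝ θ x := by
    rw [Measure.map_map measurable_neg hin]
    conv_rhs => rw [← hsymm, Measure.map_map hin measurable_neg]
    congr 1
    ext x
    simp
  have h2 : Integrable (fun x : ℝ => x ^ 2) (μ.map fun x => inner ℝ θ x) :=
    (integrable_map_measure (by fun_prop) hin.aemeasurable).2 hint
  have key := lintegral_pow_four_le C₀ hC₀ hBorell hgm hg hν hs h2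
  rw [integral_map hin.aemeasurable (by fun_prop), lintegral_map (by fun_prop) hin] at key
  have h4 : Integrable (fun x => inner ℝ θ x ^ 4) μ := by
    refine ⟨by fun_prop, ?_⟩
    rw [hasFiniteIntegral_iff_ofReal (Filter.Eventually.of_forall fun x => by positivity)]
    exact key.trans_lt ENNReal.ofReal_lt_top
  refine ⟨h4, ?_⟩
  rw [← ofReal_integral_eq_lintegral_ofReal h4
    (Filter.Eventually.of_forall fun x => by positivity)] at key
  exact (ENNReal.ofReal_le_ofReal_iff (by positivity)).1 key

theorem inner_sq_eq_sum {n : ℕ} (v x : EuclideanSpace ℝ (Fin n)) :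
    inner ℝ v x ^ 2 = ∑ i, ∑ j, v i * v j * (x i * x j) := by
  rw [PiLp.inner_apply, sq, Finset.sum_mul_sum]
  refine Finset.sum_congr rfl fun i _ => Finset.sum_congr rfl fun j _ => ?_
  simp only [RCLike.inner_apply, conj_trivial]
  ring

theorem integrable_inner_sq {n : ℕ} {μ : Measure (EuclideanSpace ℝ (Fin n))}
    (hμ : ∀ i j, Integrable (fun x => x i * x j) μ) (v : EuclideanSpace ℝ (Fin n)) :
    Integrable (fun x => inner ℝ v x ^ 2) μ := by
  simp only [inner_sq_eq_sum]
  exact integrable_finsetSum _ fun i _ => integrable_finsetSum _ fun j _ => (hμ i j).const_mul _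

theorem integral_inner_sq {n : ℕ} {μ : Measure (EuclideanSpace ℝ (Fin n))}
    (hμ : ∀ i j, Integrable (fun x => x i * x j) μ) (v : EuclideanSpace ℝ (Fin n)) :
    ∫ x, inner ℝ v x ^ 2 ∂μ = ∑ i, ∑ j, v i * v j * ∫ x, x i * x j ∂μ := by
  simp only [inner_sq_eq_sum]
  rw [integral_finsetSum _ fun i _ =>
    integrable_finsetSum _ fun j _ => (hμ i j).const_mul _]
  refine Finset.sum_congr rfl fun i _ => ?_
  rw [integral_finsetSum _ fun j _ => (hμ i j).const_mul _]
  exact Finset.sum_congr rfl fun j _ => integral_const_mul _ _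

theorem IsIsotropicMeasure.integrable_mul {n : ℕ} {μ : Measure (EuclideanSpace ℝ (Fin n))}
    (hiso : IsIsotropicMeasure μ) (i j : Fin n) : Integrable (fun x => x i * x j) μ := by
  have h2 : ∀ i, MemLp (fun x : EuclideanSpace ℝ (Fin n) => x i) 2 μ := by
    intro i
    rw [memLp_two_iff_integrable_sq (by fun_prop)]
    by_contra h
    have h1 := hiso.2 i i
    simp only [← sq, integral_undef h] at h1
    simp at h1
  exact (h2 i).integrable_mul (h2 j)

theorem IsIsotropicMeasure.integral_inner_sq {n : ℕ} {μ : Measure (EuclideanSpace ℝ (Fin n))}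
    (hiso : IsIsotropicMeasure μ) (v : EuclideanSpace ℝ (Fin n)) :
    ∫ x, inner ℝ v x ^ 2 ∂μ = ‖v‖ ^ 2 := by
  rw [_root_.integral_inner_sq hiso.integrable_mul, EuclideanSpace.real_norm_sq_eq]
  simp [hiso.2, sq]

/-- Chebyshev's inequality for the norm of an isotropic vector. -/
theorem IsIsotropicMeasure.measureReal_compl_closedBall_le {n : ℕ}
    {μ : Measure (EuclideanSpace ℝ (Fin n))} [IsProbabilityMeasure μ]
    (hiso : IsIsotropicMeasure μ) (hn : 0 < n) {r : ℝ} (hr : 0 < r) :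
    μ.real (Metric.closedBall 0 (r * √n))ᶜ ≤ 1 / r ^ 2 := by
  have hn' : (0 : ℝ) < n := by exact_mod_cast hn
  have hsq : ∀ x : EuclideanSpace ℝ (Fin n), ‖x‖ ^ 2 = ∑ i, x i * x i := fun x => by
    simp only [EuclideanSpace.real_norm_sq_eq, ← sq]
  have hint : Integrable (fun x : EuclideanSpace ℝ (Fin n) => ‖x‖ ^ 2) μ := by
    simp only [hsq]
    exact integrable_finsetSum _ fun i _ => hiso.integrable_mul i i
  have hval : ∫ x, ‖x‖ ^ 2 ∂μ = n := by
    simp only [hsq]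
    rw [integral_finsetSum _ fun i _ => hiso.integrable_mul i i]
    simp [hiso.2]
  have hmarkov := mul_meas_ge_le_integral_of_nonneg
    (Filter.Eventually.of_forall fun x => by positivity) hint (r ^ 2 * n)
  have hsub : (Metric.closedBall (0 : EuclideanSpace ℝ (Fin n)) (r * √n))ᶜ ⊆
      {x | r ^ 2 * n ≤ ‖x‖ ^ 2} := by
    intro x hx
    simp only [Set.mem_compl_iff, mem_closedBall_zero_iff, not_le] at hx
    calc r ^ 2 * n = (r * √n) ^ 2 := by rw [mul_pow, Real.sq_sqrt hn'.le]
      _ ≤ ‖x‖ ^ 2 := by gcongr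
  have hle := measureReal_mono (μ := μ) hsub
  rw [hval] at hmarkov
  rw [le_div_iff₀ (by positivity)]
  have : r ^ 2 * n * μ.real (Metric.closedBall (0 : EuclideanSpace ℝ (Fin n)) (r * √n))ᶜ ≤ n :=
    (mul_le_mul_of_nonneg_left hle (by positivity)).trans hmarkov
  nlinarith

theorem integral_inner_sq_cond_bounds {n : ℕ} {C₀ : ℝ} (hC₀ : 1 < C₀)
    {μ : Measure (EuclideanSpace ℝ (Fin n))} [IsProbabilityMeasure μ]
    (hiso : IsIsotropicMeasure μ) {θ : EuclideanSpace ℝ (Fin n)} (hθ : ‖θ‖ = 1)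
    (h4i : Integrable (fun x => inner ℝ θ x ^ 4) μ)
    (h4 : ∫ x, inner ℝ θ x ^ 4 ∂μ ≤ C₀ ^ 2) :
    1 / 2 ≤ ∫ x, inner ℝ θ x ^ 2 ∂μ[|Metric.closedBall 0 (2 * C₀ * √n)] ∧
      ∫ x, inner ℝ θ x ^ 2 ∂μ[|Metric.closedBall 0 (2 * C₀ * √n)] ≤ 2 := by
  have hn : 0 < n := by
    rcases Nat.eq_zero_or_pos n with rfl | hn
    · have : θ = 0 := Subsingleton.elim _ _
      simp [this] at hθ
    · exact hn
  have hC : 0 < C₀ := by linarith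
  set K : Set (EuclideanSpace ℝ (Fin n)) := Metric.closedBall 0 (2 * C₀ * √n) with hK
  have hKm : MeasurableSet K := Metric.isClosed_closedBall.measurableSet
  have hq : Integrable (fun x => inner ℝ θ x ^ 2) μ := integrable_inner_sq hiso.integrable_mul θ
  have hq1 : ∫ x, inner ℝ θ x ^ 2 ∂μ = 1 := by rw [hiso.integral_inner_sq, hθ, one_pow]
  have hP := hiso.measureReal_compl_closedBall_le hn (r := 2 * C₀) (by positivity)
  have hP' : 1 / (2 * C₀) ^ 2 ≤ 1 / 4 := by
    rw [div_le_div_iff₀ (by positivity) (by norm_num)]; nlinarith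
  have hpc : μ.real K + μ.real Kᶜ = 1 := by
    rw [measureReal_compl hKm]; simp
  have hp : 3 / 4 ≤ μ.real K := by linarith
  have hp1 : μ.real K ≤ 1 := measureReal_le_one
  have hsplit := integral_add_compl hKm hq
  rw [hq1] at hsplit
  have h0 : 0 ≤ ∫ x in Kᶜ, inner ℝ θ x ^ 2 ∂μ := integral_nonneg fun x => by positivity
  have hbound : ∫ x in Kᶜ, inner ℝ θ x ^ 2 ∂μ ≤ 1 / 2 := by
    calc ∫ x in Kᶜ, inner ℝ θ x ^ 2 ∂μ
        ≤ ∫ x in Kᶜ, (1 / (4 * C₀ ^ 2) * inner ℝ θ x ^ 4 + C₀ ^ 2) ∂μ := by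
          refine integral_mono hq.integrableOn
            ((h4i.integrableOn.const_mul _).add (integrable_const _)) fun x => ?_
          have h := sq_nonneg (inner ℝ θ x ^ 2 / (2 * C₀) - C₀)
          have e : (inner ℝ θ x ^ 2 / (2 * C₀) - C₀) ^ 2 =
              1 / (4 * C₀ ^ 2) * inner ℝ θ x ^ 4 + C₀ ^ 2 - inner ℝ θ x ^ 2 := by
            field_simp
            ring
          simp only
          linarith
      _ = 1 / (4 * C₀ ^ 2) * ∫ x in Kᶜ, inner ℝ θ x ^ 4 ∂μ + μ.real Kᶜ * C₀ ^ 2 := by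
          rw [integral_add (h4i.integrableOn.const_mul _) (integrable_const _),
            integral_const_mul, setIntegral_const, smul_eq_mul]
      _ ≤ 1 / (4 * C₀ ^ 2) * C₀ ^ 2 + 1 / (2 * C₀) ^ 2 * C₀ ^ 2 := by
          gcongr
          exact (setIntegral_le_integral h4i
            (Filter.Eventually.of_forall fun x => by positivity)).trans h4
      _ = 1 / 2 := by
          field_simp
          norm_num
  rw [ProbabilityTheory.cond, integral_smul_measure, smul_eq_mul, ENNReal.toReal_inv,
    ← measureReal_def, inv_mul_eq_div, le_div_iff₀ (by linarith), div_le_iff₀ (by linarith)]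
  constructor <;> linarith

theorem dotProduct_sub_smul_one_mulVec {n : ℕ} (A : Matrix (Fin n) (Fin n) ℝ) (c : ℝ)
    (v : Fin n → ℝ) : v ⬝ᵥ (A - c • (1 : Matrix (Fin n) (Fin n) ℝ)).mulVec v =
      v ⬝ᵥ A.mulVec v - c * ‖WithLp.toLp 2 v‖ ^ 2 := by
  rw [Matrix.sub_mulVec, dotProduct_sub, Matrix.smul_mulVec, Matrix.one_mulVec, dotProduct_smul,
    EuclideanSpace.real_norm_sq_eq]
  simp [dotProduct, sq]

/-- Let `C₀ > 1` be such that every symmetric log-concave real random variable `Y`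
(identified with its law `ν`) satisfies `(𝔼 Y⁴)^{1/2} ≤ C₀ 𝔼 Y²`. Let `X₁` be a
symmetric isotropic log-concave random vector in `ℝⁿ` (identified with its law `μ₁`),
let `K = B₂(0, 2 C₀ √n)`, and let `X₂` have the law `μ₂` of `X₁` conditioned on
`{X₁ ∈ K}`. Then `𝔼[X₂] = 0` and `(1/2) Iₙ ≼ Cov(X₂) ≼ 2 Iₙ`. -/
theorem conditioned_vector_almost_isotropic {n : ℕ} (C₀ : ℝ) (hC₀ : 1 < C₀)
    (hBorell : ∀ ν : Measure ℝ, IsProbabilityMeasure ν →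
      (∃ g : ℝ → ℝ, IsLogConcaveFun g ∧
        ν = volume.withDensity fun x => ENNReal.ofReal (g x)) →
      Measure.map (fun x : ℝ => -x) ν = ν →
      (∫ x, x ^ 4 ∂ν) ^ ((1 : ℝ) / 2) ≤ C₀ * ∫ x, x ^ 2 ∂ν)
    (μ₁ : Measure (EuclideanSpace ℝ (Fin n))) (hprob : IsProbabilityMeasure μ₁)
    (hlc : IsLogConcaveMeasure μ₁) (hiso : IsIsotropicMeasure μ₁)
    (hsymm : Measure.map (fun x : EuclideanSpace ℝ (Fin n) => -x) μ₁ = μ₁) :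
    ∀ μ₂ : Measure (EuclideanSpace ℝ (Fin n)),
      μ₂ = μ₁[|Metric.closedBall 0 (2 * C₀ * Real.sqrt n)] →
      (∀ i, ∫ x, x i ∂μ₂ = 0) ∧
      Matrix.PosSemidef
        ((Matrix.of fun i j =>
            (∫ x, x i * x j ∂μ₂) - (∫ x, x i ∂μ₂) * (∫ x, x j ∂μ₂)) -
          (1 / 2 : ℝ) • (1 : Matrix (Fin n) (Fin n) ℝ)) ∧
      Matrix.PosSemidef
        ((2 : ℝ) • (1 : Matrix (Fin n) (Fin n) ℝ) -
          Matrix.of fun i j =>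
            (∫ x, x i * x j ∂μ₂) - (∫ x, x i ∂μ₂) * (∫ x, x j ∂μ₂)) := by
  rintro μ₂ rfl
  have hint₁ := hiso.integrable_mul
  set K : Set (EuclideanSpace ℝ (Fin n)) := Metric.closedBall 0 (2 * C₀ * Real.sqrt n) with hK
  have hKm : MeasurableSet K := Metric.isClosed_closedBall.measurableSet
  have hmean : ∀ i, ∫ x, x i ∂μ₁[|K] = 0 := by
    intro i
    have hs : (μ₁[|K]).map (fun x => -x) = μ₁[|K] :=
      map_neg_cond hsymm hKm (by ext x; simp [hK])
    have h : ∫ x, x i ∂(μ₁[|K]).map (fun x => -x) = ∫ x, -x i ∂μ₁[|K] := by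
      rw [integral_map (by fun_prop) (by fun_prop)]
      simp
    rw [hs, integral_neg] at h
    linarith
  refine ⟨hmean, ?_⟩
  simp only [hmean, mul_zero, sub_zero]
  have hbounds : ∀ v : EuclideanSpace ℝ (Fin n),
      1 / 2 * ‖v‖ ^ 2 ≤ ∫ x, inner ℝ v x ^ 2 ∂μ₁[|K] ∧
        ∫ x, inner ℝ v x ^ 2 ∂μ₁[|K] ≤ 2 * ‖v‖ ^ 2 := by
    intro v
    rcases eq_or_ne v 0 with rfl | hv
    · simp
    have hv0 : 0 < ‖v‖ := norm_pos_iff.2 hv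
    set θ := ‖v‖⁻¹ • v with hθdef
    have hθ : ‖θ‖ = 1 := norm_smul_inv_norm (𝕜 := ℝ) hv
    have hvθ : v = ‖v‖ • θ := by rw [hθdef, smul_inv_smul₀ hv0.ne']
    obtain ⟨h4i, h4⟩ := integrable_inner_pow_four C₀ (by linarith) hBorell hlc hsymm hθ
      (integrable_inner_sq hint₁ θ)
    rw [hiso.integral_inner_sq, hθ, one_pow, one_pow, mul_one] at h4
    obtain ⟨h1, h2⟩ := integral_inner_sq_cond_bounds hC₀ hiso hθ h4i h4
    have e : ∫ x, inner ℝ v x ^ 2 ∂μ₁[|K] = ‖v‖ ^ 2 * ∫ x, inner ℝ θ x ^ 2 ∂μ₁[|K] := by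
      rw [← integral_const_mul]
      refine integral_congr_ae (Filter.Eventually.of_forall fun x => ?_)
      simp only
      conv_lhs => rw [hvθ, real_inner_smul_left, mul_pow]
    have hv2 := sq_nonneg ‖v‖
    rw [e]
    constructor <;> nlinarith
  set A : Matrix (Fin n) (Fin n) ℝ := Matrix.of fun i j => ∫ x, x i * x j ∂μ₁[|K] with hA
  have hint₂ : ∀ i j, Integrable (fun x : EuclideanSpace ℝ (Fin n) => x i * x j) (μ₁[|K]) := by
    intro i j
    by_cases h0 : μ₁ K = 0
    · simp [ProbabilityTheory.cond_eq_zero_of_meas_eq_zero h0]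
    · exact (hint₁ i j).integrableOn.smul_measure (ENNReal.inv_ne_top.2 h0)
  have hform : ∀ v : Fin n → ℝ,
      v ⬝ᵥ A.mulVec v = ∫ x, inner ℝ (WithLp.toLp 2 v) x ^ 2 ∂μ₁[|K] := by
    intro v
    rw [integral_inner_sq hint₂]
    simp only [dotProduct, Matrix.mulVec, Finset.mul_sum, hA, Matrix.of_apply]
    refine Finset.sum_congr rfl fun i _ => Finset.sum_congr rfl fun j _ => ?_
    ring
  have hherm : A.IsHermitian := by
    ext i j
    simp [hA, mul_comm]
  have hone : ∀ c : ℝ, (c • (1 : Matrix (Fin n) (Fin n) ℝ)).IsHermitian := fun c => by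
    simp [Matrix.IsHermitian]
  constructor
  · refine Matrix.PosSemidef.of_dotProduct_mulVec_nonneg (hherm.sub (hone _)) fun v => ?_
    rw [star_trivial, dotProduct_sub_smul_one_mulVec, hform]
    linarith [(hbounds (WithLp.toLp 2 v)).1]
  · refine Matrix.PosSemidef.of_dotProduct_mulVec_nonneg ((hone _).sub hherm) fun v => ?_
    rw [star_trivial, ← neg_sub A, Matrix.neg_mulVec, dotProduct_neg,
      dotProduct_sub_smul_one_mulVec, hform]
    linarith [(hbounds (WithLp.toLp 2 v)).2]

end
end
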